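/- Let g be a classical Lie superalgebra over ℂ and M a finite-dimensional g-supermodule that is semisimple over g₀. Then the ring H^•(g,g₀;ℂ) is finitely generated as a ℂ-algebra, and H^•(g,g₀;M) is finitely generated as an H^•(g,g₀;ℂ)-module. -/

import Mathlib

/-!
Core definitions: complex Lie superalgebras, supermodules, (even) morphisms,
subsuperalgebras, invariant subsupermodules, finite semisimplicity.
A Lie superalgebra `g = g₀ ⊕ g₁` is presented by its even part `V0`, odd part `V1`
and the three graded components of the bracket, subject to graded antisymmetry
and the graded Jacobi identity.
-/

noncomputable section

open scoped BigOperators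

/-- A complex Lie superalgebra `g = g₀ ⊕ g₁`. -/
structure LieSuperalgebra : Type 1 where
  V0 : Type
  V1 : Type
  [add0 : AddCommGroup V0]
  [mod0 : Module ℂ V0]
  [add1 : AddCommGroup V1]
  [mod1 : Module ℂ V1]
  b00 : V0 →ₗ[ℂ] V0 →ₗ[ℂ] V0
  b01 : V0 →ₗ[ℂ] V1 →ₗ[ℂ] V1
  b11 : V1 →ₗ[ℂ] V1 →ₗ[ℂ] V0
  b00_skew : ∀ x y, b00 x y = - b00 y x
  b11_symm : ∀ u v, b11 u v = b11 v u
  jacobi_000 : ∀ x y z, b00 x (b00 y z) = b00 (b00 x y) z + b00 y (b00 x z)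
  jacobi_001 : ∀ x y u, b01 x (b01 y u) = b01 (b00 x y) u + b01 y (b01 x u)
  jacobi_011 : ∀ x u v, b00 x (b11 u v) = b11 (b01 x u) v + b11 u (b01 x v)
  jacobi_111 : ∀ u v w, b01 (b11 u v) w + b01 (b11 v w) u + b01 (b11 w u) v = 0

attribute [instance] LieSuperalgebra.add0 LieSuperalgebra.mod0
attribute [instance] LieSuperalgebra.add1 LieSuperalgebra.mod1

/-- A supermodule `M = M₀ ⊕ M₁` over a Lie superalgebra `g`, given by the four
graded components of the action, subject to the graded module axioms. -/
structure SuperModule (g : LieSuperalgebra) : Type 1 where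
  M0 : Type
  M1 : Type
  [madd0 : AddCommGroup M0]
  [mmod0 : Module ℂ M0]
  [madd1 : AddCommGroup M1]
  [mmod1 : Module ℂ M1]
  a00 : g.V0 →ₗ[ℂ] M0 →ₗ[ℂ] M0
  a01 : g.V0 →ₗ[ℂ] M1 →ₗ[ℂ] M1
  a10 : g.V1 →ₗ[ℂ] M0 →ₗ[ℂ] M1
  a11 : g.V1 →ₗ[ℂ] M1 →ₗ[ℂ] M0
  rel_00_0 : ∀ x y m, a00 (g.b00 x y) m = a00 x (a00 y m) - a00 y (a00 x m)
  rel_00_1 : ∀ x y m, a01 (g.b00 x y) m = a01 x (a01 y m) - a01 y (a01 x m)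
  rel_01_0 : ∀ x u m, a10 (g.b01 x u) m = a01 x (a10 u m) - a10 u (a00 x m)
  rel_01_1 : ∀ x u m, a11 (g.b01 x u) m = a00 x (a11 u m) - a11 u (a01 x m)
  rel_11_0 : ∀ u v m, a00 (g.b11 u v) m = a11 u (a10 v m) + a11 v (a10 u m)
  rel_11_1 : ∀ u v m, a01 (g.b11 u v) m = a10 u (a11 v m) + a10 v (a11 u m)

attribute [instance] SuperModule.madd0 SuperModule.mmod0
attribute [instance] SuperModule.madd1 SuperModule.mmod1

namespace SuperModule

variable {g : LieSuperalgebra}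

/-- The trivial one-dimensional (purely even) supermodule `ℂ`. -/
def trivial (g : LieSuperalgebra) : SuperModule g where
  M0 := ℂ
  M1 := PUnit
  a00 := 0
  a01 := 0
  a10 := 0
  a11 := 0
  rel_00_0 := by intros; simp
  rel_00_1 := by intros; simp
  rel_01_0 := by intros; simp
  rel_01_1 := by intros; simp
  rel_11_0 := by intros; simp
  rel_11_1 := by intros; simp

/-- The pair of linear maps `f` is an (even) morphism of `g`-supermodules `M → N`. -/
def IsHom (M N : SuperModule g)
    (f : (M.M0 →ₗ[ℂ] N.M0) × (M.M1 →ₗ[ℂ] N.M1)) : Prop :=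
  (∀ x m, f.1 (M.a00 x m) = N.a00 x (f.1 m)) ∧
  (∀ x m, f.2 (M.a01 x m) = N.a01 x (f.2 m)) ∧
  (∀ u m, f.2 (M.a10 u m) = N.a10 u (f.1 m)) ∧
  (∀ u m, f.1 (M.a11 u m) = N.a11 u (f.2 m))

/-- The ℂ-vector space of even morphisms `M → N`. -/
def HomS (M N : SuperModule g) :
    Submodule ℂ ((M.M0 →ₗ[ℂ] N.M0) × (M.M1 →ₗ[ℂ] N.M1)) where
  carrier := {f | IsHom M N f}
  add_mem' := by
    rintro f f' ⟨h1, h2, h3, h4⟩ ⟨h1', h2', h3', h4'⟩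
    exact ⟨fun x m => by simp [h1, h1'], fun x m => by simp [h2, h2'],
      fun u m => by simp [h3, h3'], fun u m => by simp [h4, h4']⟩
  zero_mem' := ⟨fun x m => by simp, fun x m => by simp, fun u m => by simp,
    fun u m => by simp⟩
  smul_mem' := by
    rintro c f ⟨h1, h2, h3, h4⟩
    exact ⟨fun x m => by simp [h1], fun x m => by simp [h2],
      fun u m => by simp [h3], fun u m => by simp [h4]⟩

/-- `M` and `N` are isomorphic `g`-supermodules. -/
def Iso (M N : SuperModule g) : Prop :=
  ∃ f, IsHom M N f ∧ Function.Bijective f.1 ∧ Function.Bijective f.2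

/-- A supermodule is finite dimensional if both its graded pieces are. -/
def IsFiniteDimensional (M : SuperModule g) : Prop :=
  FiniteDimensional ℂ M.M0 ∧ FiniteDimensional ℂ M.M1

end SuperModule

/-- A Lie subsuperalgebra `t ⊆ g`, given by a pair of subspaces closed under
the bracket. -/
structure SubSuperalgebra (g : LieSuperalgebra) where
  t0 : Submodule ℂ g.V0
  t1 : Submodule ℂ g.V1
  closed00 : ∀ x ∈ t0, ∀ y ∈ t0, g.b00 x y ∈ t0
  closed01 : ∀ x ∈ t0, ∀ u ∈ t1, g.b01 x u ∈ t1
  closed11 : ∀ u ∈ t1, ∀ v ∈ t1, g.b11 u v ∈ t0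

namespace SubSuperalgebra

variable {g : LieSuperalgebra}

/-- The even part `g₀` viewed as a subsuperalgebra of `g`. -/
def evenPart (g : LieSuperalgebra) : SubSuperalgebra g where
  t0 := ⊤
  t1 := ⊥
  closed00 := fun _ _ _ _ => trivial
  closed01 := by
    rintro x - u hu
    simp only [Submodule.mem_bot] at hu ⊢
    simp [hu]
  closed11 := fun _ _ _ _ => trivial

/-- A `t`-invariant subsupermodule (pair of subspaces) of a `g`-supermodule `M`. -/
structure TSub (t : SubSuperalgebra g) (M : SuperModule g) where
  S0 : Submodule ℂ M.M0
  S1 : Submodule ℂ M.M1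
  inv00 : ∀ z ∈ t.t0, ∀ m ∈ S0, M.a00 z m ∈ S0
  inv01 : ∀ z ∈ t.t0, ∀ m ∈ S1, M.a01 z m ∈ S1
  inv10 : ∀ z ∈ t.t1, ∀ m ∈ S0, M.a10 z m ∈ S1
  inv11 : ∀ z ∈ t.t1, ∀ m ∈ S1, M.a11 z m ∈ S0

/-- A `t`-invariant subsupermodule is simple if it is nonzero and admits no proper
nonzero `t`-invariant subsupermodule. -/
def TSub.IsSimple {t : SubSuperalgebra g} {M : SuperModule g} (S : TSub t M) : Prop :=
  (S.S0 ≠ ⊥ ∨ S.S1 ≠ ⊥) ∧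
  ∀ S' : TSub t M, S'.S0 ≤ S.S0 → S'.S1 ≤ S.S1 →
    (S'.S0 = ⊥ ∧ S'.S1 = ⊥) ∨ (S'.S0 = S.S0 ∧ S'.S1 = S.S1)

/-- A `g`-supermodule `M` is finitely semisimple over the subsuperalgebra `t` if it is
a direct sum of finite-dimensional simple `t`-subsupermodules. -/
def FinSSOver (t : SubSuperalgebra g) (M : SuperModule g) : Prop :=
  ∃ (ι : Type) (S : ι → TSub t M),
    (∀ i, FiniteDimensional ℂ (S i).S0 ∧ FiniteDimensional ℂ (S i).S1) ∧
    (∀ i, (S i).IsSimple) ∧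
    iSupIndep (fun i => (S i).S0) ∧ iSupIndep (fun i => (S i).S1) ∧
    (⨆ i, (S i).S0) = ⊤ ∧ (⨆ i, (S i).S1) = ⊤

end SubSuperalgebra

/-- The adjoint supermodule: `g` acting on itself. -/
def LieSuperalgebra.adjoint (g : LieSuperalgebra) : SuperModule g where
  M0 := g.V0
  M1 := g.V1
  a00 := g.b00
  a01 := g.b01
  a10 := - g.b01.flip
  a11 := g.b11
  rel_00_0 := fun x y m => by
    rw [g.jacobi_000 x y m]; abel
  rel_00_1 := fun x y m => by
    rw [g.jacobi_001 x y m]; abel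
  rel_01_0 := fun x u m => by
    have h := g.jacobi_001 x m u
    have h' : g.b01 m (g.b01 x u) = g.b01 x (g.b01 m u) - g.b01 (g.b00 x m) u := by
      rw [h]; abel
    simp only [LinearMap.neg_apply, LinearMap.flip_apply, map_neg]
    rw [h']; abel
  rel_01_1 := fun x u m => by
    rw [g.jacobi_011 x u m]; abel
  rel_11_0 := fun u v m => by
    simp only [LinearMap.neg_apply, LinearMap.flip_apply, map_neg]
    rw [g.b00_skew (g.b11 u v) m, g.jacobi_011 m u v, g.b11_symm (g.b01 m u) v]
    abel
  rel_11_1 := fun u v m => by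
    have h := g.jacobi_111 u v m
    rw [g.b11_symm m u] at h
    simp only [LinearMap.neg_apply, LinearMap.flip_apply]
    have hA : g.b01 (g.b11 u v) m
        = g.b01 (g.b11 u v) m + g.b01 (g.b11 v m) u + g.b01 (g.b11 u m) v
          - g.b01 (g.b11 v m) u - g.b01 (g.b11 u m) v := by abel
    rw [hA, h]; abel

/-- `g` is finitely semisimple as a `t`-supermodule under the adjoint action. -/
def LieSuperalgebra.AdjFinSS (g : LieSuperalgebra) (t : SubSuperalgebra g) : Prop :=
  SubSuperalgebra.FinSSOver t g.adjoint
namespace RelCohomology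

variable (g : LieSuperalgebra)

/-- The space `Hom_{g₀}(Λᵖₛ(g/g₀), X) = Hom_{g₀}(Sᵖ(g₁), X)` of relative `p`-cochains
with values in a `g₀`-module `(X, ρ)`: since `g/g₀ ≅ g₁` is purely odd, these are the
`g₀`-equivariant symmetric `p`-multilinear maps `g₁ × ⋯ × g₁ → X`. -/
def cochain (p : ℕ) (X : Type) [AddCommGroup X] [Module ℂ X]
    (ρ : g.V0 →ₗ[ℂ] X →ₗ[ℂ] X) :
    Submodule ℂ (MultilinearMap ℂ (fun _ : Fin p => g.V1) X) where
  carrier := { φ |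
    (∀ (v : Fin p → g.V1) (σ : Equiv.Perm (Fin p)), φ (v ∘ σ) = φ v) ∧
    (∀ (x : g.V0) (v : Fin p → g.V1),
      ρ x (φ v) = ∑ i, φ (Function.update v i (g.b01 x (v i)))) }
  add_mem' := by
    rintro φ ψ ⟨h1, h2⟩ ⟨k1, k2⟩
    constructor
    · intro v σ
      simp [h1 v σ, k1 v σ]
    · intro x v
      simp [h2, k2, Finset.sum_add_distrib]
  zero_mem' := by constructor <;> intros <;> simp
  smul_mem' := by
    rintro c φ ⟨h1, h2⟩
    constructor
    · intro v σ; simp [h1 v σ]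
    · intro x v; simp [h2, Finset.smul_sum]

variable {g}

/-- The full space of relative `p`-cochains `C^p(g,g₀;M)` for a supermodule `M`,
decomposed according to the ℤ₂-grading of the target. -/
def Cochains (M : SuperModule g) (p : ℕ) : Type :=
  ↥(cochain g p M.M0 M.a00) × ↥(cochain g p M.M1 M.a01)

instance (M : SuperModule g) (p : ℕ) : AddCommGroup (Cochains M p) :=
  inferInstanceAs (AddCommGroup (_ × _))

instance (M : SuperModule g) (p : ℕ) : Module ℂ (Cochains M p) :=
  inferInstanceAs (Module ℂ (_ × _))

/-- The property that `d` is the Koszul differential of the relative cochain complex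
`C^•(g,g₀;M)`.  Since `[x_i,x_j] ∈ g₀` dies in `g/g₀`, only the second sum of the
Koszul differential survives, with sign `(-1)^{|φ|}` where the parity `|φ|` of the
component of `φ` mapping into `M_ε` is `p + ε (mod 2)`. -/
def IsKoszulDiff (M : SuperModule g) (d : ∀ p, Cochains M p →ₗ[ℂ] Cochains M (p + 1)) : Prop :=
  ∀ (p : ℕ) (φ : Cochains M p) (v : Fin (p + 1) → g.V1),
    (((d p φ).1 : MultilinearMap ℂ (fun _ : Fin (p+1) => g.V1) M.M0) v
      = ((-1 : ℂ)) ^ (p + 1) •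
          ∑ i, M.a11 (v i) ((φ.2 : MultilinearMap ℂ (fun _ : Fin p => g.V1) M.M1)
            (Fin.removeNth i v))) ∧
    (((d p φ).2 : MultilinearMap ℂ (fun _ : Fin (p+1) => g.V1) M.M1) v
      = ((-1 : ℂ)) ^ p •
          ∑ i, M.a10 (v i) ((φ.1 : MultilinearMap ℂ (fun _ : Fin p => g.V1) M.M0)
            (Fin.removeNth i v)))

/-- The subspace of coboundaries in degree `p` (the image of `d` in degree `p`,
which is `0` for `p = 0`). -/
def coboundaries {M : SuperModule g} (d : ∀ p, Cochains M p →ₗ[ℂ] Cochains M (p + 1)) :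
    ∀ p, Submodule ℂ (Cochains M p)
  | 0 => ⊥
  | (q + 1) => LinearMap.range (d q)

/-- The relative cohomology `H^p(g,g₀;M)` computed from a differential `d`. -/
def cohomology {M : SuperModule g} (d : ∀ p, Cochains M p →ₗ[ℂ] Cochains M (p + 1))
    (p : ℕ) : Type :=
  ↥(LinearMap.ker (d p)) ⧸
    (Submodule.comap (LinearMap.ker (d p)).subtype (coboundaries d p))

instance {M : SuperModule g} (d : ∀ p, Cochains M p →ₗ[ℂ] Cochains M (p + 1)) (p : ℕ) :
    AddCommGroup (cohomology d p) :=
  inferInstanceAs (AddCommGroup (_ ⧸ _))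

instance {M : SuperModule g} (d : ∀ p, Cochains M p →ₗ[ℂ] Cochains M (p + 1)) (p : ℕ) :
    Module ℂ (cohomology d p) :=
  inferInstanceAs (Module ℂ (_ ⧸ _))

end RelCohomology

/-! Classical structure: the connected reductive algebraic group `G₀` with
`Lie(G₀) = g₀`, acting compatibly on `g`.  The group is modeled abstractly; that its
action differentiates to the adjoint action of `g₀` (together with connectedness of
`G₀`) is recorded by the requirement that a multilinear form on `g₁` is
`G₀`-invariant if and only if it is `g₀`-invariant. -/

structure ClassicalStructure (g : LieSuperalgebra) : Type 1 where
  G : Type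
  [grp : Group G]
  ρ0 : Representation ℂ G g.V0
  ρ1 : Representation ℂ G g.V1
  compat00 : ∀ s x y, ρ0 s (g.b00 x y) = g.b00 (ρ0 s x) (ρ0 s y)
  compat01 : ∀ s x u, ρ1 s (g.b01 x u) = g.b01 (ρ0 s x) (ρ1 s u)
  compat11 : ∀ s u v, ρ0 s (g.b11 u v) = g.b11 (ρ1 s u) (ρ1 s v)
  findim0 : FiniteDimensional ℂ g.V0
  findim1 : FiniteDimensional ℂ g.V1
  reductive0 : ∀ (W : Submodule ℂ g.V0), (∀ s, W.map (ρ0 s) ≤ W) → ∃ W', IsCompl W W'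
    ∧ (∀ s, W'.map (ρ0 s) ≤ W')
  reductive1 : ∀ (W : Submodule ℂ g.V1), (∀ s, W.map (ρ1 s) ≤ W) → ∃ W', IsCompl W W'
    ∧ (∀ s, W'.map (ρ1 s) ≤ W')
  diff_adjoint : ∀ (n : ℕ) (f : MultilinearMap ℂ (fun _ : Fin n => g.V1) ℂ),
    (∀ (s : G) (v : Fin n → g.V1), f (fun i => ρ1 s (v i)) = f v) ↔
    (∀ (x : g.V0) (v : Fin n → g.V1),
      ∑ i, f (Function.update v i (g.b01 x (v i))) = 0)

attribute [instance] ClassicalStructure.grp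

namespace ClassicalStructure

variable {g : LieSuperalgebra}

/-- The category `ℱ = ℱ_{(g,g₀)}` of finite-dimensional `g`-supermodules that are
semisimple over `g₀`: its class of objects. -/
def InF (g : LieSuperalgebra) (M : SuperModule g) : Prop :=
  M.IsFiniteDimensional ∧ SubSuperalgebra.FinSSOver (SubSuperalgebra.evenPart g) M

/-- Degree-`n` polynomial maps `V → W` (the image of `Hom(Sⁿ(V), W)` in the space of
functions `V → W`), realized as the span of the maps `v ↦ l₁(v)⋯lₙ(v) • w`. -/
def polyMapsDeg (n : ℕ) (V W : Type) [AddCommGroup V] [Module ℂ V]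
    [AddCommGroup W] [Module ℂ W] : Submodule ℂ (V → W) :=
  Submodule.span ℂ
    { f | ∃ (l : Fin n → (V →ₗ[ℂ] ℂ)) (w : W), f = fun v => (∏ i, l i v) • w }

/-- The algebra of polynomial functions on `V` (the symmetric algebra `S(V*)`
realized as functions), i.e. the subalgebra of `V → ℂ` generated by the linear
functionals. -/
def polyFuns (V : Type) [AddCommGroup V] [Module ℂ V] : Subalgebra ℂ (V → ℂ) :=
  Algebra.adjoin ℂ (Set.range fun l : V →ₗ[ℂ] ℂ => (l : V → ℂ))

/-- Evaluation of a multilinear map on the diagonal; on symmetric multilinear maps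
this realizes `Hom(Sᵖ(V),W)` as degree-`p` polynomial maps. -/
def diagEval (p : ℕ) (V W : Type) [AddCommGroup V] [Module ℂ V]
    [AddCommGroup W] [Module ℂ W] :
    MultilinearMap ℂ (fun _ : Fin p => V) W →ₗ[ℂ] (V → W) where
  toFun := fun φ v => φ (fun _ => v)
  map_add' := fun φ ψ => by funext v; simp
  map_smul' := fun c φ => by funext v; simp

/-- The `G₀`-invariant polynomial functions `S(g₁*)^{G₀}` on `g₁`. -/
def invPolyFuns (C : ClassicalStructure g) : Subalgebra ℂ (g.V1 → ℂ) where
  carrier := { f | f ∈ polyFuns g.V1 ∧ ∀ (s : C.G) (v : g.V1), f (C.ρ1 s v) = f v }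
  add_mem' := by
    rintro f f' ⟨hf, hfi⟩ ⟨hf', hfi'⟩
    exact ⟨add_mem hf hf', fun s v => by simp [hfi s v, hfi' s v]⟩
  mul_mem' := by
    rintro f f' ⟨hf, hfi⟩ ⟨hf', hfi'⟩
    exact ⟨mul_mem hf hf', fun s v => by simp [hfi s v, hfi' s v]⟩
  algebraMap_mem' := fun c => ⟨Subalgebra.algebraMap_mem _ c, fun s v => rfl⟩

/-- The degree-`p` homogeneous `G₀`-invariant polynomial functions on `g₁`
(`Sᵖ(g₁*)^{G₀}`). -/
def invPolyDeg (C : ClassicalStructure g) (p : ℕ) : Submodule ℂ (g.V1 → ℂ) where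
  carrier := { f | f ∈ polyMapsDeg p g.V1 ℂ ∧ ∀ (s : C.G) (v : g.V1), f (C.ρ1 s v) = f v }
  add_mem' := by
    rintro f f' ⟨hf, hfi⟩ ⟨hf', hfi'⟩
    exact ⟨add_mem hf hf', fun s v => by simp [hfi s v, hfi' s v]⟩
  zero_mem' := ⟨zero_mem _, fun s v => rfl⟩
  smul_mem' := by
    rintro c f ⟨hf, hfi⟩
    exact ⟨Submodule.smul_mem _ c hf, fun s v => by simp [hfi s v]⟩

end ClassicalStructure

set_option linter.unusedSectionVars false

namespace KempfNess

section Multilinear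

variable {S E F : Type} [Fintype S] [DecidableEq S] [AddCommGroup E] [Module ℂ E]
  [AddCommGroup F] [Module ℂ F]

/-- The derivation action of an operator on the arguments of a multilinear map. -/
def der (z : E →ₗ[ℂ] E) (f : MultilinearMap ℂ (fun _ : S => E) F) (v : S → E) : F :=
  ∑ s, f (Function.update v s (z (v s)))

/-- An invariant form vanishes on generalized eigenvectors whose eigenvalues do not sum to zero. -/
lemma eq_zero_of_sum_eigenvalue_ne_zero (z : E →ₗ[ℂ] E)
    (f : MultilinearMap ℂ (fun _ : S => E) F) (hf : ∀ v, der z f v = 0)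
    (l : S → ℂ) (hl : ∑ s, l s ≠ 0) (v : S → E)
    (hv : ∀ s, v s ∈ Module.End.maxGenEigenspace z (l s)) : f v = 0 := by
  have key : ∀ (N : ℕ) (n : S → ℕ) (v : S → E), ∑ s, n s = N →
      (∀ s, ((z - algebraMap ℂ (Module.End ℂ E) (l s) : Module.End ℂ E) ^ n s) (v s) = 0) →
      f v = 0 := by
    intro N
    induction N using Nat.strong_induction_on with
    | _ N ih =>
      intro n v hn hv
      by_cases h0 : ∃ s, n s = 0
      · obtain ⟨s, hs⟩ := h0
        have := hv s
        rw [hs, pow_zero] at this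
        exact f.map_coord_zero s this
      push Not at h0
      have h1 : ∀ s, f (Function.update v s
          ((z - algebraMap ℂ (Module.End ℂ E) (l s) : Module.End ℂ E) (v s))) = 0 := by
        intro s
        refine ih (∑ t, Function.update n s (n s - 1) t) ?_ (Function.update n s (n s - 1)) _ rfl ?_
        · rw [← hn]
          refine Finset.sum_lt_sum (fun t _ => ?_) ⟨s, Finset.mem_univ _, ?_⟩
          · by_cases hts : t = s
            · subst hts; simp
            · simp [hts]
          · simpa using Nat.pos_of_ne_zero (h0 s)
        · intro t
          by_cases hts : t = s
          · subst hts
            have h2 := hv t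
            obtain ⟨k, hk⟩ := Nat.exists_eq_succ_of_ne_zero (h0 t)
            rw [hk, pow_succ, Module.End.mul_apply] at h2
            simpa [hk] using h2
          · simpa [hts] using hv t
      have h2 : (∑ s, l s) • f v = 0 := by
        rw [← hf v, der, Finset.sum_smul]
        refine Finset.sum_congr rfl fun s _ => ?_
        have h3 := h1 s
        rw [LinearMap.sub_apply, f.map_update_sub, sub_eq_zero] at h3
        rw [h3, Module.algebraMap_end_apply, f.map_update_smul, Function.update_eq_self]
      exact (smul_eq_zero.1 h2).resolve_left hl
  choose n hn using fun s => (Module.End.mem_maxGenEigenspace z (l s) (v s)).1 (hv s)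
  refine key _ n v rfl fun s => ?_
  have := hn s
  rwa [← Algebra.algebraMap_eq_smul_one] at this

end Multilinear

section Slot

variable {S ι : Type} [Fintype S] [DecidableEq S] [Fintype ι] [DecidableEq ι]

/-- A matrix acting on one index of an array. -/
def slot (s : S) (Z : Matrix ι ι ℂ) (F : (S → ι) → ℂ) : (S → ι) → ℂ :=
  fun j => ∑ i, Z (j s) i * F (Function.update j s i)

lemma slot_slot_same (s : S) (Z W : Matrix ι ι ℂ) (F : (S → ι) → ℂ) :
    slot s Z (slot s W F) = slot s (Z * W) F := by
  funext j
  simp only [slot, Function.update_self, Function.update_idem, Matrix.mul_apply, Finset.mul_sum,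
    Finset.sum_mul]
  rw [Finset.sum_comm]
  simp only [mul_assoc]

lemma slot_slot_comm {s t : S} (h : s ≠ t) (Z W : Matrix ι ι ℂ) (F : (S → ι) → ℂ) :
    slot s Z (slot t W F) = slot t W (slot s Z F) := by
  funext j
  simp only [slot, Finset.mul_sum]
  rw [Finset.sum_comm]
  refine Finset.sum_congr rfl fun i _ => Finset.sum_congr rfl fun k _ => ?_
  rw [Function.update_of_ne h.symm, Function.update_of_ne h, Function.update_comm h]
  ring

lemma slot_add (s : S) (Z : Matrix ι ι ℂ) (F G : (S → ι) → ℂ) :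
    slot s Z (F + G) = slot s Z F + slot s Z G := by
  funext j; simp [slot, mul_add, Finset.sum_add_distrib]

lemma slot_zero (s : S) (Z : Matrix ι ι ℂ) : slot s Z (0 : (S → ι) → ℂ) = 0 := by
  funext j; simp [slot]

lemma slot_sum {T : Type} (u : Finset T) (s : S) (Z : Matrix ι ι ℂ) (F : T → (S → ι) → ℂ) :
    slot s Z (∑ t ∈ u, F t) = ∑ t ∈ u, slot s Z (F t) := by
  classical
  induction u using Finset.induction_on with
  | empty => simp [slot_zero]
  | insert a u ha ih => rw [Finset.sum_insert ha, Finset.sum_insert ha, slot_add, ih]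

lemma slot_sub_left (s : S) (Z W : Matrix ι ι ℂ) (F : (S → ι) → ℂ) :
    slot s (Z - W) F = slot s Z F - slot s W F := by
  funext j; simp [slot, sub_mul]

lemma slot_sum_left {T : Type} (u : Finset T) (s : S) (Z : T → Matrix ι ι ℂ) (F : (S → ι) → ℂ) :
    slot s (∑ t ∈ u, Z t) F = ∑ t ∈ u, slot s (Z t) F := by
  funext j; simp only [slot, Finset.sum_apply, Matrix.sum_apply, Finset.sum_mul]
  rw [Finset.sum_comm]

/-- The standard Hermitian pairing on arrays. -/
def pairing {J : Type} [Fintype J] (F G : J → ℂ) : ℂ := ∑ j, F j * star (G j)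

lemma slot_adjoint (s : S) (Z : Matrix ι ι ℂ) (F G : (S → ι) → ℂ) :
    pairing (slot s Z F) G = pairing F (slot s Z.conjTranspose G) := by
  simp only [pairing, slot, Finset.sum_mul, star_sum, Finset.mul_sum]
  rw [← Fintype.sum_prod_type', ← Fintype.sum_prod_type']
  let e : (S → ι) × ι ≃ (S → ι) × ι :=
    { toFun := fun p => (Function.update p.1 s p.2, p.1 s)
      invFun := fun p => (Function.update p.1 s p.2, p.1 s)
      left_inv := fun p => by simp
      right_inv := fun p => by simp }
  refine Fintype.sum_equiv e _ _ fun p => ?_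
  simp only [e, Equiv.coe_fn_mk, Function.update_self, Function.update_idem,
    Function.update_eq_self, Matrix.conjTranspose_apply, star_mul', star_star]
  ring

/-- The sum of the actions of a matrix on all indices of an array. -/
def theta (Z : Matrix ι ι ℂ) (F : (S → ι) → ℂ) : (S → ι) → ℂ := ∑ s, slot s Z F

lemma theta_adjoint (Z : Matrix ι ι ℂ) (F G : (S → ι) → ℂ) :
    pairing (theta Z F) G = pairing F (theta Z.conjTranspose G) := by
  have h1 : pairing (theta Z F) G = ∑ s, pairing (slot s Z F) G := by
    simp only [pairing, theta, Finset.sum_apply, Finset.sum_mul]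
    rw [Finset.sum_comm]
  have h2 : pairing F (theta Z.conjTranspose G) = ∑ s, pairing F (slot s Z.conjTranspose G) := by
    simp only [pairing, theta, Finset.sum_apply, star_sum, Finset.mul_sum]
    rw [Finset.sum_comm]
  rw [h1, h2]
  exact Finset.sum_congr rfl fun s _ => slot_adjoint s Z F G

lemma theta_commutator (Z W : Matrix ι ι ℂ) (F : (S → ι) → ℂ) :
    theta Z (theta W F) - theta W (theta Z F) = theta (Z * W - W * Z) F := by
  have h : ∀ Z W : Matrix ι ι ℂ, theta Z (theta W F) =
      ∑ s, (slot s (Z * W) F + ∑ t ∈ Finset.univ.erase s, slot s Z (slot t W F)) := by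
    intro Z W
    refine Finset.sum_congr rfl fun s _ => ?_
    rw [theta, slot_sum, ← Finset.add_sum_erase _ _ (Finset.mem_univ s), slot_slot_same]
  have hc : ∑ s, ∑ t ∈ Finset.univ.erase s, slot s Z (slot t W F) =
      ∑ s : S, ∑ t ∈ Finset.univ.erase s, slot s W (slot t Z F) := by
    rw [Finset.sum_comm' (t' := Finset.univ) (s' := fun t => Finset.univ.erase t)]
    · refine Finset.sum_congr rfl fun s _ => Finset.sum_congr rfl fun t ht => ?_
      exact slot_slot_comm (Finset.ne_of_mem_erase ht) Z W F
    · intro x y; simp [eq_comm]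
  rw [h, h, Finset.sum_add_distrib, Finset.sum_add_distrib, hc, add_sub_add_right_eq_sub,
    ← Finset.sum_sub_distrib]
  exact Finset.sum_congr rfl fun s _ => (slot_sub_left s _ _ F).symm

lemma theta_sum_left {T : Type} (u : Finset T) (Z : T → Matrix ι ι ℂ) (F : (S → ι) → ℂ) :
    theta (∑ t ∈ u, Z t) F = ∑ t ∈ u, theta (Z t) F := by
  simp only [theta, slot_sum_left]
  rw [Finset.sum_comm]

lemma theta_zero (Z : Matrix ι ι ℂ) : theta Z (0 : (S → ι) → ℂ) = 0 := by
  simp [theta, slot_zero]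

lemma pairing_self_re_nonneg {J : Type} [Fintype J] (F : J → ℂ) : 0 ≤ (pairing F F).re := by
  simp only [pairing, Complex.re_sum]
  refine Finset.sum_nonneg fun j _ => ?_
  rw [Complex.star_def, Complex.mul_conj]
  exact_mod_cast Complex.normSq_nonneg _

end Slot

section Positivity

variable {α : Type} [Fintype α] {A E : Type} [AddCommGroup A] [Module ℂ A] [AddCommGroup E]
  [Module ℂ E]

/-- The moment map of a tuple of matrices. -/
def moment {ι : Type} [Fintype ι] (X : α → Matrix ι ι ℂ) : Matrix ι ι ℂ :=
  ∑ a, (X a * (X a).conjTranspose - (X a).conjTranspose * X a)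

/-- A spanning family of generalized eigenvectors of `z` for which the moment map of the action
is diagonal on each generalized eigenspace. -/
structure Frame (ρ : A →ₗ[ℂ] E →ₗ[ℂ] E) (a : α → A) (z : A) : Type 1 where
  ι : Type
  [fin : Fintype ι]
  [dec : DecidableEq ι]
  e : ι → E
  span_e : Submodule.span ℂ (Set.range e) = ⊤
  X : α → Matrix ι ι ℂ
  apply_e : ∀ t j, ρ (a t) (e j) = ∑ l, X t l j • e l
  μ : ι → ℂ
  mem_eig : ∀ i, e i ∈ Module.End.maxGenEigenspace (ρ z) (μ i)
  off : ∀ i j, i ≠ j → μ i = μ j → moment X i j = 0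

attribute [instance] Frame.fin Frame.dec

/-- The margin of a frame at an index. -/
def Frame.κ {ρ : A →ₗ[ℂ] E →ₗ[ℂ] E} {a : α → A} {z : A} (Φ : Frame ρ a z) (τ : ℂ →+ ℝ)
    (i : Φ.ι) : ℝ := (moment Φ.X i i).re - τ (Φ.μ i)

lemma moment_transpose {ι : Type} [Fintype ι] (X : α → Matrix ι ι ℂ) :
    ∑ a, ((X a).transpose * (X a).transpose.conjTranspose -
      (X a).transpose.conjTranspose * (X a).transpose) = - (moment X).transpose := by
  simp only [moment, Matrix.transpose_sum, ← Finset.sum_neg_distrib]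
  refine Finset.sum_congr rfl fun a _ => ?_
  rw [Matrix.transpose_sub, Matrix.transpose_mul, Matrix.transpose_mul, neg_sub]
  simp only [Matrix.conjTranspose, Matrix.transpose_map, Matrix.transpose_transpose]

variable {S : Type} [Fintype S] [DecidableEq S]

theorem Frame.exists_sum_nonpos {ρ : A →ₗ[ℂ] E →ₗ[ℂ] E} {a : α → A} {z : A} (Φ : Frame ρ a z)
    (τ : ℂ →+ ℝ) (f : MultilinearMap ℂ (fun _ : S => E) ℂ) (hf : ∀ x v, der (ρ x) f v = 0)
    (j₀ : S → Φ.ι) (hj₀ : f (Φ.e ∘ j₀) ≠ 0) :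
    ∃ j : S → Φ.ι, f (Φ.e ∘ j) ≠ 0 ∧ ∑ s, Φ.κ τ (j s) ≤ 0 := by
  set F : (S → Φ.ι) → ℂ := fun j => f (Φ.e ∘ j) with hF
  have hupd : ∀ (j : S → Φ.ι) s i, Φ.e ∘ Function.update j s i =
      Function.update (Φ.e ∘ j) s (Φ.e i) := fun j s i => Function.comp_update _ _ _ _
  have hθ : ∀ t, theta (Φ.X t).transpose F = 0 := by
    intro t
    funext j
    have := hf (a t) (Φ.e ∘ j)
    rw [Pi.zero_apply, ← this, der, theta, Finset.sum_apply]
    refine Finset.sum_congr rfl fun s _ => ?_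
    simp only [slot, Function.comp_apply, Φ.apply_e, f.map_update_sum, f.map_update_smul,
      Matrix.transpose_apply, hF, hupd, smul_eq_mul]
  have hμ : ∀ j, F j ≠ 0 → ∑ s, Φ.μ (j s) = 0 := by
    intro j hj
    by_contra h
    exact hj (eq_zero_of_sum_eigenvalue_ne_zero (ρ z) f (hf z) (fun s => Φ.μ (j s)) h _
      fun s => Φ.mem_eig _)
  have h1 : (pairing (theta (moment Φ.X).transpose F) F).re ≤ 0 := by
    have h2 : theta (∑ t, ((Φ.X t).transpose * (Φ.X t).transpose.conjTranspose -
      (Φ.X t).transpose.conjTranspose * (Φ.X t).transpose)) F =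
        ∑ t, theta (Φ.X t).transpose (theta (Φ.X t).transpose.conjTranspose F) := by
      rw [theta_sum_left]
      refine Finset.sum_congr rfl fun t _ => ?_
      rw [← theta_commutator, hθ, theta_zero, sub_zero]
    rw [moment_transpose] at h2
    have h3 : theta (-(moment Φ.X).transpose) F = - theta (moment Φ.X).transpose F := by
      funext j; simp [theta, slot]
    have h4 : pairing (theta (moment Φ.X).transpose F) F =
        - ∑ t, pairing (theta (Φ.X t).transpose.conjTranspose F)
          (theta (Φ.X t).transpose.conjTranspose F) := by
      rw [h3] at h2
      rw [neg_eq_iff_eq_neg.1 h2]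
      have : ∀ t, pairing (theta (Φ.X t).transpose.conjTranspose F)
          (theta (Φ.X t).transpose.conjTranspose F) =
          pairing (theta (Φ.X t).transpose (theta (Φ.X t).transpose.conjTranspose F)) F :=
        fun t => (theta_adjoint _ _ _).symm
      simp only [this]
      simp only [pairing, Pi.neg_apply, Finset.sum_apply, neg_mul, Finset.sum_mul,
        Finset.sum_neg_distrib]
      rw [Finset.sum_comm]
    rw [h4, Complex.neg_re, Complex.re_sum, neg_nonpos]
    exact Finset.sum_nonneg fun t _ => pairing_self_re_nonneg _
  have h5 : (pairing (theta (moment Φ.X).transpose F) F).re =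
      ∑ j, (∑ s, Φ.κ τ (j s)) * Complex.normSq (F j) := by
    rw [pairing, Complex.re_sum]
    refine Finset.sum_congr rfl fun j _ => ?_
    by_cases hj : F j = 0
    · simp [hj]
    have h6 : theta (moment Φ.X).transpose F j =
        (∑ s, moment Φ.X (j s) (j s)) * F j := by
      rw [theta, Finset.sum_apply, Finset.sum_mul]
      refine Finset.sum_congr rfl fun s _ => ?_
      rw [slot, Finset.sum_eq_single (j s)]
      · simp [Matrix.transpose_apply]
      · intro i _ hi
        by_cases hFi : F (Function.update j s i) = 0
        · simp [hFi]
        have e1 := hμ _ hFi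
        have e2 := hμ _ hj
        rw [← Finset.add_sum_erase _ _ (Finset.mem_univ s)] at e1 e2
        have e3 : ∑ t ∈ Finset.univ.erase s, Φ.μ (Function.update j s i t) =
            ∑ t ∈ Finset.univ.erase s, Φ.μ (j t) :=
          Finset.sum_congr rfl fun t ht => by
            rw [Function.update_of_ne (Finset.ne_of_mem_erase ht)]
        rw [e3, Function.update_self] at e1
        have e4 : Φ.μ i = Φ.μ (j s) := add_right_cancel (e1.trans e2.symm)
        rw [Matrix.transpose_apply, Φ.off _ _ hi e4, zero_mul]
      · simp
    rw [h6, mul_assoc, Complex.star_def, Complex.mul_conj, Complex.re_mul_ofReal, Complex.re_sum]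
    congr 1
    have : ∑ s, τ (Φ.μ (j s)) = 0 := by rw [← map_sum, hμ j hj, map_zero]
    simp only [Frame.κ, Finset.sum_sub_distrib, this, sub_zero]
  rw [h5] at h1
  by_contra hcon
  push Not at hcon
  refine absurd h1 (not_le.2 (Finset.sum_pos' (fun j _ => ?_) ⟨j₀, Finset.mem_univ _, ?_⟩))
  · by_cases hj : F j = 0
    · simp [hj]
    · exact mul_nonneg (hcon j hj).le (Complex.normSq_nonneg _)
  · exact mul_pos (hcon j₀ hj₀) (Complex.normSq_pos.2 hj₀)

end Positivity

/-- The product of two actions. -/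
def prodAct {A E E' : Type} [AddCommGroup A] [Module ℂ A] [AddCommGroup E] [Module ℂ E]
    [AddCommGroup E'] [Module ℂ E'] (ρ : A →ₗ[ℂ] E →ₗ[ℂ] E) (ρ' : A →ₗ[ℂ] E' →ₗ[ℂ] E') :
    A →ₗ[ℂ] E × E' →ₗ[ℂ] E × E' where
  toFun x := (ρ x).prodMap (ρ' x)
  map_add' x y := by ext <;> simp
  map_smul' c x := by ext <;> simp

section Prod

variable {α : Type} [Fintype α] {A E E' : Type} [AddCommGroup A] [Module ℂ A] [AddCommGroup E]
  [Module ℂ E] [AddCommGroup E'] [Module ℂ E']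

@[simp] lemma prodAct_apply (ρ : A →ₗ[ℂ] E →ₗ[ℂ] E) (ρ' : A →ₗ[ℂ] E' →ₗ[ℂ] E') (x : A)
    (p : E × E') : prodAct ρ ρ' x p = (ρ x p.1, ρ' x p.2) := rfl

lemma moment_fromBlocks {ι κ : Type} [Fintype ι] [Fintype κ] (X : α → Matrix ι ι ℂ)
    (Y : α → Matrix κ κ ℂ) :
    moment (fun t => Matrix.fromBlocks (X t) 0 0 (Y t)) =
      Matrix.fromBlocks (moment X) 0 0 (moment Y) := by
  classical
  ext i j
  rcases i with i | i <;> rcases j with j | j <;>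
    simp [moment, Matrix.fromBlocks_conjTranspose, Matrix.fromBlocks_multiply, Matrix.sum_apply]

lemma mem_maxGenEigenspace_map {V W : Type} [AddCommGroup V] [Module ℂ V] [AddCommGroup W]
    [Module ℂ W] (f : V →ₗ[ℂ] V) (g : W →ₗ[ℂ] W) (i : V →ₗ[ℂ] W) (h : ∀ v, i (f v) = g (i v))
    {c : ℂ} {v : V} (hv : v ∈ Module.End.maxGenEigenspace f c) :
    i v ∈ Module.End.maxGenEigenspace g c := by
  rw [Module.End.mem_maxGenEigenspace] at hv ⊢
  obtain ⟨k, hk⟩ := hv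
  refine ⟨k, ?_⟩
  have : ∀ (k : ℕ) v, i (((f - c • (1 : Module.End ℂ V) : Module.End ℂ V) ^ k) v) =
      ((g - c • (1 : Module.End ℂ W) : Module.End ℂ W) ^ k) (i v) := by
    intro k
    induction k with
    | zero => simp
    | succ k ih => intro v; rw [pow_succ, pow_succ, Module.End.mul_apply, ih]; simp [h]
  rw [← this, hk, map_zero]

/-- The union of two frames. -/
def Frame.prod {ρ : A →ₗ[ℂ] E →ₗ[ℂ] E} {ρ' : A →ₗ[ℂ] E' →ₗ[ℂ] E'} {a : α → A} {z : A}
    (Φ : Frame ρ a z) (Ψ : Frame ρ' a z) : Frame (prodAct ρ ρ') a z where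
  ι := Φ.ι ⊕ Ψ.ι
  e := Sum.elim (fun i => (Φ.e i, 0)) (fun i => (0, Ψ.e i))
  span_e := by
    rw [Set.Sum.elim_range, Submodule.span_union]
    have h1 : Set.range (fun i => ((Φ.e i, 0) : E × E')) =
        LinearMap.inl ℂ E E' '' Set.range Φ.e := by rw [← Set.range_comp]; rfl
    have h2 : Set.range (fun i => ((0, Ψ.e i) : E × E')) =
        LinearMap.inr ℂ E E' '' Set.range Ψ.e := by rw [← Set.range_comp]; rfl
    rw [h1, h2, Submodule.span_image, Submodule.span_image, Φ.span_e, Ψ.span_e, Submodule.map_top,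
      Submodule.map_top, LinearMap.sup_range_inl_inr]
  X t := Matrix.fromBlocks (Φ.X t) 0 0 (Ψ.X t)
  apply_e t j := by
    rcases j with j | j
    · simp [Φ.apply_e, Prod.ext_iff, Prod.fst_sum, Prod.snd_sum]
    · simp [Ψ.apply_e, Prod.ext_iff, Prod.fst_sum, Prod.snd_sum]
  μ := Sum.elim Φ.μ Ψ.μ
  mem_eig i := by
    rcases i with i | i
    · exact mem_maxGenEigenspace_map (ρ z) _ (LinearMap.inl ℂ E E') (fun v => by simp)
        (Φ.mem_eig i)
    · exact mem_maxGenEigenspace_map (ρ' z) _ (LinearMap.inr ℂ E E') (fun v => by simp)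
        (Ψ.mem_eig i)
  off i j hij hμ := by
    rw [moment_fromBlocks]
    rcases i with i | i <;> rcases j with j | j
    · exact Φ.off i j (fun h => hij (h ▸ rfl)) hμ
    · rfl
    · rfl
    · exact Ψ.off i j (fun h => hij (h ▸ rfl)) hμ

lemma Frame.prod_κ_inl {ρ : A →ₗ[ℂ] E →ₗ[ℂ] E} {ρ' : A →ₗ[ℂ] E' →ₗ[ℂ] E'} {a : α → A} {z : A}
    (Φ : Frame ρ a z) (Ψ : Frame ρ' a z) (τ : ℂ →+ ℝ) (i : Φ.ι) :
    (Φ.prod Ψ).κ τ (Sum.inl i) = Φ.κ τ i := by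
  exact congrArg (fun c : ℂ => c.re - τ (Φ.μ i))
    (congrFun₂ (moment_fromBlocks Φ.X Ψ.X) (Sum.inl i) (Sum.inl i))

lemma Frame.prod_κ_inr {ρ : A →ₗ[ℂ] E →ₗ[ℂ] E} {ρ' : A →ₗ[ℂ] E' →ₗ[ℂ] E'} {a : α → A} {z : A}
    (Φ : Frame ρ a z) (Ψ : Frame ρ' a z) (τ : ℂ →+ ℝ) (i : Ψ.ι) :
    (Φ.prod Ψ).κ τ (Sum.inr i) = Ψ.κ τ i := by
  exact congrArg (fun c : ℂ => c.re - τ (Ψ.μ i))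
    (congrFun₂ (moment_fromBlocks Φ.X Ψ.X) (Sum.inr i) (Sum.inr i))

end Prod

section Blocks

variable {ι : Type} [Fintype ι] [DecidableEq ι] {μ : ι → ℂ}

/-- A matrix is blockwise if its entries between different labels vanish. -/
def IsBlk (μ : ι → ℂ) (g : Matrix ι ι ℂ) : Prop := ∀ i j, μ i ≠ μ j → g i j = 0

lemma IsBlk.mul {g h : Matrix ι ι ℂ} (hg : IsBlk μ g) (hh : IsBlk μ h) : IsBlk μ (g * h) := by
  intro i j hij
  rw [Matrix.mul_apply]
  refine Finset.sum_eq_zero fun l _ => ?_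
  by_cases hl : μ i = μ l
  · rw [hh l j (hl ▸ hij), mul_zero]
  · rw [hg i l hl, zero_mul]

lemma IsBlk.conjTranspose {g : Matrix ι ι ℂ} (hg : IsBlk μ g) : IsBlk μ g.conjTranspose := by
  intro i j hij
  rw [Matrix.conjTranspose_apply, hg j i hij.symm, star_zero]

lemma isBlk_diagonal (d : ι → ℂ) : IsBlk μ (Matrix.diagonal d) := by
  intro i j hij
  exact Matrix.diagonal_apply_ne _ fun h => hij (h ▸ rfl)

lemma isBlk_one : IsBlk μ (1 : Matrix ι ι ℂ) := isBlk_diagonal _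

/-- Blockwise unitary matrices. -/
def blkUnitary (μ : ι → ℂ) : Set (Matrix ι ι ℂ) :=
  {V | V * V.conjTranspose = 1 ∧ V.conjTranspose * V = 1 ∧ IsBlk μ V}

lemma one_mem_blkUnitary : (1 : Matrix ι ι ℂ) ∈ blkUnitary μ := by
  simp [blkUnitary, isBlk_one]

lemma conjTranspose_mem_blkUnitary {U : Matrix ι ι ℂ} (hU : U ∈ blkUnitary μ) :
    U.conjTranspose ∈ blkUnitary μ :=
  ⟨by rw [Matrix.conjTranspose_conjTranspose]; exact hU.2.1,
    by rw [Matrix.conjTranspose_conjTranspose]; exact hU.1, hU.2.2.conjTranspose⟩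

/-- The spectral theorem for blockwise Hermitian matrices. -/
lemma exists_blkUnitary_diagonalize {H : Matrix ι ι ℂ} (hH : H.IsHermitian) (hb : IsBlk μ H) :
    ∃ V ∈ blkUnitary μ, ∃ d : ι → ℝ,
      H = V.conjTranspose * Matrix.diagonal (fun i => (d i : ℂ)) * V := by
  classical
  let K := Set.range μ
  let f : ι → K := Set.rangeFactorization μ
  let e : (Σ k : K, {i // f i = k}) ≃ ι := Equiv.sigmaFiberEquiv f
  have hef : ∀ p, f (e p) = p.1 := fun p => p.2.2
  let B : ∀ k : K, Matrix {i // f i = k} {i // f i = k} ℂ := fun k => H.submatrix (↑) (↑)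
  have hB : ∀ k, (B k).IsHermitian := fun k => hH.submatrix _
  have hHB : H.submatrix e e = Matrix.blockDiagonal' B := by
    ext ⟨k, i⟩ ⟨l, j⟩
    by_cases hkl : k = l
    · subst hkl
      rw [Matrix.blockDiagonal'_apply_eq]
      rfl
    · rw [Matrix.blockDiagonal'_apply_ne _ _ _ hkl]
      refine hb _ _ fun h => hkl ?_
      have h1 := hef ⟨k, i⟩
      have h2 := hef ⟨l, j⟩
      exact h1.symm.trans ((Subtype.ext h : f (e ⟨k, i⟩) = f (e ⟨l, j⟩)).trans h2)
  let U : ∀ k : K, Matrix {i // f i = k} {i // f i = k} ℂ := fun k =>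
    (hB k).eigenvectorUnitary
  have hU1 : ∀ k, U k * (U k).conjTranspose = 1 := fun k =>
    Matrix.mem_unitaryGroup_iff.1 (hB k).eigenvectorUnitary.2
  have hU2 : ∀ k, (U k).conjTranspose * U k = 1 := fun k =>
    Matrix.mem_unitaryGroup_iff'.1 (hB k).eigenvectorUnitary.2
  let d' : (Σ k : K, {i // f i = k}) → ℝ := fun p => (hB p.1).eigenvalues p.2
  have hsp : ∀ k, B k = U k * Matrix.diagonal (fun i => ((hB k).eigenvalues i : ℂ)) *
      (U k).conjTranspose := fun k => by
    have h0 := (hB k).spectral_theorem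
    simpa [Unitary.conjStarAlgAut_apply, Matrix.star_eq_conjTranspose, Function.comp_def, U]
      using h0
  let W := (Matrix.blockDiagonal' U).submatrix e.symm e.symm
  have hW1 : W * W.conjTranspose = 1 := by
    simp only [W, Matrix.conjTranspose_submatrix, Matrix.submatrix_mul_equiv]
    rw [Matrix.blockDiagonal'_conjTranspose, ← Matrix.blockDiagonal'_mul, funext hU1]
    exact (congrArg (fun N => Matrix.submatrix N e.symm e.symm)
      Matrix.blockDiagonal'_one).trans (Matrix.submatrix_one_equiv _)
  have hW2 : W.conjTranspose * W = 1 := by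
    simp only [W, Matrix.conjTranspose_submatrix, Matrix.submatrix_mul_equiv]
    rw [Matrix.blockDiagonal'_conjTranspose, ← Matrix.blockDiagonal'_mul, funext hU2]
    exact (congrArg (fun N => Matrix.submatrix N e.symm e.symm)
      Matrix.blockDiagonal'_one).trans (Matrix.submatrix_one_equiv _)
  have hWb : IsBlk μ W := by
    intro i j hij
    refine (Matrix.blockDiagonal'_apply U _ _).trans (dif_neg fun h => hij ?_)
    have h1 := hef (e.symm i)
    have h2 := hef (e.symm j)
    rw [e.apply_symm_apply] at h1 h2
    exact congrArg Subtype.val (h1.trans (h.trans h2.symm))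
  refine ⟨W.conjTranspose, conjTranspose_mem_blkUnitary ⟨hW1, hW2, hWb⟩,
    fun i => d' (e.symm i), ?_⟩
  have hd : Matrix.diagonal (fun i => (d' (e.symm i) : ℂ)) =
      (Matrix.blockDiagonal' fun k => Matrix.diagonal
        (fun i => ((hB k).eigenvalues i : ℂ))).submatrix e.symm e.symm := by
    rw [Matrix.blockDiagonal'_diagonal, Matrix.submatrix_diagonal_equiv]
    rfl
  rw [Matrix.conjTranspose_conjTranspose, hd]
  simp only [W, Matrix.conjTranspose_submatrix, Matrix.submatrix_mul_equiv]
  rw [Matrix.blockDiagonal'_conjTranspose, ← Matrix.blockDiagonal'_mul,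
    ← Matrix.blockDiagonal'_mul, ← funext hsp, ← hHB]
  simp

/-- Singular value decomposition for invertible blockwise matrices. -/
lemma exists_blk_svd {g h : Matrix ι ι ℂ} (hg : IsBlk μ g) (hgh : g * h = 1) :
    ∃ U ∈ blkUnitary μ, ∃ V ∈ blkUnitary μ, ∃ s : ι → ℝ,
      g = U * Matrix.diagonal (fun i => (Real.exp (s i) : ℂ)) * V := by
  have hhg : h * g = 1 := mul_eq_one_comm.1 hgh
  obtain ⟨V, hV, d, hd⟩ := exists_blkUnitary_diagonalize (μ := μ)
    (Matrix.isHermitian_conjTranspose_mul_self g) (hg.conjTranspose.mul hg)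
  have hd' : Matrix.diagonal (fun i => (d i : ℂ)) =
      (g * V.conjTranspose).conjTranspose * (g * V.conjTranspose) := by
    rw [Matrix.conjTranspose_mul, Matrix.conjTranspose_conjTranspose, Matrix.mul_assoc V,
      ← Matrix.mul_assoc _ g, hd, Matrix.mul_assoc _ V, hV.1, Matrix.mul_one,
      ← Matrix.mul_assoc, hV.1, Matrix.one_mul]
  have hdpos : ∀ i, 0 < d i := by
    intro i
    have h1 := congrFun₂ hd' i i
    rw [Matrix.diagonal_apply_eq, Matrix.mul_apply] at h1
    have h2 : d i = ∑ j, Complex.normSq ((g * V.conjTranspose) j i) := by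
      have h3 : (d i : ℂ) = ((∑ j, Complex.normSq ((g * V.conjTranspose) j i) : ℝ) : ℂ) := by
        rw [h1]
        push_cast
        refine Finset.sum_congr rfl fun j _ => ?_
        rw [Matrix.conjTranspose_apply, mul_comm, Complex.star_def, Complex.mul_conj]
      exact_mod_cast h3
    rw [h2]
    by_contra hcon
    have h4 : ∀ j, (g * V.conjTranspose) j i = 0 := by
      intro j
      have h5 := (Finset.sum_eq_zero_iff_of_nonneg fun j _ =>
        Complex.normSq_nonneg ((g * V.conjTranspose) j i)).1
        (le_antisymm (not_lt.1 hcon) (Finset.sum_nonneg fun j _ => Complex.normSq_nonneg _)) j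
        (Finset.mem_univ _)
      exact Complex.normSq_eq_zero.1 h5
    have h6 : (V * h) * (g * V.conjTranspose) = 1 := by
      rw [Matrix.mul_assoc, ← Matrix.mul_assoc h, hhg, Matrix.one_mul, hV.1]
    have h7 := congrFun₂ h6 i i
    rw [Matrix.mul_apply, Matrix.one_apply_eq] at h7
    simp [h4] at h7
  set s : ι → ℝ := fun i => Real.log (d i) / 2 with hs
  have hexp : ∀ i, Real.exp (s i) * Real.exp (s i) = d i := by
    intro i
    rw [← Real.exp_add, hs]
    simp [Real.exp_log (hdpos i)]
  set D : Matrix ι ι ℂ := Matrix.diagonal (fun i => (Real.exp (s i) : ℂ)) with hD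
  set D' : Matrix ι ι ℂ := Matrix.diagonal (fun i => (Real.exp (-s i) : ℂ)) with hD'
  have hDD : D' * D = 1 := by
    rw [hD, hD', Matrix.diagonal_mul_diagonal, ← Matrix.diagonal_one]
    congr 1; funext i
    rw [← Complex.ofReal_mul, ← Real.exp_add]; simp
  have hD's : D'.conjTranspose = D' := by
    rw [hD', Matrix.diagonal_conjTranspose]
    congr 1; funext i; exact Complex.conj_ofReal _
  have hUU : (g * V.conjTranspose * D').conjTranspose * (g * V.conjTranspose * D') = 1 := by
    rw [Matrix.conjTranspose_mul _ D', Matrix.mul_assoc, ← Matrix.mul_assoc _ (g * _), ← hd', hD's]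
    rw [hD', Matrix.diagonal_mul_diagonal, Matrix.diagonal_mul_diagonal, ← Matrix.diagonal_one]
    congr 1; funext i
    rw [← hexp i, ← Complex.ofReal_mul, ← Complex.ofReal_mul, ← Real.exp_add, ← Real.exp_add,
      ← Real.exp_add]
    simp
  refine ⟨g * V.conjTranspose * D', ⟨mul_eq_one_comm.1 hUU, hUU,
    (hg.mul hV.2.2.conjTranspose).mul (isBlk_diagonal _)⟩, V, hV, s, ?_⟩
  rw [← hD, Matrix.mul_assoc _ D', hDD, Matrix.mul_one, Matrix.mul_assoc, hV.2.1, Matrix.mul_one]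

/-- The squared Frobenius norm. -/
def nF (Y : Matrix ι ι ℂ) : ℝ := ∑ i, ∑ j, Complex.normSq (Y i j)

lemma nF_eq_trace (Y : Matrix ι ι ℂ) : (nF Y : ℂ) = (Y * Y.conjTranspose).trace := by
  simp [nF, Matrix.trace, Matrix.mul_apply, Complex.mul_conj]

lemma nF_unitary_mul {U Y : Matrix ι ι ℂ} (hU : U.conjTranspose * U = 1) : nF (U * Y) = nF Y := by
  have : (nF (U * Y) : ℂ) = nF Y := by
    rw [nF_eq_trace, nF_eq_trace, Matrix.conjTranspose_mul, Matrix.mul_assoc, Matrix.trace_mul_comm,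
      Matrix.mul_assoc, Matrix.mul_assoc, hU, Matrix.mul_one]
  exact_mod_cast this

lemma nF_mul_unitary {U Y : Matrix ι ι ℂ} (hU : U * U.conjTranspose = 1) : nF (Y * U) = nF Y := by
  have : (nF (Y * U) : ℂ) = nF Y := by
    rw [nF_eq_trace, nF_eq_trace, Matrix.conjTranspose_mul, Matrix.mul_assoc, ← Matrix.mul_assoc U,
      hU, Matrix.one_mul]
  exact_mod_cast this

/-- A weighted sum of the logarithms of the absolute values of the block determinants. -/
def logChar (μ : ι → ℂ) (c : ℂ → ℝ) (g : Matrix ι ι ℂ) : ℝ :=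
  ∑ k ∈ Finset.univ.image μ, c k * Real.log ‖(g.toSquareBlock μ k).det‖

lemma toSquareBlock_mul {g h : Matrix ι ι ℂ} (hg : IsBlk μ g) (k : ℂ) :
    (g * h).toSquareBlock μ k = g.toSquareBlock μ k * h.toSquareBlock μ k := by
  ext ⟨i, hi⟩ ⟨j, hj⟩
  have h1 : ∑ l, g i l * h l j = ∑ l with μ l = k, g i l * h l j := by
    rw [Finset.sum_filter]
    refine Finset.sum_congr rfl fun l _ => ?_
    split_ifs with hl
    · rfl
    · rw [hg i l (hi ▸ Ne.symm hl), zero_mul]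
  rw [Matrix.toSquareBlock_def, Matrix.of_apply, Matrix.mul_apply, Matrix.mul_apply, h1]
  exact Finset.sum_subtype _ (by simp) _

end Blocks

section Minimum

variable {ι : Type} [Fintype ι] [DecidableEq ι] {μ : ι → ℂ}

lemma toSquareBlock_one (k : ℂ) : (1 : Matrix ι ι ℂ).toSquareBlock μ k = 1 := by
  ext ⟨i, hi⟩ ⟨j, hj⟩
  simp [Matrix.toSquareBlock_def, Matrix.one_apply]

lemma det_toSquareBlock_ne_zero {g h : Matrix ι ι ℂ} (hg : IsBlk μ g) (hgh : g * h = 1) (k : ℂ) :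
    (g.toSquareBlock μ k).det ≠ 0 := by
  have := toSquareBlock_mul (h := h) hg k
  rw [hgh, toSquareBlock_one] at this
  have h2 := congrArg Matrix.det this
  rw [Matrix.det_one, Matrix.det_mul] at h2
  intro h0
  rw [h0, zero_mul] at h2
  exact one_ne_zero h2

lemma logChar_mul (c : ℂ → ℝ) {g g' h h' : Matrix ι ι ℂ} (hg : IsBlk μ g) (hgg : g * g' = 1)
    (hh : IsBlk μ h) (hhh : h * h' = 1) :
    logChar μ c (g * h) = logChar μ c g + logChar μ c h := by
  simp only [logChar, ← Finset.sum_add_distrib]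
  refine Finset.sum_congr rfl fun k _ => ?_
  rw [toSquareBlock_mul hg, Matrix.det_mul, norm_mul, Real.log_mul, mul_add]
  · exact norm_ne_zero_iff.2 (det_toSquareBlock_ne_zero hg hgg k)
  · exact norm_ne_zero_iff.2 (det_toSquareBlock_ne_zero hh hhh k)

lemma logChar_unitary (c : ℂ → ℝ) {U : Matrix ι ι ℂ} (hU : U ∈ blkUnitary μ) :
    logChar μ c U = 0 := by
  refine Finset.sum_eq_zero fun k _ => ?_
  have := toSquareBlock_mul (h := U.conjTranspose) hU.2.2 k
  rw [hU.1, toSquareBlock_one] at this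
  have h2 := congrArg (fun N => ‖N.det‖) this
  have h3 : U.conjTranspose.toSquareBlock μ k = (U.toSquareBlock μ k).conjTranspose := rfl
  simp only [h3, Matrix.det_one, Matrix.det_mul, Matrix.det_conjTranspose, norm_mul, norm_star,
    norm_one] at h2
  have h4 : ‖(U.toSquareBlock μ k).det‖ = 1 := by
    nlinarith [norm_nonneg (U.toSquareBlock μ k).det]
  rw [h4, Real.log_one, mul_zero]

lemma logChar_diagonal (c : ℂ → ℝ) (s : ι → ℝ) :
    logChar μ c (Matrix.diagonal fun i => (Real.exp (s i) : ℂ)) = ∑ i, c (μ i) * s i := by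
  have h1 : ∀ k, Real.log ‖((Matrix.diagonal fun i => (Real.exp (s i) : ℂ)).toSquareBlock μ k).det‖
      = ∑ i with μ i = k, s i := by
    intro k
    have h2 : (Matrix.diagonal fun i => (Real.exp (s i) : ℂ)).toSquareBlock μ k =
        Matrix.diagonal fun i : {i // μ i = k} => (Real.exp (s i) : ℂ) := by
      ext ⟨i, hi⟩ ⟨j, hj⟩
      simp [Matrix.toSquareBlock_def, Matrix.diagonal_apply]
    rw [h2, Matrix.det_diagonal, ← Complex.ofReal_prod, ← Real.exp_sum, Complex.norm_real,
      Real.norm_of_nonneg (Real.exp_pos _).le, Real.log_exp]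
    exact (Finset.sum_subtype _ (by simp) _).symm
  simp only [logChar, h1, Finset.mul_sum]
  rw [← Finset.sum_fiberwise_of_maps_to (s := Finset.univ) (t := Finset.univ.image μ) (g := μ)
    (fun i _ => Finset.mem_image_of_mem _ (Finset.mem_univ i))]
  refine Finset.sum_congr rfl fun k _ => Finset.sum_congr rfl fun i hi => ?_
  rw [(Finset.mem_filter.1 hi).2]

variable {α : Type} [Fintype α]

/-- The Kempf–Ness functional of a tuple of matrices at `g` with inverse `h`. -/
def knFun (μ : ι → ℂ) (X : α → Matrix ι ι ℂ) (c : ℂ → ℝ) (η ζ : ℝ) (g h : Matrix ι ι ℂ) : ℝ :=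
  ∑ t, nF (g * X t * h) + η * nF h - 2 * logChar μ c g + ζ * (logChar μ (fun _ => 1) g) ^ 2

/-- The Kempf–Ness functional in polar coordinates. -/
def knPolar (μ : ι → ℂ) (X : α → Matrix ι ι ℂ) (c : ℂ → ℝ) (η ζ : ℝ)
    (p : (ι → ℝ) × Matrix ι ι ℂ) : ℝ :=
  ∑ t, ∑ i, ∑ j, Real.exp (2 * (p.1 i - p.1 j)) *
      Complex.normSq ((p.2 * X t * p.2.conjTranspose) i j) +
    η * ∑ i, Real.exp (-2 * p.1 i) - 2 * ∑ i, c (μ i) * p.1 i + ζ * (∑ i, p.1 i) ^ 2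

lemma knFun_unitary_mul (X : α → Matrix ι ι ℂ) (c : ℂ → ℝ) (η ζ : ℝ) {U g h : Matrix ι ι ℂ}
    (hU : U ∈ blkUnitary μ) (hg : IsBlk μ g) (hgh : g * h = 1) :
    knFun μ X c η ζ (U * g) (h * U.conjTranspose) = knFun μ X c η ζ g h := by
  simp only [knFun]
  rw [logChar_mul c hU.2.2 hU.1 hg hgh, logChar_mul _ hU.2.2 hU.1 hg hgh, logChar_unitary _ hU,
    logChar_unitary _ hU, zero_add, zero_add,
    nF_mul_unitary (conjTranspose_mem_blkUnitary hU).1]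
  congr 4
  funext t
  rw [Matrix.mul_assoc U, Matrix.mul_assoc U, nF_unitary_mul hU.2.1, ← Matrix.mul_assoc,
    nF_mul_unitary (conjTranspose_mem_blkUnitary hU).1]

lemma exp_diagonal_mul_inv (s : ι → ℝ) :
    (Matrix.diagonal fun i => (Real.exp (s i) : ℂ)) *
      (Matrix.diagonal fun i => (Real.exp (-s i) : ℂ)) = 1 := by
  rw [Matrix.diagonal_mul_diagonal, ← Matrix.diagonal_one]
  congr 1; funext i
  rw [← Complex.ofReal_mul, ← Real.exp_add]; simp

lemma normSq_exp_mul (x : ℝ) (z : ℂ) :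
    Complex.normSq ((Real.exp x : ℂ) * z) = Real.exp (2 * x) * Complex.normSq z := by
  rw [Complex.normSq_mul, Complex.normSq_ofReal, ← Real.exp_add, two_mul]

/-- The effect of a positive diagonal matrix on the Kempf–Ness functional. -/
lemma knFun_diagonal_mul (X : α → Matrix ι ι ℂ) (c : ℂ → ℝ) (η ζ : ℝ) {g h : Matrix ι ι ℂ}
    (hg : IsBlk μ g) (hgh : g * h = 1) (s : ι → ℝ) :
    knFun μ X c η ζ ((Matrix.diagonal fun i => (Real.exp (s i) : ℂ)) * g)
      (h * (Matrix.diagonal fun i => (Real.exp (-s i) : ℂ))) =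
    ∑ t, ∑ i, ∑ j, Real.exp (2 * (s i - s j)) * Complex.normSq ((g * X t * h) i j) +
    η * ∑ i, ∑ j, Real.exp (-2 * s j) * Complex.normSq (h i j) -
    2 * (∑ i, c (μ i) * s i + logChar μ c g) +
    ζ * (∑ i, s i + logChar μ (fun _ => 1) g) ^ 2 := by
  simp only [knFun]
  rw [logChar_mul c (isBlk_diagonal _) (exp_diagonal_mul_inv s) hg hgh,
    logChar_mul _ (isBlk_diagonal _) (exp_diagonal_mul_inv s) hg hgh, logChar_diagonal,
    logChar_diagonal]
  simp only [one_mul]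
  have e1 : ∀ t, nF ((Matrix.diagonal fun i => (Real.exp (s i) : ℂ)) * g * X t *
      (h * Matrix.diagonal fun i => (Real.exp (-s i) : ℂ))) =
      ∑ i, ∑ j, Real.exp (2 * (s i - s j)) * Complex.normSq ((g * X t * h) i j) := by
    intro t
    rw [nF]
    refine Finset.sum_congr rfl fun i _ => Finset.sum_congr rfl fun j _ => ?_
    have e : (Matrix.diagonal fun i => (Real.exp (s i) : ℂ)) * g * X t *
      (h * Matrix.diagonal fun i => (Real.exp (-s i) : ℂ)) =
      (Matrix.diagonal fun i => (Real.exp (s i) : ℂ)) * (g * X t * h *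
      Matrix.diagonal fun i => (Real.exp (-s i) : ℂ)) := by simp only [Matrix.mul_assoc]
    rw [e, Matrix.diagonal_mul, Matrix.mul_diagonal, mul_comm _ ((Real.exp (-s j) : ℝ) : ℂ),
      normSq_exp_mul, normSq_exp_mul, ← mul_assoc, ← Real.exp_add]
    congr 2
    ring
  have e2 : nF (h * Matrix.diagonal fun i => (Real.exp (-s i) : ℂ)) =
      ∑ i, ∑ j, Real.exp (-2 * s j) * Complex.normSq (h i j) := by
    rw [nF]
    refine Finset.sum_congr rfl fun i _ => Finset.sum_congr rfl fun j _ => ?_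
    rw [Matrix.mul_diagonal, mul_comm _ ((Real.exp (-s j) : ℝ) : ℂ), normSq_exp_mul]
    congr 2
    ring
  simp only [e1, e2]

lemma knFun_polar (X : α → Matrix ι ι ℂ) (c : ℂ → ℝ) (η ζ : ℝ) (s : ι → ℝ) {V : Matrix ι ι ℂ}
    (hV : V ∈ blkUnitary μ) :
    knFun μ X c η ζ ((Matrix.diagonal fun i => (Real.exp (s i) : ℂ)) * V)
      (V.conjTranspose * (Matrix.diagonal fun i => (Real.exp (-s i) : ℂ))) =
    knPolar μ X c η ζ (s, V) := by
  rw [knFun_diagonal_mul X c η ζ hV.2.2 hV.1, knPolar, logChar_unitary _ hV, logChar_unitary _ hV,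
    add_zero, add_zero]
  congr 4
  rw [Finset.sum_comm]
  refine Finset.sum_congr rfl fun j _ => ?_
  rw [← Finset.mul_sum]
  have h1 : ∑ i, Complex.normSq (V.conjTranspose i j) = 1 := by
    have h2 := congrFun₂ hV.1 j j
    rw [Matrix.mul_apply, Matrix.one_apply_eq] at h2
    have h3 : ((∑ i, Complex.normSq (V.conjTranspose i j) : ℝ) : ℂ) = 1 := by
      rw [← h2]
      push_cast
      refine Finset.sum_congr rfl fun i _ => ?_
      rw [Matrix.conjTranspose_apply, Complex.star_def, Complex.normSq_conj, Complex.mul_conj]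
    exact_mod_cast h3
  rw [h1, mul_one]

lemma isCompact_blkUnitary : IsCompact (blkUnitary μ) := by
  have hK : IsCompact (Set.pi Set.univ fun _ : ι => Set.pi Set.univ fun _ : ι =>
      Metric.closedBall (0 : ℂ) 1) :=
    isCompact_univ_pi fun i => isCompact_univ_pi fun j => isCompact_closedBall (0 : ℂ) 1
  refine hK.of_isClosed_subset ?_ ?_
  · have h1 : blkUnitary μ = {V : Matrix ι ι ℂ | V * V.conjTranspose = 1} ∩
        ({V | V.conjTranspose * V = 1} ∩ ⋂ i, ⋂ j, {V | μ i ≠ μ j → V i j = 0}) := by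
      ext V; simp [blkUnitary, IsBlk]
    rw [h1]
    have hc : Continuous fun V : Matrix ι ι ℂ => V.conjTranspose := continuous_id.matrix_conjTranspose
    refine (isClosed_eq (continuous_id.matrix_mul hc) continuous_const).inter
      ((isClosed_eq (hc.matrix_mul continuous_id) continuous_const).inter
        (isClosed_iInter fun i => isClosed_iInter fun j => ?_))
    by_cases hij : μ i = μ j
    · simp [hij]
    · simp only [ne_eq, hij, not_false_eq_true, forall_const]
      exact isClosed_eq (continuous_id.matrix_elem i j) continuous_const
  · intro V hV i _ j _
    rw [mem_closedBall_zero_iff]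
    exact entry_norm_bound_of_unitary (Matrix.mem_unitaryGroup_iff.2 hV.1) i j

lemma exists_pos_lower_bound {Z : Type} [TopologicalSpace Z] {K : Set Z} (hK : IsCompact K)
    {l q : Z → ℝ} (hl : Continuous l) (hq : Continuous q) (hq0 : ∀ x ∈ K, 0 ≤ q x)
    (h : ∀ x ∈ K, q x = 0 → 0 < l x) :
    ∃ ε > 0, ∃ T : ℝ, ∀ x ∈ K, ∀ t ≥ T, ε ≤ l x + t * q x := by
  obtain ⟨s, hs⟩ := hK.elim_finite_subcover (fun n : ℕ => {x | 0 < l x + n * q x})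
    (fun n => isOpen_lt continuous_const (hl.add (continuous_const.mul hq))) (by
      intro x hx
      rw [Set.mem_iUnion]
      rcases (hq0 x hx).eq_or_lt with h0 | h0
      · exact ⟨0, by simpa using h x hx h0.symm⟩
      · obtain ⟨n, hn⟩ := exists_nat_gt (-l x / q x)
        refine ⟨n, ?_⟩
        rw [div_lt_iff₀ h0] at hn
        simp only [Set.mem_ofPred_eq]
        linarith)
  set N := s.sup id
  have hN : ∀ x ∈ K, 0 < l x + N * q x := by
    intro x hx
    obtain ⟨n, hn, hxn⟩ := Set.mem_iUnion₂.1 (hs hx)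
    have h1 : (n : ℝ) ≤ N := by exact_mod_cast Finset.le_sup (f := id) hn
    have h2 := mul_le_mul_of_nonneg_right h1 (hq0 x hx)
    have h3 : 0 < l x + n * q x := hxn
    linarith
  rcases K.eq_empty_or_nonempty with rfl | hne
  · exact ⟨1, one_pos, 0, by simp⟩
  obtain ⟨x₀, hx₀, hmin⟩ := hK.exists_isMinOn hne
    (f := fun x => l x + N * q x) (hl.add (continuous_const.mul hq)).continuousOn
  refine ⟨l x₀ + N * q x₀, hN x₀ hx₀, N, fun x hx t ht => ?_⟩
  have h1 := hmin hx
  have h2 := mul_le_mul_of_nonneg_right ht (hq0 x hx)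
  simp only [Set.mem_ofPred_eq] at h1
  linarith

lemma eq_zero_of_sum_sum_sum {S T U : Type} [Fintype S] [Fintype T] [Fintype U]
    {f : S → T → U → ℝ} (hf : ∀ s t u, 0 ≤ f s t u) (h : ∑ s, ∑ t, ∑ u, f s t u = 0) (s t u) :
    f s t u = 0 := by
  have h1 := (Finset.sum_eq_zero_iff_of_nonneg fun s _ => Finset.sum_nonneg fun t _ =>
    Finset.sum_nonneg fun u _ => hf s t u).1 h s (Finset.mem_univ _)
  have h2 := (Finset.sum_eq_zero_iff_of_nonneg fun t _ =>
    Finset.sum_nonneg fun u _ => hf s t u).1 h1 t (Finset.mem_univ _)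
  exact (Finset.sum_eq_zero_iff_of_nonneg fun u _ => hf s t u).1 h2 u (Finset.mem_univ _)

lemma two_mul_max_sq_le_exp (y : ℝ) : 2 * (max y 0) ^ 2 ≤ Real.exp (2 * y) := by
  rcases le_total y 0 with h | h
  · rw [max_eq_right h]; simpa using (Real.exp_pos _).le
  · rw [max_eq_left h]
    have := Real.quadratic_le_exp_of_nonneg (x := 2 * y) (by linarith)
    nlinarith

/-- The Kempf–Ness functional attains its minimum when the numerical criterion holds. -/
theorem exists_knFun_min (X : α → Matrix ι ι ℂ) (c : ℂ → ℝ) {η ζ : ℝ} (hη : 0 ≤ η) (hζ : 0 ≤ ζ)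
    (hyp : ∀ V ∈ blkUnitary μ, ∀ σ : ι → ℝ, σ ≠ 0 →
      (∀ t i j, (V * X t * V.conjTranspose) i j ≠ 0 → σ i ≤ σ j) → (0 < η → ∀ i, 0 ≤ σ i) →
      (0 < ζ → ∑ i, σ i = 0) → ∑ i, c (μ i) * σ i < 0) :
    ∃ g h : Matrix ι ι ℂ, IsBlk μ g ∧ IsBlk μ h ∧ g * h = 1 ∧
      ∀ g' h' : Matrix ι ι ℂ, IsBlk μ g' → g' * h' = 1 →
        knFun μ X c η ζ g h ≤ knFun μ X c η ζ g' h' := by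
  have hent : ∀ t i j, Continuous fun p : (ι → ℝ) × Matrix ι ι ℂ =>
      Complex.normSq ((p.2 * X t * p.2.conjTranspose) i j) := fun t i j =>
    Complex.continuous_normSq.comp
      (((continuous_snd.matrix_mul continuous_const).matrix_mul
        continuous_snd.matrix_conjTranspose).matrix_elem i j)
  have hψ : Continuous (knPolar μ X c η ζ) := by
    unfold knPolar
    have := hent
    fun_prop
  let l : (ι → ℝ) × Matrix ι ι ℂ → ℝ := fun p => -2 * ∑ i, c (μ i) * p.1 i
  let q : (ι → ℝ) × Matrix ι ι ℂ → ℝ := fun p =>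
    ∑ t, ∑ i, ∑ j, 2 * (max (p.1 i - p.1 j) 0) ^ 2 *
      Complex.normSq ((p.2 * X t * p.2.conjTranspose) i j) +
    η * ∑ i, 2 * (max (-p.1 i) 0) ^ 2 + ζ * (∑ i, p.1 i) ^ 2
  have hl : Continuous l := by fun_prop
  have hq : Continuous q := by
    have := hent
    fun_prop
  have hK : IsCompact (Metric.sphere (0 : ι → ℝ) 1 ×ˢ blkUnitary μ) :=
    (isCompact_sphere _ _).prod isCompact_blkUnitary
  have hA : ∀ p : (ι → ℝ) × Matrix ι ι ℂ, 0 ≤ ∑ t, ∑ i, ∑ j, 2 * (max (p.1 i - p.1 j) 0) ^ 2 *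
      Complex.normSq ((p.2 * X t * p.2.conjTranspose) i j) := fun p =>
    Finset.sum_nonneg fun t _ => Finset.sum_nonneg fun i _ => Finset.sum_nonneg fun j _ =>
      mul_nonneg (by positivity) (Complex.normSq_nonneg _)
  have hB : ∀ p : (ι → ℝ) × Matrix ι ι ℂ, 0 ≤ η * ∑ i, 2 * (max (-p.1 i) 0) ^ 2 := fun p =>
    mul_nonneg hη (Finset.sum_nonneg fun i _ => by positivity)
  have hC : ∀ p : (ι → ℝ) × Matrix ι ι ℂ, 0 ≤ ζ * (∑ i, p.1 i) ^ 2 := fun p =>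
    mul_nonneg hζ (sq_nonneg _)
  have hq0 : ∀ p, 0 ≤ q p := fun p => add_nonneg (add_nonneg (hA p) (hB p)) (hC p)
  obtain ⟨ε, hε, T, hT⟩ := exists_pos_lower_bound hK hl hq (fun p _ => hq0 p) (by
    rintro ⟨σ, V⟩ ⟨hσ, hV⟩ h0
    have hA' := hA (σ, V)
    have hB' := hB (σ, V)
    have hC' := hC (σ, V)
    have hq' : _ + _ + _ = (0 : ℝ) := h0
    have e1 := le_antisymm (by linarith) hA'
    have e2 := le_antisymm (by linarith) hB'
    have e3 := le_antisymm (by linarith) hC'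
    have hlt := hyp V hV σ (by rintro rfl; simp at hσ) ?_ ?_ ?_
    · simp only [l]; linarith
    · intro t i j hne
      have e6 := eq_zero_of_sum_sum_sum (fun t i j => mul_nonneg
        (by positivity : 0 ≤ 2 * (max (σ i - σ j) 0) ^ 2) (Complex.normSq_nonneg _)) e1 t i j
      have e7 : max (σ i - σ j) 0 = 0 := by
        rcases mul_eq_zero.1 e6 with h | h
        · simpa using h
        · exact absurd (Complex.normSq_eq_zero.1 h) hne
      linarith [le_max_left (σ i - σ j) 0]
    · intro hη' i
      have e4 := (mul_eq_zero.1 e2).resolve_left hη'.ne'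
      have e5 : max (-σ i) 0 = 0 := by
        simpa using (Finset.sum_eq_zero_iff_of_nonneg (fun i _ => by positivity)).1 e4 i
          (Finset.mem_univ _)
      linarith [le_max_left (-σ i) 0]
    · intro hζ'
      simpa using (mul_eq_zero.1 e3).resolve_left hζ'.ne')
  have hbound : ∀ s : ι → ℝ, s ≠ 0 → ∀ V : Matrix ι ι ℂ,
      ‖s‖ * (l (‖s‖⁻¹ • s, V) + ‖s‖ * q (‖s‖⁻¹ • s, V)) ≤ knPolar μ X c η ζ (s, V) := by
    intro s hs V
    have ht : 0 < ‖s‖ := norm_pos_iff.2 hs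
    have hts : ∀ i, ‖s‖ * (‖s‖⁻¹ * s i) = s i := fun i => mul_inv_cancel_left₀ ht.ne' _
    have hmax : ∀ y : ℝ, ‖s‖ ^ 2 * (2 * (max (‖s‖⁻¹ * y) 0) ^ 2) = 2 * (max y 0) ^ 2 := by
      intro y
      have : ‖s‖ * max (‖s‖⁻¹ * y) 0 = max y 0 := by
        rw [mul_max_of_nonneg _ _ ht.le, mul_inv_cancel_left₀ ht.ne', mul_zero]
      rw [← this]; ring
    have e1 : ‖s‖ * l (‖s‖⁻¹ • s, V) = -2 * ∑ i, c (μ i) * s i := by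
      simp only [l, Pi.smul_apply, smul_eq_mul, Finset.mul_sum]
      refine Finset.sum_congr rfl fun i _ => ?_
      rw [← hts i]; field_simp
    have e2 : ‖s‖ ^ 2 * q (‖s‖⁻¹ • s, V) = ∑ t, ∑ i, ∑ j, 2 * (max (s i - s j) 0) ^ 2 *
        Complex.normSq ((V * X t * V.conjTranspose) i j) +
        η * ∑ i, 2 * (max (-s i) 0) ^ 2 + ζ * (∑ i, s i) ^ 2 := by
      have t1 : ‖s‖ ^ 2 * (∑ t, ∑ i, ∑ j, 2 * (max (‖s‖⁻¹ * s i - ‖s‖⁻¹ * s j) 0) ^ 2 *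
          Complex.normSq ((V * X t * V.conjTranspose) i j)) =
          ∑ t, ∑ i, ∑ j, 2 * (max (s i - s j) 0) ^ 2 *
          Complex.normSq ((V * X t * V.conjTranspose) i j) := by
        simp only [Finset.mul_sum]
        refine Finset.sum_congr rfl fun t _ => Finset.sum_congr rfl fun i _ =>
          Finset.sum_congr rfl fun j _ => ?_
        rw [← mul_assoc, ← mul_sub, hmax]
      have t2 : ‖s‖ ^ 2 * (η * ∑ i, 2 * (max (-(‖s‖⁻¹ * s i)) 0) ^ 2) =
          η * ∑ i, 2 * (max (-s i) 0) ^ 2 := by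
        rw [mul_left_comm, Finset.mul_sum]
        congr 1
        refine Finset.sum_congr rfl fun i _ => ?_
        rw [← mul_neg, hmax]
      have t3 : ‖s‖ ^ 2 * (ζ * (∑ i, ‖s‖⁻¹ * s i) ^ 2) = ζ * (∑ i, s i) ^ 2 := by
        rw [← Finset.mul_sum]
        field_simp
      simp only [q, Pi.smul_apply, smul_eq_mul]
      rw [mul_add, mul_add, t1, t2, t3]
    have e3 : ‖s‖ * (l (‖s‖⁻¹ • s, V) + ‖s‖ * q (‖s‖⁻¹ • s, V)) =
        ‖s‖ * l (‖s‖⁻¹ • s, V) + ‖s‖ ^ 2 * q (‖s‖⁻¹ • s, V) := by ring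
    rw [e3, e1, e2, knPolar]
    have i1 : ∑ t, ∑ i, ∑ j, 2 * (max (s i - s j) 0) ^ 2 *
        Complex.normSq ((V * X t * V.conjTranspose) i j) ≤
        ∑ t, ∑ i, ∑ j, Real.exp (2 * (s i - s j)) *
        Complex.normSq ((V * X t * V.conjTranspose) i j) :=
      Finset.sum_le_sum fun t _ => Finset.sum_le_sum fun i _ => Finset.sum_le_sum fun j _ =>
        mul_le_mul_of_nonneg_right (two_mul_max_sq_le_exp _) (Complex.normSq_nonneg _)
    have i2 : η * ∑ i, 2 * (max (-s i) 0) ^ 2 ≤ η * ∑ i, Real.exp (-2 * s i) := by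
      refine mul_le_mul_of_nonneg_left (Finset.sum_le_sum fun i _ => ?_) hη
      have := two_mul_max_sq_le_exp (-s i)
      rwa [mul_neg, ← neg_mul] at this
    simp only
    linarith
  set B := knPolar μ X c η ζ (0, 1)
  set R := max T (|B| / ε + 1) with hR
  have hRpos : 0 < R := lt_of_lt_of_le (by positivity) (le_max_right _ _)
  have hlarge : ∀ s : ι → ℝ, ∀ V ∈ blkUnitary μ, R ≤ ‖s‖ → B < knPolar μ X c η ζ (s, V) := by
    intro s V hV hs
    have ht : 0 < ‖s‖ := hRpos.trans_le hs
    have hs0 : s ≠ 0 := norm_pos_iff.1 ht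
    refine lt_of_lt_of_le ?_ (hbound s hs0 V)
    have h1 := hT (‖s‖⁻¹ • s, V) ⟨by simp [norm_smul, ht.ne'], hV⟩ ‖s‖ ((le_max_left _ _).trans hs)
    have h2 : |B| / ε < ‖s‖ := by linarith [(le_max_right T (|B| / ε + 1)).trans hs]
    rw [div_lt_iff₀ hε] at h2
    calc B ≤ |B| := le_abs_self _
      _ < ‖s‖ * ε := h2
      _ ≤ _ := mul_le_mul_of_nonneg_left h1 ht.le
  obtain ⟨⟨s, V⟩, ⟨-, hV⟩, hmin⟩ := ((isCompact_closedBall (0 : ι → ℝ) R).prod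
    (isCompact_blkUnitary (μ := μ))).exists_isMinOn
      ⟨(0, 1), ⟨by simp [hRpos.le], one_mem_blkUnitary⟩⟩ hψ.continuousOn
  have hglob : ∀ s' : ι → ℝ, ∀ V' ∈ blkUnitary μ,
      knPolar μ X c η ζ (s, V) ≤ knPolar μ X c η ζ (s', V') := by
    intro s' V' hV'
    rcases le_total ‖s'‖ R with h | h
    · exact hmin ⟨by simpa using h, hV'⟩
    · have h1 : knPolar μ X c η ζ (s, V) ≤ B :=
        hmin (show ((0 : ι → ℝ), (1 : Matrix ι ι ℂ)) ∈ _ from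
          ⟨by simp [hRpos.le], one_mem_blkUnitary⟩)
      exact h1.trans (hlarge s' V' hV' h).le
  change V ∈ blkUnitary μ at hV
  refine ⟨(Matrix.diagonal fun i => (Real.exp (s i) : ℂ)) * V,
    V.conjTranspose * (Matrix.diagonal fun i => (Real.exp (-s i) : ℂ)),
    (isBlk_diagonal _).mul hV.2.2, hV.2.2.conjTranspose.mul (isBlk_diagonal _), ?_,
    fun g' h' hg' hgh' => ?_⟩
  · rw [Matrix.mul_assoc, ← Matrix.mul_assoc V, hV.1, Matrix.one_mul, exp_diagonal_mul_inv]
  · rw [knFun_polar X c η ζ s hV]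
    obtain ⟨U, hU, V', hV', s', rfl⟩ := exists_blk_svd hg' hgh'
    have e1 : U * ((Matrix.diagonal fun i => (Real.exp (s' i) : ℂ)) * V') *
        (V'.conjTranspose * (Matrix.diagonal fun i => (Real.exp (-s' i) : ℂ)) *
          U.conjTranspose) = 1 := by
      rw [Matrix.mul_assoc U, ← Matrix.mul_assoc (_ * V'), ← Matrix.mul_assoc (_ * V'),
        Matrix.mul_assoc _ V', hV'.1, Matrix.mul_one, exp_diagonal_mul_inv, Matrix.one_mul, hU.1]
    have e2 : h' = V'.conjTranspose * (Matrix.diagonal fun i => (Real.exp (-s' i) : ℂ)) *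
          U.conjTranspose := by
      refine left_inv_eq_right_inv (mul_eq_one_comm.1 hgh') ?_
      rw [Matrix.mul_assoc U]
      exact e1
    rw [e2, Matrix.mul_assoc U, knFun_unitary_mul X c η ζ hU ((isBlk_diagonal _).mul hV'.2.2),
      knFun_polar X c η ζ s' hV']
    · exact hglob s' V' hV'
    · rw [Matrix.mul_assoc, ← Matrix.mul_assoc V', hV'.1, Matrix.one_mul, exp_diagonal_mul_inv]

end Minimum

section Critical

variable {ι : Type} [Fintype ι] [DecidableEq ι] {μ : ι → ℂ} {α : Type} [Fintype α]

lemma moment_apply_self_re (X : α → Matrix ι ι ℂ) (i : ι) :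
    (moment X i i).re = ∑ t, (∑ j, Complex.normSq (X t i j) - ∑ j, Complex.normSq (X t j i)) := by
  simp [moment, Matrix.sum_apply, Matrix.mul_apply, Complex.mul_conj,
    ← Complex.normSq_eq_conj_mul_self]

lemma moment_isHermitian (X : α → Matrix ι ι ℂ) : (moment X).IsHermitian := by
  simp [Matrix.IsHermitian, moment, Matrix.conjTranspose_sum, Matrix.conjTranspose_mul]

lemma moment_conj {V : Matrix ι ι ℂ} (hV : V.conjTranspose * V = 1) (X : α → Matrix ι ι ℂ) :
    moment (fun t => V * X t * V.conjTranspose) = V * moment X * V.conjTranspose := by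
  simp only [moment, Matrix.mul_sum, Matrix.sum_mul]
  refine Finset.sum_congr rfl fun t _ => ?_
  have e : (V * X t * V.conjTranspose).conjTranspose =
      V * (X t).conjTranspose * V.conjTranspose := by
    simp [Matrix.conjTranspose_mul, Matrix.mul_assoc]
  have e2 : ∀ P Q : Matrix ι ι ℂ, V * P * V.conjTranspose * (V * Q * V.conjTranspose) =
      V * (P * Q) * V.conjTranspose := by
    intro P Q
    calc _ = V * P * (V.conjTranspose * V) * Q * V.conjTranspose := by simp only [Matrix.mul_assoc]
      _ = _ := by rw [hV]; simp only [Matrix.mul_assoc, Matrix.one_mul]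
  rw [e, e2, e2, Matrix.mul_sub, Matrix.sub_mul]

lemma hasDerivAt_exp_mul_const (a b : ℝ) :
    HasDerivAt (fun r : ℝ => Real.exp (r * a) * b) (a * b) 0 := by
  have := (((hasDerivAt_id (0 : ℝ)).mul_const a).exp).mul_const b
  simpa using this

/-- First order conditions at a minimum of the Kempf–Ness functional. -/
theorem exists_critical (X : α → Matrix ι ι ℂ) (c : ℂ → ℝ) {η ζ : ℝ} (hη : 0 ≤ η) (hζ : 0 ≤ ζ)
    (hyp : ∀ V ∈ blkUnitary μ, ∀ σ : ι → ℝ, σ ≠ 0 →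
      (∀ t i j, (V * X t * V.conjTranspose) i j ≠ 0 → σ i ≤ σ j) → (0 < η → ∀ i, 0 ≤ σ i) →
      (0 < ζ → ∑ i, σ i = 0) → ∑ i, c (μ i) * σ i < 0) :
    ∃ g h : Matrix ι ι ℂ, IsBlk μ g ∧ IsBlk μ h ∧ g * h = 1 ∧
      (∀ i j, i ≠ j → μ i = μ j → moment (fun t => g * X t * h) i j = 0) ∧
      ∃ (Λ : ℝ) (p : ι → ℝ), (∀ i, 0 < p i) ∧
        ∀ i, (moment (fun t => g * X t * h) i i).re - c (μ i) = η * p i - ζ * Λ := by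
  obtain ⟨g₀, h₀, hg₀, hh₀, hgh₀, hmin₀⟩ := exists_knFun_min X c hη hζ hyp
  set M := moment fun t => g₀ * X t * h₀
  let B : Matrix ι ι ℂ := fun i j => if μ i = μ j then M i j else 0
  have hM := moment_isHermitian fun t => g₀ * X t * h₀
  have hBh : B.IsHermitian := by
    ext i j
    have := congrFun₂ hM i j
    rw [Matrix.conjTranspose_apply] at this
    rw [Matrix.conjTranspose_apply]
    by_cases h : μ i = μ j
    · simp only [B, h, if_true]; exact this
    · simp [B, h, Ne.symm h]
  obtain ⟨V, hV, dd, hd⟩ := exists_blkUnitary_diagonalize (μ := μ) hBh fun i j h => if_neg h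
  set g := V * g₀ with hg
  set h := h₀ * V.conjTranspose with hh
  have hgB : IsBlk μ g := hV.2.2.mul hg₀
  have hgh : g * h = 1 := by
    rw [hg, hh, Matrix.mul_assoc, ← Matrix.mul_assoc g₀, hgh₀, Matrix.one_mul, hV.1]
  have hX : (fun t => g * X t * h) = fun t => V * (g₀ * X t * h₀) * V.conjTranspose := by
    funext t; simp only [hg, hh, Matrix.mul_assoc]
  refine ⟨g, h, hgB, hh₀.mul hV.2.2.conjTranspose, hgh, ?_, ?_⟩
  · intro i j hij hμ
    rw [hX, moment_conj hV.2.1]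
    have e1 : (V * M * V.conjTranspose) i j = (V * B * V.conjTranspose) i j := by
      simp only [Matrix.mul_apply, Finset.sum_mul]
      refine Finset.sum_congr rfl fun l _ => Finset.sum_congr rfl fun k _ => ?_
      by_cases h1 : μ i = μ k
      · by_cases h2 : μ j = μ l
        · have : B k l = M k l := if_pos (by rw [← h1, ← h2, hμ])
          rw [this]
        · rw [Matrix.conjTranspose_apply, hV.2.2 j l h2]; simp
      · rw [hV.2.2 i k h1]; simp
    rw [e1, hd]
    have e2 : V * (V.conjTranspose * Matrix.diagonal (fun i => (dd i : ℂ)) * V) * V.conjTranspose =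
        (V * V.conjTranspose) * Matrix.diagonal (fun i => (dd i : ℂ)) * (V * V.conjTranspose) := by
      simp only [Matrix.mul_assoc]
    rw [e2, hV.1, Matrix.one_mul, Matrix.mul_one, Matrix.diagonal_apply_ne _ hij]
  · refine ⟨logChar μ (fun _ => 1) g, fun i => ∑ a, Complex.normSq (h a i), fun i => ?_,
      fun i => ?_⟩
    · refine lt_of_le_of_ne (Finset.sum_nonneg fun a _ => Complex.normSq_nonneg _) fun h0 => ?_
      have h1 := (Finset.sum_eq_zero_iff_of_nonneg fun a _ => Complex.normSq_nonneg _).1 h0.symm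
      have h2 := congrFun₂ hgh i i
      rw [Matrix.mul_apply, Matrix.one_apply_eq, Finset.sum_eq_zero] at h2
      · exact zero_ne_one h2
      · intro a _
        rw [Complex.normSq_eq_zero.1 (h1 a (Finset.mem_univ _)), mul_zero]
    · set e : ι → ℝ := Pi.single i 1
      have hm : ∀ g' h' : Matrix ι ι ℂ, IsBlk μ g' → g' * h' = 1 →
          knFun μ X c η ζ g h ≤ knFun μ X c η ζ g' h' := by
        intro g' h' hg' hgh'
        rw [hg, hh, knFun_unitary_mul X c η ζ hV hg₀ hgh₀]
        exact hmin₀ g' h' hg' hgh'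
      let φ : ℝ → ℝ := fun r =>
        ∑ t, ∑ i, ∑ j, Real.exp (r * (2 * (e i - e j))) * Complex.normSq ((g * X t * h) i j) +
        η * ∑ i, ∑ j, Real.exp (r * (-2 * e j)) * Complex.normSq (h i j) -
        2 * (r * (∑ i, c (μ i) * e i) + logChar μ c g) +
        ζ * (r * (∑ i, e i) + logChar μ (fun _ => 1) g) ^ 2
      have hφ : ∀ r, φ r = knFun μ X c η ζ
          ((Matrix.diagonal fun i => (Real.exp (r * e i) : ℂ)) * g)
          (h * (Matrix.diagonal fun i => (Real.exp (-(r * e i)) : ℂ))) := by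
        intro r
        rw [knFun_diagonal_mul X c η ζ hgB hgh (fun i => r * e i)]
        have a1 : ∀ i, c (μ i) * (r * e i) = r * (c (μ i) * e i) := fun i => by ring
        have a2 : ∀ i j, 2 * (r * e i - r * e j) = r * (2 * (e i - e j)) := fun i j => by ring
        have a3 : ∀ j, -2 * (r * e j) = r * (-2 * e j) := fun j => by ring
        simp only [φ, a1, a2, a3]
        simp only [Finset.mul_sum]
      have hφ0 : φ 0 = knFun μ X c η ζ g h := by
        rw [hφ]; simp
      have hloc : IsLocalMin φ 0 := Filter.Eventually.of_forall fun r => by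
        rw [hφ0, hφ r]
        refine hm _ _ ((isBlk_diagonal _).mul hgB) ?_
        rw [Matrix.mul_assoc, ← Matrix.mul_assoc g, hgh, Matrix.one_mul, exp_diagonal_mul_inv]
      have hder : HasDerivAt φ (∑ t, ∑ i, ∑ j, (2 * (e i - e j)) * Complex.normSq ((g * X t * h) i j) +
        η * ∑ i, ∑ j, (-2 * e j) * Complex.normSq (h i j) -
        2 * (∑ i, c (μ i) * e i) +
        ζ * (2 * logChar μ (fun _ => 1) g * (∑ i, e i))) 0 := by
        refine HasDerivAt.add (HasDerivAt.sub (HasDerivAt.add ?_ ?_) ?_) ?_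
        · exact HasDerivAt.fun_sum fun t _ => HasDerivAt.fun_sum fun i _ =>
            HasDerivAt.fun_sum fun j _ => hasDerivAt_exp_mul_const _ _
        · exact (HasDerivAt.fun_sum fun i _ =>
            HasDerivAt.fun_sum fun j _ => hasDerivAt_exp_mul_const _ _).const_mul _
        · simpa using ((((hasDerivAt_id (0 : ℝ)).mul_const (∑ i, c (μ i) * e i)).add_const
            (logChar μ c g)).const_mul 2)
        · simpa using (((((hasDerivAt_id (0 : ℝ)).mul_const (∑ i, e i)).add_const
            (logChar μ (fun _ => 1) g)).pow 2).const_mul ζ)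
      have h0 := hloc.hasDerivAt_eq_zero hder
      have s1 : ∑ i, e i = 1 := by simp [e]
      have s2 : ∑ j, c (μ j) * e j = c (μ i) := by simp [e, Pi.single_apply]
      have s3 : ∑ a, ∑ j, (-2 * e j) * Complex.normSq (h a j) =
          -2 * ∑ a, Complex.normSq (h a i) := by
        rw [Finset.mul_sum]
        refine Finset.sum_congr rfl fun a _ => ?_
        simp [e, Pi.single_apply]
      have s4 : ∀ Y : Matrix ι ι ℂ, ∑ k, ∑ j, (2 * (e k - e j)) * Complex.normSq (Y k j) =
          2 * (∑ j, Complex.normSq (Y i j) - ∑ j, Complex.normSq (Y j i)) := by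
        intro Y
        simp only [mul_sub, sub_mul, Finset.sum_sub_distrib]
        congr 1
        · rw [Finset.sum_comm, Finset.mul_sum]
          refine Finset.sum_congr rfl fun a _ => ?_
          simp [e, Pi.single_apply]
        · rw [Finset.mul_sum]
          refine Finset.sum_congr rfl fun a _ => ?_
          simp [e, Pi.single_apply]
      simp only [s4] at h0
      rw [s1, s2, s3, ← Finset.mul_sum, ← moment_apply_self_re] at h0
      linarith

end Critical

section Trace

variable {E F : Type} [AddCommGroup E] [Module ℂ E] [AddCommGroup F] [Module ℂ F]

lemma der_det {ι : Type} [Fintype ι] [DecidableEq ι] (b : Module.Basis ι ℂ E) (T : E →ₗ[ℂ] E)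
    (v : ι → E) : der T b.det.toMultilinearMap v = LinearMap.trace ℂ E T * b.det v := by
  have h1 : ∀ s, b.det.toMultilinearMap (Function.update v s (T (v s))) =
      ((b.toMatrix v).adjugate * ((LinearMap.toMatrix b b T) * b.toMatrix v)) s s := by
    intro s
    have h2 : b.det.toMultilinearMap (Function.update v s (T (v s))) =
        (b.toMatrix (Function.update v s (T (v s)))).det := b.det_apply _
    rw [h2, Module.Basis.toMatrix_update, ← Matrix.cramer_apply, Matrix.cramer_eq_adjugate_mulVec,
      Matrix.mul_apply, Matrix.mulVec, dotProduct]
    refine Finset.sum_congr rfl fun k _ => ?_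
    congr 1
    have h3 := congrFun (LinearMap.toMatrix_mulVec_repr b b T (v s)) k
    rw [← h3]
    rfl
  rw [der, Finset.sum_congr rfl fun s _ => h1 s]
  change ((b.toMatrix v).adjugate * ((LinearMap.toMatrix b b T) * b.toMatrix v)).trace = _
  rw [Matrix.trace_mul_comm, Matrix.mul_assoc, Matrix.mul_adjugate, Matrix.mul_smul, Matrix.mul_one,
    Matrix.trace_smul, LinearMap.trace_eq_matrix_trace ℂ b, b.det_apply, smul_eq_mul, mul_comm]

lemma trace_eq_sum_of_mem_maxGenEigenspace {ι : Type} [Fintype ι] [DecidableEq ι]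
    (b : Module.Basis ι ℂ E) (f : E →ₗ[ℂ] E) (μ : ι → ℂ)
    (hb : ∀ i, b i ∈ Module.End.maxGenEigenspace f (μ i)) :
    LinearMap.trace ℂ E f = ∑ i, μ i := by
  by_contra hne
  rcases isEmpty_or_nonempty ι with hι | ⟨⟨i₀⟩⟩
  · apply hne
    rw [LinearMap.trace_eq_matrix_trace ℂ b]
    simp [Matrix.trace]
  have : FiniteDimensional ℂ E := b.finiteDimensional_of_finite
  set t : ℂ := LinearMap.trace ℂ E f
  set n : ℂ := (Fintype.card ι : ℂ)
  have hn : n ≠ 0 := by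
    have : 0 < Fintype.card ι := Fintype.card_pos_iff.2 ⟨i₀⟩
    exact Nat.cast_ne_zero.2 this.ne'
  have key : b.det.toMultilinearMap b = 0 := by
    refine eq_zero_of_sum_eigenvalue_ne_zero (f - (t / n) • LinearMap.id) b.det.toMultilinearMap
      (fun v => ?_) (fun i => μ i - t / n) ?_ b fun i => ?_
    · rw [der_det, map_sub, map_smul, LinearMap.trace_id, Module.finrank_eq_card_basis b,
        smul_eq_mul, div_mul_cancel₀ _ hn]
      change (t - t) * _ = 0
      rw [sub_self, zero_mul]
    · rw [Finset.sum_sub_distrib, Finset.sum_const, Finset.card_univ, nsmul_eq_mul,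
        mul_div_cancel₀ _ hn, sub_ne_zero]
      exact Ne.symm hne
    · have h1 := hb i
      rw [Module.End.mem_maxGenEigenspace] at h1 ⊢
      obtain ⟨k, hk⟩ := h1
      refine ⟨k, ?_⟩
      have : (f - (t / n) • LinearMap.id - (μ i - t / n) • (1 : Module.End ℂ E)) =
          f - μ i • (1 : Module.End ℂ E) := by
        rw [sub_smul, sub_sub]
        congr 1
        exact add_sub_cancel _ _
      rw [this]
      exact hk
  have h1 : b.det.toMultilinearMap b = 1 := b.det_self
  exact one_ne_zero (h1.symm.trans key)

lemma exists_basis_maxGenEigenspace [FiniteDimensional ℂ E] (f : E →ₗ[ℂ] E) :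
    ∃ (ι : Type) (_ : Fintype ι) (_ : DecidableEq ι) (b : Module.Basis ι ℂ E) (μ : ι → ℂ),
      ∀ i, b i ∈ Module.End.maxGenEigenspace f (μ i) := by
  classical
  have h : DirectSum.IsInternal fun c : ℂ => Module.End.maxGenEigenspace f c :=
    DirectSum.isInternal_submodule_of_iSupIndep_of_iSup_eq_top
      (Module.End.independent_maxGenEigenspace f) (Module.End.iSup_maxGenEigenspace_eq_top f)
  let b := h.collectedBasis fun c => Module.finBasis ℂ (Module.End.maxGenEigenspace f c)
  exact ⟨_, FiniteDimensional.fintypeBasisIndex b, inferInstance, b, fun i => i.1,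
    fun i => h.collectedBasis_mem _ i⟩

/-- Additivity of the trace in short exact sequences. -/
lemma trace_exact {K : Type} [AddCommGroup K] [Module ℂ K] [FiniteDimensional ℂ E]
    {i : K →ₗ[ℂ] E} {π : E →ₗ[ℂ] F} (hi : Function.Injective i) (hπ : Function.Surjective π)
    (hex : LinearMap.range i = LinearMap.ker π) {fK : K →ₗ[ℂ] K} {f : E →ₗ[ℂ] E} {fF : F →ₗ[ℂ] F}
    (h1 : ∀ v, i (fK v) = f (i v)) (h2 : ∀ v, π (f v) = fF (π v)) :
    LinearMap.trace ℂ E f = LinearMap.trace ℂ K fK + LinearMap.trace ℂ F fF := by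
  have : FiniteDimensional ℂ K := FiniteDimensional.of_injective i hi
  have : FiniteDimensional ℂ F := FiniteDimensional.of_surjective π hπ
  obtain ⟨s, hs⟩ := π.exists_rightInverse_of_surjective (LinearMap.range_eq_top.2 hπ)
  obtain ⟨p, hp⟩ := i.exists_leftInverse_of_injective (LinearMap.ker_eq_bot.2 hi)
  have hs' : ∀ v, π (s v) = v := fun v => LinearMap.congr_fun hs v
  have hp' : ∀ v, p (i v) = v := fun v => LinearMap.congr_fun hp v
  have hk : ∀ v, i (p (v - s (π v))) = v - s (π v) := by
    intro v
    have : v - s (π v) ∈ LinearMap.range i := by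
      rw [hex, LinearMap.mem_ker, map_sub, hs', sub_self]
    obtain ⟨w, hw⟩ := this
    rw [← hw, hp']
  have hd : f = (f ∘ₗ i) ∘ₗ (p ∘ₗ (LinearMap.id - s ∘ₗ π)) + (f ∘ₗ s) ∘ₗ π := by
    ext v
    simp only [LinearMap.add_apply, LinearMap.comp_apply, LinearMap.sub_apply, LinearMap.id_apply]
    rw [hk, ← map_add, sub_add_cancel]
  have e1 : (p ∘ₗ (LinearMap.id - s ∘ₗ π)) ∘ₗ (f ∘ₗ i) = fK := by
    ext v
    have h0 : π (i (fK v)) = 0 := by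
      rw [← LinearMap.mem_ker, ← hex]; exact ⟨_, rfl⟩
    simp only [LinearMap.comp_apply, LinearMap.sub_apply, LinearMap.id_apply]
    rw [← h1, h0, map_zero, sub_zero, hp']
  have e2 : π ∘ₗ (f ∘ₗ s) = fF := by
    ext v
    simp only [LinearMap.comp_apply, h2, hs']
  conv_lhs => rw [hd]
  rw [map_add, LinearMap.trace_comp_comm' _ (f ∘ₗ i), LinearMap.trace_comp_comm' _ (f ∘ₗ s), e1, e2]

end Trace

section Action

variable {A E F : Type} [AddCommGroup A] [Module ℂ A] [AddCommGroup E] [Module ℂ E]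
  [AddCommGroup F] [Module ℂ F]

/-- Stability of a subspace under a linear family of endomorphisms. -/
def IsStable (ρ : A →ₗ[ℂ] E →ₗ[ℂ] E) (K : Submodule ℂ E) : Prop := ∀ x, ∀ v ∈ K, ρ x v ∈ K

/-- The action on a stable subspace. -/
def subAct (ρ : A →ₗ[ℂ] E →ₗ[ℂ] E) {K : Submodule ℂ E} (hK : IsStable ρ K) :
    A →ₗ[ℂ] K →ₗ[ℂ] K where
  toFun x := (ρ x).restrict (hK x)
  map_add' x y := by ext; simp
  map_smul' c x := by ext; simp

@[simp] lemma coe_subAct_apply (ρ : A →ₗ[ℂ] E →ₗ[ℂ] E) {K : Submodule ℂ E} (hK : IsStable ρ K)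
    (x : A) (v : K) : (subAct ρ hK x v : E) = ρ x v := rfl

/-- The action on the quotient by a stable subspace. -/
def quotAct (ρ : A →ₗ[ℂ] E →ₗ[ℂ] E) {K : Submodule ℂ E} (hK : IsStable ρ K) :
    A →ₗ[ℂ] (E ⧸ K) →ₗ[ℂ] (E ⧸ K) where
  toFun x := K.mapQ K (ρ x) (hK x)
  map_add' x y := by ext; simp
  map_smul' c x := by ext; simp

@[simp] lemma quotAct_mkQ (ρ : A →ₗ[ℂ] E →ₗ[ℂ] E) {K : Submodule ℂ E} (hK : IsStable ρ K)
    (x : A) (v : E) : quotAct ρ hK x (K.mkQ v) = K.mkQ (ρ x v) := rfl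

/-- The character by which the algebra acts on the determinant of the quotient by `K`. -/
def detChar (ρ : A →ₗ[ℂ] E →ₗ[ℂ] E) {K : Submodule ℂ E} (hK : IsStable ρ K) : A →ₗ[ℂ] ℂ :=
  LinearMap.trace ℂ E ∘ₗ ρ - LinearMap.trace ℂ K ∘ₗ subAct ρ hK

lemma detChar_apply (ρ : A →ₗ[ℂ] E →ₗ[ℂ] E) {K : Submodule ℂ E} (hK : IsStable ρ K) (x : A) :
    detChar ρ hK x = LinearMap.trace ℂ E (ρ x) - LinearMap.trace ℂ K (subAct ρ hK x) := rfl

lemma trace_quotAct [FiniteDimensional ℂ E] (ρ : A →ₗ[ℂ] E →ₗ[ℂ] E) {K : Submodule ℂ E}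
    (hK : IsStable ρ K) (x : A) :
    LinearMap.trace ℂ (E ⧸ K) (quotAct ρ hK x) = detChar ρ hK x := by
  rw [detChar_apply, trace_exact (i := K.subtype) (π := K.mkQ) K.injective_subtype
    K.mkQ_surjective (by rw [K.range_subtype, K.ker_mkQ]) (fK := subAct ρ hK x)
    (fF := quotAct ρ hK x) (fun v => rfl) (fun v => rfl), add_sub_cancel_left]

lemma IsStable.bot (ρ : A →ₗ[ℂ] E →ₗ[ℂ] E) : IsStable ρ ⊥ := by
  intro x v hv
  rw [Submodule.mem_bot] at hv ⊢
  rw [hv, map_zero]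

lemma IsStable.top (ρ : A →ₗ[ℂ] E →ₗ[ℂ] E) : IsStable ρ ⊤ := fun _ _ _ => Submodule.mem_top

lemma IsStable.inf {ρ : A →ₗ[ℂ] E →ₗ[ℂ] E} {K L : Submodule ℂ E} (hK : IsStable ρ K)
    (hL : IsStable ρ L) : IsStable ρ (K ⊓ L) := fun x v hv => ⟨hK x v hv.1, hL x v hv.2⟩

lemma IsStable.sup {ρ : A →ₗ[ℂ] E →ₗ[ℂ] E} {K L : Submodule ℂ E} (hK : IsStable ρ K)
    (hL : IsStable ρ L) : IsStable ρ (K ⊔ L) := by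
  intro x v hv
  obtain ⟨k, hk, l, hl, rfl⟩ := Submodule.mem_sup.1 hv
  rw [map_add]
  exact Submodule.add_mem_sup (hK x k hk) (hL x l hl)

lemma IsStable.sInf {ρ : A →ₗ[ℂ] E →ₗ[ℂ] E} {𝒦 : Set (Submodule ℂ E)}
    (h : ∀ K ∈ 𝒦, IsStable ρ K) : IsStable ρ (sInf 𝒦) := by
  intro x v hv
  rw [Submodule.mem_sInf] at hv ⊢
  exact fun K hK => h K hK x v (hv K hK)

lemma IsStable.comap {ρ : A →ₗ[ℂ] E →ₗ[ℂ] E} {ρ' : A →ₗ[ℂ] F →ₗ[ℂ] F} {π : E →ₗ[ℂ] F}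
    (hπ : ∀ x v, π (ρ x v) = ρ' x (π v)) {K : Submodule ℂ F} (hK : IsStable ρ' K) :
    IsStable ρ (K.comap π) := by
  intro x v hv
  rw [Submodule.mem_comap] at hv ⊢
  rw [hπ]
  exact hK x _ hv

lemma IsStable.map {ρ : A →ₗ[ℂ] E →ₗ[ℂ] E} {ρ' : A →ₗ[ℂ] F →ₗ[ℂ] F} {π : E →ₗ[ℂ] F}
    (hπ : ∀ x v, π (ρ x v) = ρ' x (π v)) {K : Submodule ℂ E} (hK : IsStable ρ K) :
    IsStable ρ' (K.map π) := by
  rintro x _ ⟨v, hv, rfl⟩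
  rw [← hπ]
  exact Submodule.mem_map_of_mem (hK x v hv)

lemma detChar_comap [FiniteDimensional ℂ E] {ρ : A →ₗ[ℂ] E →ₗ[ℂ] E} {ρ' : A →ₗ[ℂ] F →ₗ[ℂ] F}
    {π : E →ₗ[ℂ] F} (hπ : ∀ x v, π (ρ x v) = ρ' x (π v)) (hs : Function.Surjective π)
    {K : Submodule ℂ F} (hK : IsStable ρ' K) {L : Submodule ℂ E} (hL : IsStable ρ L)
    (hLK : L = K.comap π) : detChar ρ hL = detChar ρ' hK := by
  subst hLK
  have : FiniteDimensional ℂ F := FiniteDimensional.of_surjective π hs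
  ext x
  rw [← trace_quotAct, ← trace_quotAct]
  let e : (E ⧸ K.comap π) →ₗ[ℂ] (F ⧸ K) := (K.comap π).mapQ K π le_rfl
  have he : Function.Injective e := by
    rw [← LinearMap.ker_eq_bot, Submodule.ker_mapQ, Submodule.mkQ_map_self]
  have hes : Function.Surjective e := by
    intro y
    obtain ⟨y, rfl⟩ := K.mkQ_surjective y
    obtain ⟨v, rfl⟩ := hs y
    exact ⟨(K.comap π).mkQ v, rfl⟩
  rw [trace_exact (i := (0 : (⊥ : Submodule ℂ E) →ₗ[ℂ] _)) (π := e)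
    (fK := 0) (fF := quotAct ρ' hK x) (fun a b _ => Subsingleton.elim _ _) hes
    (by rw [LinearMap.range_zero, LinearMap.ker_eq_bot.2 he]) (fun v => by simp), map_zero, zero_add]
  intro v
  obtain ⟨v, rfl⟩ := (K.comap π).mkQ_surjective v
  change K.mkQ (π (ρ x v)) = K.mkQ (ρ' x (π v))
  rw [hπ]

lemma detChar_of_le [FiniteDimensional ℂ E] {ρ : A →ₗ[ℂ] E →ₗ[ℂ] E} {N : Submodule ℂ E}
    (hN : IsStable ρ N) {K : Submodule ℂ N} (hK : IsStable (subAct ρ hN) K)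
    {L : Submodule ℂ E} (hL : IsStable ρ L) (hLK : L = K.map N.subtype) :
    detChar (subAct ρ hN) hK = detChar ρ hL - detChar ρ hN := by
  subst hLK
  ext x
  rw [LinearMap.sub_apply, detChar_apply, detChar_apply, detChar_apply, sub_sub_sub_cancel_left]
  congr 1
  let e : K →ₗ[ℂ] K.map N.subtype := N.subtype.submoduleMap K
  have he : Function.Injective e := fun a b hab =>
    Subtype.ext (N.injective_subtype (congrArg (Subtype.val : K.map N.subtype → E) hab))
  rw [trace_exact (i := (0 : (⊥ : Submodule ℂ E) →ₗ[ℂ] _)) (π := e) (f := subAct (subAct ρ hN) hK x)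
    (fK := 0) (fF := subAct ρ hL x) (fun a b _ => Subsingleton.elim _ _)
    (N.subtype.submoduleMap_surjective K)
    (by rw [LinearMap.range_zero, LinearMap.ker_eq_bot.2 he]) (fun v => by simp), map_zero, zero_add]
  intro v
  rfl

end Action

section Frames

variable {α : Type} [Fintype α] {A E F : Type} [AddCommGroup A] [Module ℂ A] [AddCommGroup E]
  [Module ℂ E] [AddCommGroup F] [Module ℂ F]

lemma exists_basis_change {ι : Type} [Fintype ι] [DecidableEq ι] (b : Module.Basis ι ℂ E)
    {g h : Matrix ι ι ℂ} (hgh : g * h = 1) :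
    ∃ b' : Module.Basis ι ℂ E, (∀ j, b' j = ∑ l, h l j • b l) ∧
      ∀ T : E →ₗ[ℂ] E, LinearMap.toMatrix b' b' T = g * LinearMap.toMatrix b b T * h := by
  let e : E ≃ₗ[ℂ] E := LinearEquiv.ofLinearMap (Matrix.toLin b b h) (Matrix.toLin b b g)
    (by rw [← Matrix.toLin_mul, mul_eq_one_comm.1 hgh, Matrix.toLin_one])
    (by rw [← Matrix.toLin_mul, hgh, Matrix.toLin_one])
  refine ⟨b.map e, fun j => ?_, fun T => ?_⟩
  · rw [Module.Basis.map_apply]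
    exact Matrix.toLin_self b b h j
  · have h1 : LinearMap.toMatrix (b.map e) (b.map e) T =
        LinearMap.toMatrix b b (Matrix.toLin b b g ∘ₗ T ∘ₗ Matrix.toLin b b h) := by
      ext i j
      rw [LinearMap.toMatrix_apply, LinearMap.toMatrix_apply]
      rfl
    rw [h1, LinearMap.toMatrix_comp b b b, LinearMap.toMatrix_comp b b b,
      LinearMap.toMatrix_toLin, LinearMap.toMatrix_toLin, Matrix.mul_assoc]

lemma mem_maxGenEigenspace_of_isBlk {ι : Type} [Fintype ι] {μ : ι → ℂ} {h : Matrix ι ι ℂ}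
    (hh : IsBlk μ h) {f : E →ₗ[ℂ] E} {b : ι → E}
    (hb : ∀ i, b i ∈ Module.End.maxGenEigenspace f (μ i)) (j : ι) :
    ∑ l, h l j • b l ∈ Module.End.maxGenEigenspace f (μ j) := by
  refine Submodule.sum_mem _ fun l _ => ?_
  by_cases hl : μ l = μ j
  · exact Submodule.smul_mem _ _ (hl ▸ hb l)
  · rw [hh l j hl, zero_smul]; exact Submodule.zero_mem _

lemma isStable_of_span {ρ : A →ₗ[ℂ] E →ₗ[ℂ] E} {a : α → A}
    (ha : Submodule.span ℂ (Set.range a) = ⊤) {K : Submodule ℂ E}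
    (h : ∀ t, ∀ v ∈ K, ρ (a t) v ∈ K) : IsStable ρ K := by
  intro x v hv
  have hx : x ∈ Submodule.span ℂ (Set.range a) := ha ▸ Submodule.mem_top
  induction hx using Submodule.span_induction with
  | mem x hx => obtain ⟨t, rfl⟩ := hx; exact h t v hv
  | zero => simp
  | add x y _ _ hx hy => rw [map_add]; exact K.add_mem hx hy
  | smul c x _ hx => rw [map_smul]; exact K.smul_mem c hx

theorem exists_frame_critical [FiniteDimensional ℂ E] (ρ : A →ₗ[ℂ] E →ₗ[ℂ] E) {a : α → A}
    (ha : Submodule.span ℂ (Set.range a) = ⊤) (z : A) (c : ℂ → ℝ) {η ζ : ℝ} (hη : 0 ≤ η)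
    (hζ : 0 ≤ ζ)
    (hyp : ∀ (ι : Type) [Fintype ι] [DecidableEq ι] (b : Module.Basis ι ℂ E) (μ : ι → ℂ),
      (∀ i, b i ∈ Module.End.maxGenEigenspace (ρ z) (μ i)) → ∀ σ : ι → ℝ, σ ≠ 0 →
      (∀ r, IsStable ρ (Submodule.span ℂ (b '' {i | σ i ≤ r}))) → (0 < η → ∀ i, 0 ≤ σ i) →
      (0 < ζ → ∑ i, σ i = 0) → ∑ i, c (μ i) * σ i < 0) :
    ∃ (Φ : Frame ρ a z) (Λ : ℝ) (p : Φ.ι → ℝ), (∀ i, Φ.e i ≠ 0) ∧ (∀ i, 0 < p i) ∧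
      ∀ i, (moment Φ.X i i).re - c (Φ.μ i) = η * p i - ζ * Λ := by
  obtain ⟨ι, _, _, b, μ, hb⟩ := exists_basis_maxGenEigenspace (ρ z)
  obtain ⟨g, h, -, hh, hgh, hoff, Λ, p, hp, hcrit⟩ := exists_critical (μ := μ)
    (fun t => LinearMap.toMatrix b b (ρ (a t))) c hη hζ (by
      intro V hV σ hσ hst h1 h2
      obtain ⟨b', hb', hT⟩ := exists_basis_change b hV.1
      refine hyp ι b' μ (fun i => ?_) σ hσ (fun r => isStable_of_span ha fun t v hv => ?_) h1 h2
      · rw [hb' i]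
        exact mem_maxGenEigenspace_of_isBlk hV.2.2.conjTranspose hb i
      · induction hv using Submodule.span_induction with
        | mem x hx =>
          obtain ⟨j, hj, rfl⟩ := hx
          rw [← b'.sum_repr (ρ (a t) (b' j))]
          refine Submodule.sum_mem _ fun i _ => ?_
          rw [← LinearMap.toMatrix_apply, hT]
          by_cases h0 : (V * LinearMap.toMatrix b b (ρ (a t)) * V.conjTranspose) i j = 0
          · rw [h0, zero_smul]; exact Submodule.zero_mem _
          · exact Submodule.smul_mem _ _ (Submodule.subset_span
              ⟨i, (hst t i j h0).trans hj, rfl⟩)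
        | zero => simp
        | add x y _ _ hx hy => rw [map_add]; exact Submodule.add_mem _ hx hy
        | smul c x _ hx => rw [map_smul]; exact Submodule.smul_mem _ c hx)
  obtain ⟨b', hb', hT⟩ := exists_basis_change b hgh
  exact ⟨{ ι := ι
           e := b'
           span_e := b'.span_eq
           X := fun t => g * LinearMap.toMatrix b b (ρ (a t)) * h
           apply_e := fun t j => by
            rw [← hT]
            simp only [LinearMap.toMatrix_apply]
            exact (b'.sum_repr _).symm
           μ := μ
           mem_eig := fun i => by
            rw [hb' i]; exact mem_maxGenEigenspace_of_isBlk hh hb i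
           off := hoff }, Λ, p, b'.ne_zero, hp, hcrit⟩

lemma sum_mul_neg_of_threshold {ι : Type} [Fintype ι] (c : ι → ℝ) :
    ∀ σ : ι → ℝ, (∀ i, 0 ≤ σ i) → σ ≠ 0 →
      (∀ r, 0 ≤ r → (∃ i, r < σ i) → ∑ i with r < σ i, c i < 0) → ∑ i, c i * σ i < 0 := by
  have key : ∀ (n : ℕ) (σ : ι → ℝ), (Finset.univ.filter fun i => 0 < σ i).card = n →
      (∀ i, 0 ≤ σ i) → σ ≠ 0 →
      (∀ r, 0 ≤ r → (∃ i, r < σ i) → ∑ i with r < σ i, c i < 0) → ∑ i, c i * σ i < 0 := by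
    intro n
    induction n using Nat.strong_induction_on with
    | _ n ih =>
      intro σ hn h0 hne hthr
      have hex : ∃ i, 0 < σ i := by
        by_contra! hcon
        exact hne (funext fun i => le_antisymm (hcon i) (h0 i))
      obtain ⟨i₀, hi₀⟩ := hex
      obtain ⟨m, hm, hmin⟩ := Finset.exists_min_image (Finset.univ.filter fun i => 0 < σ i) σ
        ⟨i₀, by simpa using hi₀⟩
      have hmpos : 0 < σ m := (Finset.mem_filter.1 hm).2
      have hmin' : ∀ i, 0 < σ i → σ m ≤ σ i := fun i hi => hmin i (by simpa using hi)
      set σ' : ι → ℝ := fun i => if 0 < σ i then σ i - σ m else 0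
      have hσ'0 : ∀ i, 0 ≤ σ' i := by
        intro i
        by_cases hi : 0 < σ i
        · simp only [σ', hi, if_true]; linarith [hmin' i hi]
        · simp [σ', hi]
      have hlt : ∀ r, 0 ≤ r → ∀ i, r < σ' i ↔ r + σ m < σ i := by
        intro r hr i
        by_cases hi : 0 < σ i
        · simp only [σ', hi, if_true]; constructor <;> intro h <;> linarith
        · simp only [σ', hi, if_false]; constructor <;> intro h <;> linarith
      have hsum : ∑ i, c i * σ i = ∑ i, c i * σ' i + σ m * ∑ i with 0 < σ i, c i := by
        rw [Finset.sum_filter, Finset.mul_sum, ← Finset.sum_add_distrib]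
        refine Finset.sum_congr rfl fun i _ => ?_
        by_cases hi : 0 < σ i
        · simp only [σ', hi, if_true]; ring
        · have : σ i = 0 := le_antisymm (not_lt.1 hi) (h0 i)
          simp [σ', this]
      have hlast := mul_neg_of_pos_of_neg hmpos (hthr 0 le_rfl ⟨i₀, hi₀⟩)
      rw [hsum]
      by_cases hz : σ' = 0
      · simp only [hz, Pi.zero_apply, mul_zero, Finset.sum_const_zero, zero_add]
        exact hlast
      · have := ih _ (by
          rw [← hn]
          refine Finset.card_lt_card (Finset.ssubset_iff_subset_ne.2 ⟨fun i hi => ?_, fun heq => ?_⟩)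
          · simp only [Finset.mem_filter, Finset.mem_univ, true_and] at hi ⊢
            linarith [(hlt 0 le_rfl i).1 hi]
          · rw [← heq] at hm
            have := (Finset.mem_filter.1 hm).2
            rw [hlt 0 le_rfl] at this
            linarith) σ' rfl hσ'0 hz (fun r hr ⟨i, hi⟩ => by
              simp only [hlt r hr]
              exact hthr _ (by linarith) ⟨i, (hlt r hr i).1 hi⟩)
        linarith
  exact fun σ => key _ σ rfl

/-- Existence of frames with positive margins under a stability condition. -/
theorem exists_frame_of_detChar_lt [FiniteDimensional ℂ E] (ρ : A →ₗ[ℂ] E →ₗ[ℂ] E) {a : α → A}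
    (ha : Submodule.span ℂ (Set.range a) = ⊤) (z : A) (τ : ℂ →+ ℝ) (δ : ℝ)
    (hyp : ∀ (K : Submodule ℂ E) (hK : IsStable ρ K), K ≠ ⊤ →
      τ (detChar ρ hK z) < δ * (Module.finrank ℂ E - Module.finrank ℂ K)) :
    ∃ Φ : Frame ρ a z, ∀ i, -δ < Φ.κ τ i := by
  obtain ⟨Φ, Λ, p, -, hp, h⟩ := exists_frame_critical ρ ha z (fun x => τ x - δ) zero_le_one le_rfl (by
    intro ι _ _ b μ hb σ hσ hst hpos _
    refine sum_mul_neg_of_threshold (fun i => τ (μ i) - δ) σ (hpos one_pos) hσ ?_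
    rintro r hr ⟨i₀, hi₀⟩
    set I : Set ι := {i | σ i ≤ r} with hI
    set K := Submodule.span ℂ (b '' I)
    have hli : LinearIndependent ℂ fun i : I => b i := b.linearIndependent.comp _
      Subtype.val_injective
    have hKr : Submodule.span ℂ (Set.range fun i : I => b i) = K := by
      simp only [K, Set.image_eq_range]
    let bK : Module.Basis I ℂ K := (Module.Basis.span hli).map (LinearEquiv.ofEq _ _ hKr)
    have hbK : ∀ i, (bK i : E) = b i := fun i => by
      simp [bK, Module.Basis.span_apply]
    have hK : K ≠ ⊤ := by
      intro htop
      have h1 : b i₀ ∈ K := htop ▸ Submodule.mem_top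
      rw [b.mem_span_image, b.repr_self] at h1
      exact absurd (h1 (by simp) : σ i₀ ≤ r) (not_le.2 hi₀)
    have h1 := trace_eq_sum_of_mem_maxGenEigenspace b (ρ z) μ hb
    have h2 := trace_eq_sum_of_mem_maxGenEigenspace bK (subAct ρ (hst r) z) (fun i => μ i) (by
      intro i
      have h3 := hb i
      rw [← hbK i] at h3
      rw [Module.End.mem_maxGenEigenspace] at h3 ⊢
      obtain ⟨k, hk⟩ := h3
      refine ⟨k, ?_⟩
      have : ∀ (k : ℕ) (v : K), ((((subAct ρ (hst r) z) - μ i • (1 : Module.End ℂ K) :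
          Module.End ℂ K) ^ k) v : E) = ((ρ z - μ i • (1 : Module.End ℂ E) : Module.End ℂ E) ^ k) v := by
        intro k
        induction k with
        | zero => simp
        | succ k ih => intro v; rw [pow_succ, pow_succ, Module.End.mul_apply, ih]; simp
      exact Subtype.ext ((this k _).trans hk))
    have h3 := hyp K (hst r) hK
    rw [detChar_apply, h1, h2] at h3
    have h4 : ∀ {R : Type} [AddCommGroup R] (f : ι → R),
        ∑ i with r < σ i, f i = ∑ i, f i - ∑ i : I, f i := by
      intro R _ f
      rw [eq_sub_iff_add_eq, add_comm, ← Finset.sum_filter_add_sum_filter_not Finset.univ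
        (fun i => σ i ≤ r)]
      congr 1
      · exact (Finset.sum_subtype _ (by simp [I]) f).symm
      · simp only [not_le]
    rw [h4]
    simp only [Finset.sum_sub_distrib, Finset.sum_const, Finset.card_univ, nsmul_eq_mul]
    rw [map_sub, map_sum, map_sum, Module.finrank_eq_card_basis b,
      Module.finrank_eq_card_basis bK] at h3
    linarith)
  refine ⟨Φ, fun i => ?_⟩
  have := h i
  have := hp i
  rw [Frame.κ]
  linarith

/-- Pushing a frame forward along an equivariant surjection. -/
def Frame.map {ρ : A →ₗ[ℂ] E →ₗ[ℂ] E} {ρ' : A →ₗ[ℂ] F →ₗ[ℂ] F} {a : α → A} {z : A}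
    (Φ : Frame ρ a z) (π : E →ₗ[ℂ] F) (hπ : ∀ x v, π (ρ x v) = ρ' x (π v))
    (hs : Function.Surjective π) : Frame ρ' a z where
  ι := Φ.ι
  e := π ∘ Φ.e
  span_e := by
    rw [Set.range_comp, Submodule.span_image, Φ.span_e, Submodule.map_top,
      LinearMap.range_eq_top.2 hs]
  X := Φ.X
  apply_e t j := by
    rw [Function.comp_apply, ← hπ, Φ.apply_e, map_sum]
    simp
  μ := Φ.μ
  mem_eig i := mem_maxGenEigenspace_map (ρ z) _ π (hπ z) (Φ.mem_eig i)
  off := Φ.off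

/-- Existence of complements of stable subspaces. -/
def HasCompl (ρ : A →ₗ[ℂ] E →ₗ[ℂ] E) : Prop :=
  ∀ K : Submodule ℂ E, IsStable ρ K → ∃ L, IsStable ρ L ∧ IsCompl K L

lemma exists_frame_moment_zero_of_simple [FiniteDimensional ℂ E] (ρ : A →ₗ[ℂ] E →ₗ[ℂ] E)
    {a : α → A} (ha : Submodule.span ℂ (Set.range a) = ⊤)
    (hs : ∀ K, IsStable ρ K → K = ⊥ ∨ K = ⊤) : ∃ Φ : Frame ρ a 0, moment Φ.X = 0 := by
  obtain ⟨Φ, Λ, p, hne, -, h⟩ := exists_frame_critical ρ ha 0 (fun _ => 0) le_rfl zero_le_one (by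
    intro ι _ _ b μ _ σ hσ hst _ hsum
    exfalso
    have hne : Nonempty ι := by
      by_contra hcon
      rw [not_nonempty_iff] at hcon
      exact hσ (Subsingleton.elim _ _)
    obtain ⟨m, hm⟩ := Finite.exists_min σ
    have hall : ∀ i, σ i ≤ σ m := by
      intro i
      rcases hs _ (hst (σ m)) with h | h
      · exfalso
        have : b m ∈ Submodule.span ℂ (b '' {i | σ i ≤ σ m}) := Submodule.subset_span ⟨m, le_refl (σ m), rfl⟩
        rw [h, Submodule.mem_bot] at this
        exact b.ne_zero m this
      · have : b i ∈ Submodule.span ℂ (b '' {i | σ i ≤ σ m}) := h ▸ Submodule.mem_top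
        rw [b.mem_span_image, b.repr_self] at this
        exact this (by simp)
    have hc : ∀ i, σ i = σ m := fun i => le_antisymm (hall i) (hm i)
    have h1 := hsum one_pos
    rw [Finset.sum_congr rfl fun i _ => hc i, Finset.sum_const, Finset.card_univ,
      nsmul_eq_mul] at h1
    have h2 : (Fintype.card ι : ℝ) ≠ 0 := Nat.cast_ne_zero.2 Fintype.card_ne_zero
    have h3 := (mul_eq_zero.1 h1).resolve_left h2
    exact hσ (funext fun i => (hc i).trans h3))
  refine ⟨Φ, ?_⟩
  have hμ : ∀ i, Φ.μ i = 0 := fun i => by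
    by_contra hne0
    have hi := Φ.mem_eig i
    rw [map_zero, Module.End.mem_maxGenEigenspace] at hi
    obtain ⟨k, hk⟩ := hi
    have : (0 - Φ.μ i • (1 : Module.End ℂ E)) ^ k = (-Φ.μ i) ^ k • (1 : Module.End ℂ E) := by
      rw [zero_sub, ← neg_smul, smul_pow, one_pow]
    rw [this, LinearMap.smul_apply, Module.End.one_apply, smul_eq_zero] at hk
    exact hk.elim (pow_ne_zero k (neg_ne_zero.2 hne0)) (hne i)
  have hsum : ∑ i, (moment Φ.X i i).re = 0 := by
    simp only [moment_apply_self_re]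
    rw [Finset.sum_comm]
    refine Finset.sum_eq_zero fun t _ => ?_
    rw [Finset.sum_sub_distrib, sub_eq_zero, Finset.sum_comm]
  have hdiag : ∀ i, (moment Φ.X i i).re = -Λ := fun i => by simpa using h i
  ext i j
  by_cases hij : i = j
  · subst hij
    have hre : (moment Φ.X i i).re = 0 := by
      simp only [hdiag, Finset.sum_const, Finset.card_univ, nsmul_eq_mul] at hsum
      rw [hdiag]
      exact (mul_eq_zero.1 hsum).resolve_left
        (Nat.cast_ne_zero.2 (Fintype.card_pos_iff.2 ⟨i⟩).ne')
    have him : (moment Φ.X i i).im = 0 := by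
      have := congrFun₂ (moment_isHermitian Φ.X) i i
      rw [Matrix.conjTranspose_apply] at this
      exact Complex.conj_eq_iff_im.1 this
    exact Complex.ext hre him
  · exact Φ.off i j hij ((hμ i).trans (hμ j).symm)

/-- A finite-dimensional space all of whose stable subspaces have stable complements carries a
frame with vanishing moment. -/
theorem exists_frame_moment_zero {a : α → A} (ha : Submodule.span ℂ (Set.range a) = ⊤) :
    ∀ (n : ℕ) {E : Type} [AddCommGroup E] [Module ℂ E] [FiniteDimensional ℂ E]
      (ρ : A →ₗ[ℂ] E →ₗ[ℂ] E), Module.finrank ℂ E = n → HasCompl ρ →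
      ∃ Φ : Frame ρ a 0, moment Φ.X = 0 := by
  intro n
  induction n using Nat.strong_induction_on with
  | _ n ih =>
    intro E _ _ _ ρ hn hc
    by_cases hs : ∀ K, IsStable ρ K → K = ⊥ ∨ K = ⊤
    · exact exists_frame_moment_zero_of_simple ρ ha hs
    push Not at hs
    obtain ⟨K, hK, hKb, hKt⟩ := hs
    obtain ⟨L, hL, hKL⟩ := hc K hK
    have hLt : L ≠ ⊤ := fun h => hKb (by simpa [h] using hKL.inf_eq_bot)
    have sub : ∀ (N : Submodule ℂ E) (hN : IsStable ρ N), N ≠ ⊤ →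
        ∃ Φ : Frame (subAct ρ hN) a 0, moment Φ.X = 0 := by
      intro N hN hNt
      refine ih _ (hn ▸ Submodule.finrank_lt hNt) _ rfl fun K' hK' => ?_
      have hmap : IsStable ρ (K'.map N.subtype) := hK'.map fun x v => rfl
      obtain ⟨L', hL', hcompl⟩ := hc _ hmap
      refine ⟨L'.comap N.subtype, hL'.comap fun x v => rfl, ?_⟩
      constructor
      · rw [disjoint_iff, eq_bot_iff]
        rintro v ⟨h1, h2⟩
        have : (v : E) ∈ K'.map N.subtype ⊓ L' := ⟨⟨v, h1, rfl⟩, h2⟩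
        rw [hcompl.inf_eq_bot, Submodule.mem_bot] at this
        exact Subtype.ext this
      · rw [codisjoint_iff, eq_top_iff]
        rintro v -
        have : (v : E) ∈ K'.map N.subtype ⊔ L' := hcompl.sup_eq_top ▸ Submodule.mem_top
        obtain ⟨_, ⟨k, hk, rfl⟩, l, hl, hkl⟩ := Submodule.mem_sup.1 this
        have hv : v = k + (v - k) := by abel
        rw [hv]
        refine Submodule.add_mem_sup hk ?_
        change ((v - k : N) : E) ∈ L'
        have : ((v - k : N) : E) = l := by
          rw [Submodule.coe_sub, ← hkl]; simp
        rwa [this]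
    obtain ⟨Φ, hΦ⟩ := sub K hK hKt
    obtain ⟨Ψ, hΨ⟩ := sub L hL hLt
    refine ⟨(Φ.prod Ψ).map (K.subtype.coprod L.subtype) (fun x v => ?_) fun v => ?_, ?_⟩
    · simp [prodAct_apply, coe_subAct_apply]
    · have : v ∈ K ⊔ L := hKL.sup_eq_top ▸ Submodule.mem_top
      obtain ⟨k, hk, l, hl, rfl⟩ := Submodule.mem_sup.1 this
      exact ⟨(⟨k, hk⟩, ⟨l, hl⟩), by simp⟩
    · refine (moment_fromBlocks Φ.X Ψ.X).trans ?_
      rw [hΦ, hΨ, Matrix.fromBlocks_zero]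
      rfl

end Frames

section Orthogonal

variable {α : Type} [Fintype α] {E : Type} [NormedAddCommGroup E] [InnerProductSpace ℂ E]
  [FiniteDimensional ℂ E]

lemma orthogonal_stable_of_sum_commutator (T T' : α → E →ₗ[ℂ] E)
    (hadj : ∀ t x y, inner ℂ (T t x) y = inner ℂ x (T' t y))
    (hcomm : ∑ t, (T t * T' t - T' t * T t) = 0) (K : Submodule ℂ E)
    (hK : ∀ t, ∀ v ∈ K, T t v ∈ K) (t : α) {v : E} (hv : v ∈ K.orthogonal) :
    T t v ∈ K.orthogonal := by
  set P : E →ₗ[ℂ] E := (K.starProjection : E →L[ℂ] E).toLinearMap with hP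
  have hPa : ∀ x, P x = K.starProjection x := fun _ => rfl
  have hPK : ∀ x, P x ∈ K := fun x => K.starProjection_apply_mem x
  have hPid : ∀ x ∈ K, P x = x := fun x hx => Submodule.starProjection_eq_self_iff.2 hx
  have hPadj : ∀ x y, inner ℂ (P x) y = inner ℂ x (P y) := fun x y =>
    Submodule.inner_starProjection_left_eq_right K x y
  have hadj' : ∀ t x y, inner ℂ y (T t x) = inner ℂ (T' t y) x := fun t x y => by
    rw [← inner_conj_symm, hadj, inner_conj_symm]
  have hPP : P * P = P := LinearMap.ext fun x => hPid _ (hPK x)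
  have hTP : ∀ t, P * T t * P = T t * P := fun t => LinearMap.ext fun x =>
    hPid _ (hK t _ (hPK x))
  have hPT : ∀ t, P * T' t * P = P * T' t := fun t => LinearMap.ext fun x => by
    refine ext_inner_left ℂ fun y => ?_
    simp only [Module.End.mul_apply]
    rw [← hPadj, ← hadj, ← hPadj, ← hPadj, ← hadj, hPid _ (hK t _ (hPK y))]
  set B : α → E →ₗ[ℂ] E := fun t => P * T t * (1 - P)
  set B' : α → E →ₗ[ℂ] E := fun t => (1 - P) * T' t * P
  have hB : ∀ t x y, inner ℂ y (B t x) = inner ℂ (B' t y) x := by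
    intro t x y
    simp only [B, B', Module.End.mul_apply, LinearMap.sub_apply, Module.End.one_apply, map_sub,
      inner_sub_left, inner_sub_right]
    rw [← hPadj, ← hPadj, hadj', hadj', hPadj]
  have hsplit : ∀ t, LinearMap.trace ℂ E (P * (T t * T' t - T' t * T t) * P) =
      LinearMap.trace ℂ E (B t * B' t) := by
    intro t
    have h1 : P * (T t * T' t - T' t * T t) * P =
        B t * B' t + ((P * T t * P) * (P * T' t * P) - (P * T' t * P) * (P * T t * P)) := by
      have e1 : B t * B' t = P * T t * T' t * P - P * T t * P * T' t * P := by
        have : (1 - P) * (1 - P) = 1 - P := by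
          rw [mul_sub, sub_mul, sub_mul, hPP]; simp
        simp only [B, B']
        calc _ = P * T t * ((1 - P) * (1 - P)) * T' t * P := by simp only [mul_assoc]
          _ = _ := by rw [this, mul_sub, mul_one, sub_mul, sub_mul]
      have e2 : (P * T t * P) * (P * T' t * P) = P * T t * P * T' t * P := by
        calc _ = P * T t * (P * P) * T' t * P := by simp only [mul_assoc]
          _ = _ := by rw [hPP]
      have e3 : (P * T' t * P) * (P * T t * P) = P * T' t * T t * P := by
        rw [hPT, hTP]; simp only [mul_assoc]
      rw [e1, e2, e3, mul_sub, sub_mul]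
      simp only [mul_assoc]
      abel
    rw [h1, map_add, map_sub, LinearMap.trace_mul_comm ℂ (P * T t * P), sub_self, add_zero]
  have hsum : ∑ t, LinearMap.trace ℂ E (B t * B' t) = 0 := by
    rw [← Finset.sum_congr rfl fun t _ => hsplit t, ← map_sum, ← Finset.sum_mul,
      ← Finset.mul_sum, hcomm]
    simp
  let b := stdOrthonormalBasis ℂ E
  have htr : ∀ t, LinearMap.trace ℂ E (B t * B' t) = ((∑ i, ‖B' t (b i)‖ ^ 2 : ℝ) : ℂ) := by
    intro t
    rw [LinearMap.trace_eq_sum_inner _ b]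
    push_cast
    refine Finset.sum_congr rfl fun i _ => ?_
    rw [Module.End.mul_apply, hB, inner_self_eq_norm_sq_to_K]
    rfl
  simp only [htr] at hsum
  rw [← Complex.ofReal_sum, Complex.ofReal_eq_zero] at hsum
  have h0 := (Finset.sum_eq_zero_iff_of_nonneg fun t _ =>
    Finset.sum_nonneg fun i _ => by positivity).1 hsum t (Finset.mem_univ t)
  have h1 := (Finset.sum_eq_zero_iff_of_nonneg fun i _ => by positivity).1 h0
  have hB0 : B' t = 0 := b.toBasis.ext fun i => by
    have := h1 i (Finset.mem_univ i)
    simpa using this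
  rw [Submodule.mem_orthogonal]
  intro u hu
  have hPv : P v = 0 := (Submodule.starProjection_apply_eq_zero_iff K).2 hv
  have h2 : inner ℂ u (B t v) = 0 := by rw [hB, hB0]; simp
  simp only [B, Module.End.mul_apply, LinearMap.sub_apply, Module.End.one_apply, hPv,
    sub_zero] at h2
  rwa [← hPadj, hPid u hu] at h2

lemma exists_sub_mem_kernel (T T' : α → E →ₗ[ℂ] E)
    (hadj : ∀ t x y, inner ℂ (T t x) y = inner ℂ x (T' t y))
    (hcomm : ∑ t, (T t * T' t - T' t * T t) = 0) (K : Submodule ℂ E)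
    (hK : ∀ t, ∀ v ∈ K, T t v ∈ K) (u : E) (hu : ∀ t, T t u ∈ K) :
    ∃ k ∈ K, ∀ t, T t (u - k) = 0 := by
  refine ⟨K.starProjection u, K.starProjection_apply_mem u, fun t => ?_⟩
  have h1 : T t (u - K.starProjection u) ∈ K.orthogonal :=
    orthogonal_stable_of_sum_commutator T T' hadj hcomm K hK t
      (K.sub_starProjection_mem_orthogonal u)
  have h2 : T t (u - K.starProjection u) ∈ K := by
    rw [map_sub]
    exact K.sub_mem (hu t) (hK t _ (K.starProjection_apply_mem u))
  have : T t (u - K.starProjection u) ∈ K ⊓ K.orthogonal := ⟨h2, h1⟩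
  rwa [K.inf_orthogonal_eq_bot, Submodule.mem_bot] at this

end Orthogonal

section Forms

variable {α : Type} [Fintype α] {A Y F : Type} [AddCommGroup A] [Module ℂ A] [AddCommGroup Y]
  [Module ℂ Y] [AddCommGroup F] [Module ℂ F] {S : Type} [Fintype S] [DecidableEq S]

/-- The derivation action of an endomorphism on multilinear maps, as a multilinear map. -/
def derMap (z : Y →ₗ[ℂ] Y) :
    MultilinearMap ℂ (fun _ : S => Y) F →ₗ[ℂ] MultilinearMap ℂ (fun _ : S => Y) F where
  toFun f := ∑ s, f.compLinearMap (Function.update (fun _ => LinearMap.id) s z)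
  map_add' f g := by
    ext v; simp [Finset.sum_add_distrib]
  map_smul' c f := by
    ext v; simp [Finset.smul_sum]

@[simp] lemma derMap_apply (z : Y →ₗ[ℂ] Y) (f : MultilinearMap ℂ (fun _ : S => Y) F)
    (v : S → Y) : derMap z f v = der z f v := by
  simp only [derMap, LinearMap.coe_mk, AddHom.coe_mk, sum_apply, der,
    MultilinearMap.compLinearMap_apply]
  refine Finset.sum_congr rfl fun s _ => congrArg f (funext fun i => ?_)
  by_cases h : i = s
  · subst h; simp
  · simp [h]

lemma derMap_add_left (z w : Y →ₗ[ℂ] Y) (f : MultilinearMap ℂ (fun _ : S => Y) F) :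
    derMap (z + w) f = derMap z f + derMap w f := by
  ext v
  simp [der, MultilinearMap.map_update_add, Finset.sum_add_distrib]

lemma derMap_smul_left (c : ℂ) (z : Y →ₗ[ℂ] Y) (f : MultilinearMap ℂ (fun _ : S => Y) F) :
    derMap (c • z) f = c • derMap z f := by
  ext v
  simp [der, MultilinearMap.map_update_smul, Finset.smul_sum]

lemma eq_zero_of_span {ι : Type} {e : ι → Y} (he : Submodule.span ℂ (Set.range e) = ⊤)
    {f : MultilinearMap ℂ (fun _ : S => Y) F} (hf : ∀ j : S → ι, f (e ∘ j) = 0) : f = 0 := by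
  let b := Module.Basis.ofSpan he.ge
  have hb : ∀ i, ∃ j, e j = b i := fun i => Module.Basis.ofSpan_subset he.ge ⟨i, rfl⟩
  choose k hk using hb
  refine Module.Basis.ext_multilinear (fun _ => b) fun v => ?_
  have := hf fun s => k (v s)
  rw [zero_apply, ← this]
  exact congrArg f (funext fun s => (hk (v s)).symm)

/-- Values of a multilinear form on a family. -/
def arrayOf {ι : Type} (e : ι → Y) : MultilinearMap ℂ (fun _ : S => Y) ℂ →ₗ[ℂ] ((S → ι) → ℂ) where
  toFun f j := f (e ∘ j)
  map_add' _ _ := rfl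
  map_smul' _ _ := rfl

lemma arrayOf_injective {ι : Type} {e : ι → Y} (he : Submodule.span ℂ (Set.range e) = ⊤)
    {f : MultilinearMap ℂ (fun _ : S => Y) ℂ} (hf : arrayOf e f = 0) : f = 0 :=
  eq_zero_of_span he fun j => congrFun hf j

lemma arrayOf_derMap {ρ : A →ₗ[ℂ] Y →ₗ[ℂ] Y} {a : α → A} {z : A} (Φ : Frame ρ a z) (t : α)
    (f : MultilinearMap ℂ (fun _ : S => Y) ℂ) :
    arrayOf Φ.e (derMap (ρ (a t)) f) = theta (Φ.X t).transpose (arrayOf Φ.e f) := by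
  funext j
  simp only [arrayOf, LinearMap.coe_mk, AddHom.coe_mk, derMap_apply, der, theta, Finset.sum_apply,
    slot]
  refine Finset.sum_congr rfl fun s _ => ?_
  rw [Function.comp_apply, Φ.apply_e, MultilinearMap.map_update_sum]
  refine Finset.sum_congr rfl fun i _ => ?_
  rw [MultilinearMap.map_update_smul, Matrix.transpose_apply, smul_eq_mul, Function.comp_update]

/-- Invariants lift along quotients by stable subspaces of spaces of forms. -/
theorem exists_invariant_mod [FiniteDimensional ℂ Y] {ρ : A →ₗ[ℂ] Y →ₗ[ℂ] Y} (hc : HasCompl ρ)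
    {a : α → A} (ha : Submodule.span ℂ (Set.range a) = ⊤) {I : Type} [Fintype I] (q : I → ℕ)
    (K : Submodule ℂ (Π i, MultilinearMap ℂ (fun _ : Fin (q i) => Y) ℂ))
    (hK : ∀ x, ∀ s ∈ K, (fun i => derMap (ρ x) (s i)) ∈ K)
    (u : Π i, MultilinearMap ℂ (fun _ : Fin (q i) => Y) ℂ)
    (hu : ∀ x, (fun i => derMap (ρ x) (u i)) ∈ K) :
    ∃ k ∈ K, ∀ x i, derMap (ρ x) (u i - k i) = 0 := by
  obtain ⟨Φ, hΦ⟩ := exists_frame_moment_zero ha _ ρ rfl hc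
  let J := Σ i, (Fin (q i) → Φ.ι)
  let Ψ : (Π i, MultilinearMap ℂ (fun _ : Fin (q i) => Y) ℂ) →ₗ[ℂ] EuclideanSpace ℂ J :=
    { toFun := fun s => WithLp.toLp 2 fun j => arrayOf Φ.e (s j.1) j.2
      map_add' := fun s s' => by ext j; simp
      map_smul' := fun c s => by ext j; simp }
  let Θ : Matrix Φ.ι Φ.ι ℂ → EuclideanSpace ℂ J →ₗ[ℂ] EuclideanSpace ℂ J := fun Z =>
    { toFun := fun F => WithLp.toLp 2 fun j => theta Z (fun l => F ⟨j.1, l⟩) j.2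
      map_add' := fun F F' => by
        ext j; simp [theta, slot, mul_add, Finset.sum_add_distrib]
      map_smul' := fun c F => by
        ext j; simp [theta, slot, Finset.mul_sum, mul_left_comm] }
  have hΘ : ∀ Z F j, Θ Z F j = theta Z (fun l => F ⟨j.1, l⟩) j.2 := fun _ _ _ => rfl
  have hΨΘ : ∀ t s, Ψ (fun i => derMap (ρ (a t)) (s i)) = Θ (Φ.X t).transpose (Ψ s) := by
    intro t s
    ext j
    exact congrFun (arrayOf_derMap Φ t (s j.1)) j.2
  have hinj : Function.Injective Ψ := by
    rw [← LinearMap.ker_eq_bot, eq_bot_iff]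
    intro s hs
    refine funext fun i => arrayOf_injective Φ.span_e (funext fun l => ?_)
    have := congrArg (fun F : EuclideanSpace ℂ J => F ⟨i, l⟩) (LinearMap.mem_ker.1 hs)
    exact this
  obtain ⟨k', hk', h⟩ := exists_sub_mem_kernel (fun t => Θ (Φ.X t).transpose)
    (fun t => Θ (Φ.X t).transpose.conjTranspose) (by
      intro t x y
      simp only [PiLp.inner_apply, hΘ]
      rw [Fintype.sum_sigma, Fintype.sum_sigma]
      refine Finset.sum_congr rfl fun i _ => ?_
      have := theta_adjoint (Φ.X t).transpose.conjTranspose (fun l => y ⟨i, l⟩) (fun l => x ⟨i, l⟩)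
      rw [Matrix.conjTranspose_conjTranspose] at this
      simpa [pairing] using this.symm) (by
      have h1 := moment_transpose Φ.X
      rw [hΦ, Matrix.transpose_zero, neg_zero] at h1
      ext F j
      have h2 : ∑ t, (theta (Φ.X t).transpose (theta (Φ.X t).transpose.conjTranspose
          (fun l => F ⟨j.1, l⟩)) - theta (Φ.X t).transpose.conjTranspose (theta (Φ.X t).transpose
          (fun l => F ⟨j.1, l⟩))) = 0 := by
        simp only [theta_commutator]
        rw [← theta_sum_left, h1]
        funext l; simp [theta, slot]
      have h3 := congrFun h2 j.2
      simp only [Finset.sum_apply, Pi.sub_apply] at h3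
      simpa [hΘ, WithLp.ofLp_sum, Finset.sum_apply] using h3) (K.map Ψ) (by
      rintro t _ ⟨s, hs, rfl⟩
      exact ⟨_, hK (a t) s hs, hΨΘ t s⟩) (Ψ u) (fun t => ⟨_, hu (a t), hΨΘ t u⟩)
  obtain ⟨k, hk, rfl⟩ := hk'
  refine ⟨k, hk, fun x => ?_⟩
  have hx : x ∈ Submodule.span ℂ (Set.range a) := ha ▸ Submodule.mem_top
  induction hx using Submodule.span_induction with
  | mem x hx =>
    obtain ⟨t, rfl⟩ := hx
    have h1 := h t
    rw [← map_sub] at h1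
    have h2 := (hΨΘ t (u - k)).trans h1
    rw [← map_zero Ψ] at h2
    exact fun i => congrFun (hinj h2) i
  | zero => intro i; ext v; simp [der]
  | add x y _ _ hx hy => intro i; rw [map_add, derMap_add_left, hx, hy, add_zero]
  | smul c x _ hx => intro i; rw [map_smul, derMap_smul_left, hx, smul_zero]

end Forms

lemma projection_comm {E : Type} [AddCommGroup E] [Module ℂ E] {p q : Submodule ℂ E}
    (h : IsCompl p q) (T : E →ₗ[ℂ] E) (hp : ∀ v ∈ p, T v ∈ p) (hq : ∀ v ∈ q, T v ∈ q) (x : E) :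
    p.projection q h (T x) = T (p.projection q h x) := by
  obtain ⟨u, hu, w, hw, rfl⟩ := Submodule.mem_sup.1 (h.sup_eq_top ▸ Submodule.mem_top : x ∈ p ⊔ q)
  simp only [map_add]
  rw [Submodule.projection_apply_of_mem_left h hu, Submodule.projection_apply_of_mem_left h (hp u hu),
    (Submodule.projection_apply_eq_zero_iff h).2 hw,
    (Submodule.projection_apply_eq_zero_iff h).2 (hq w hw)]
  simp

section Invariant

variable {A X : Type} [AddCommGroup A] [Module ℂ A] [AddCommGroup X] [Module ℂ X]
  {F : Type} [AddCommGroup F] [Module ℂ F]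

/-- Invariance of a multilinear map under a family of operators acting by derivations. -/
def IsInv {S : Type} [Fintype S] [DecidableEq S] (ρ : A →ₗ[ℂ] X →ₗ[ℂ] X)
    (f : MultilinearMap ℂ (fun _ : S => X) F) : Prop := ∀ x v, der (ρ x) f v = 0

/-- The vectors annihilated by a multilinear map in a given argument. -/
def slotKer {S : Type} [DecidableEq S] (f : MultilinearMap ℂ (fun _ : S => X) F) (i : S) :
    Submodule ℂ X where
  carrier := {u | ∀ v, f (Function.update v i u) = 0}
  add_mem' h h' v := by rw [MultilinearMap.map_update_add, h v, h' v, add_zero]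
  zero_mem' v := MultilinearMap.map_update_zero _ _ _
  smul_mem' c u h v := by rw [MultilinearMap.map_update_smul, h v, smul_zero]

lemma IsInv.isStable_slotKer {S : Type} [Fintype S] [DecidableEq S] {ρ : A →ₗ[ℂ] X →ₗ[ℂ] X}
    {f : MultilinearMap ℂ (fun _ : S => X) F} (hf : IsInv ρ f) (i : S) :
    IsStable ρ (slotKer f i) := by
  intro x u hu v
  have h := hf x (Function.update v i u)
  rw [der, ← Finset.add_sum_erase _ _ (Finset.mem_univ i), Function.update_self,
    Function.update_idem, Finset.sum_eq_zero, add_zero] at h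
  · exact h
  · intro s hs
    have hsi := Finset.ne_of_mem_erase hs
    rw [Function.update_of_ne hsi, Function.update_comm hsi.symm]
    exact hu _

/-- The common kernel of all invariant forms. -/
def nullSub (ρ : A →ₗ[ℂ] X →ₗ[ℂ] X) : Submodule ℂ X :=
  sInf {K | ∃ (n : ℕ) (f : MultilinearMap ℂ (fun _ : Fin n => X) ℂ) (_ : IsInv ρ f) (i : Fin n),
    K = slotKer f i}

lemma mem_nullSub {ρ : A →ₗ[ℂ] X →ₗ[ℂ] X} {u : X} : u ∈ nullSub ρ ↔
    ∀ (n : ℕ) (f : MultilinearMap ℂ (fun _ : Fin n => X) ℂ), IsInv ρ f → ∀ i v,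
      f (Function.update v i u) = 0 := by
  rw [nullSub, Submodule.mem_sInf]
  constructor
  · intro h n f hf i v
    exact h _ ⟨n, f, hf, i, rfl⟩ v
  · rintro h _ ⟨n, f, hf, i, rfl⟩ v
    exact h n f hf i v

lemma nullSub_isStable (ρ : A →ₗ[ℂ] X →ₗ[ℂ] X) : IsStable ρ (nullSub ρ) := by
  refine IsStable.sInf ?_
  rintro _ ⟨n, f, hf, i, rfl⟩
  exact hf.isStable_slotKer i

/-- Maximal proper stable subspaces. -/
structure IsMaxStable (ρ : A →ₗ[ℂ] X →ₗ[ℂ] X) (H : Submodule ℂ X) : Prop where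
  stable : IsStable ρ H
  ne_top : H ≠ ⊤
  eq_or : ∀ K, IsStable ρ K → H ≤ K → K = H ∨ K = ⊤

lemma exists_le_isMaxStable [FiniteDimensional ℂ X] {ρ : A →ₗ[ℂ] X →ₗ[ℂ] X} {K : Submodule ℂ X}
    (hK : IsStable ρ K) (hKt : K ≠ ⊤) : ∃ H, K ≤ H ∧ IsMaxStable ρ H := by
  obtain ⟨H, hH, hmax⟩ := (wellFounded_gt (α := Submodule ℂ X)).has_min
    {H | K ≤ H ∧ IsStable ρ H ∧ H ≠ ⊤} ⟨K, le_rfl, hK, hKt⟩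
  refine ⟨H, hH.1, hH.2.1, hH.2.2, fun L hL hHL => ?_⟩
  by_contra! hcon
  exact hmax L ⟨hH.1.trans hHL, hL, hcon.2⟩ (lt_of_le_of_ne hHL hcon.1.symm)

lemma hasCompl_of_sInf_eq_bot [FiniteDimensional ℂ X] {ρ : A →ₗ[ℂ] X →ₗ[ℂ] X}
    (h : ∀ u : X, u ≠ 0 → ∃ H, IsMaxStable ρ H ∧ u ∉ H) : HasCompl ρ := by
  intro K hK
  obtain ⟨L, ⟨hL, hKL⟩, hmin⟩ := (wellFounded_lt (α := Submodule ℂ X)).has_min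
    {L | IsStable ρ L ∧ K ⊔ L = ⊤} ⟨⊤, IsStable.top ρ, by simp⟩
  refine ⟨L, hL, ⟨?_, codisjoint_iff.2 hKL⟩⟩
  rw [disjoint_iff, eq_bot_iff]
  intro u hu
  rw [Submodule.mem_bot]
  by_contra hu0
  obtain ⟨H, hH, huH⟩ := h u hu0
  refine hmin (L ⊓ H) ⟨hL.inf hH.stable, ?_⟩ (lt_of_le_of_ne inf_le_left fun heq => huH ?_)
  · have h1 : (K ⊓ L) ⊔ H = ⊤ := by
      refine (hH.eq_or _ ((hK.inf hL).sup hH.stable) le_sup_right).resolve_left fun heq => huH ?_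
      rw [← heq]
      exact Submodule.mem_sup_left hu
    have h2 : L = (K ⊓ L) ⊔ (L ⊓ H) := by
      have := (sup_inf_assoc_of_le H (inf_le_right : K ⊓ L ≤ L)).symm
      rw [h1, top_inf_eq, inf_comm H L] at this
      exact this.symm
    rw [eq_top_iff, ← hKL]
    refine sup_le le_sup_left ?_
    conv_lhs => rw [h2]
    exact sup_le_sup_right inf_le_left _
  · exact inf_eq_left.1 heq hu.2

lemma IsMaxStable.map_mkQ {ρ : A →ₗ[ℂ] X →ₗ[ℂ] X} {N H : Submodule ℂ X} (hN : IsStable ρ N)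
    (hNH : N ≤ H) (hH : IsMaxStable ρ H) : IsMaxStable (quotAct ρ hN) (H.map N.mkQ) := by
  have hcm : (H.map N.mkQ).comap N.mkQ = H := by
    rw [Submodule.comap_map_mkQ, sup_eq_right.2 hNH]
  refine ⟨hH.stable.map fun x v => rfl, fun h => hH.ne_top ?_, fun K hK hHK => ?_⟩
  · rw [← hcm, h, Submodule.comap_top]
  · have h1 := hH.eq_or (K.comap N.mkQ) (IsStable.comap (ρ' := quotAct ρ hN) (fun x v => rfl) hK)
      (by rw [← hcm]; exact Submodule.comap_mono hHK)
    have h2 : (K.comap N.mkQ).map N.mkQ = K := Submodule.map_comap_eq_of_surjective N.mkQ_surjective K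
    rcases h1 with h1 | h1
    · left; rw [← h2, h1]
    · right; rw [← h2, h1, Submodule.map_top, Submodule.range_mkQ]

variable {G : Type} [Group G]

/-- A reductive group acting compatibly with a family of operators: invariants agree and stable
subspaces have stable complements. -/
structure ReductiveData (ρ : A →ₗ[ℂ] X →ₗ[ℂ] X) (r : Representation ℂ G X) : Prop where
  stable : ∀ s K, IsStable ρ K → IsStable ρ (K.comap (r s))
  compl : ∀ W : Submodule ℂ X, (∀ s, W.map (r s) ≤ W) → ∃ W', IsCompl W W' ∧
    ∀ s, W'.map (r s) ≤ W'
  inv_iff : ∀ (n : ℕ) (f : MultilinearMap ℂ (fun _ : Fin n => X) ℂ),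
    (∀ s v, f (fun i => r s (v i)) = f v) ↔ IsInv ρ f

lemma rep_mul_inv (r : Representation ℂ G X) (s : G) (u : X) : r s (r s⁻¹ u) = u := by
  rw [← Module.End.mul_apply, ← map_mul, mul_inv_cancel, map_one, Module.End.one_apply]

lemma comap_inv_comap (r : Representation ℂ G X) (s : G) (H : Submodule ℂ X) :
    (H.comap (r s)).comap (r s⁻¹) = H := by
  ext u; rw [Submodule.mem_comap, Submodule.mem_comap, rep_mul_inv]

namespace ReductiveData

variable {ρ : A →ₗ[ℂ] X →ₗ[ℂ] X} {r : Representation ℂ G X}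

lemma map_mem_nullSub (D : ReductiveData ρ r) (s : G) {u : X} (hu : u ∈ nullSub ρ) : r s u ∈
    nullSub ρ := by
  rw [mem_nullSub] at hu ⊢
  intro n f hf i v
  have h := ((D.inv_iff n f).2 hf) s (Function.update (fun j => r s⁻¹ (v j)) i u)
  rw [hu n f hf] at h
  rw [← h]
  congr 1
  funext j
  by_cases hj : j = i
  · subst hj; simp
  · simp [hj]

lemma isMaxStable_comap (D : ReductiveData ρ r) (s : G) {H : Submodule ℂ X} (hH : IsMaxStable ρ H) :
    IsMaxStable ρ (H.comap (r s)) := by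
  refine ⟨D.stable s H hH.stable, fun h => hH.ne_top ?_, fun K hK hle => ?_⟩
  · rw [← comap_inv_comap r s H, h, Submodule.comap_top]
  · have h1 := hH.eq_or (K.comap (r s⁻¹)) (D.stable _ _ hK)
      (by rw [← comap_inv_comap r s H]; exact Submodule.comap_mono hle)
    have h2 : K = (K.comap (r s⁻¹)).comap (r s) := by
      have := comap_inv_comap r s⁻¹ K
      rw [inv_inv] at this
      exact this.symm
    rcases h1 with h1 | h1
    · left; rw [h2, h1]
    · right; rw [h2, h1, Submodule.comap_top]

theorem exists_isMaxStable_notMem (D : ReductiveData ρ r) [FiniteDimensional ℂ X] {u : X}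
    (hu : u ∉ nullSub ρ) :
    ∃ H, IsMaxStable ρ H ∧ nullSub ρ ≤ H ∧ u ∉ H := by
  by_contra! hcon
  set 𝒦 : Set (Submodule ℂ X) := {H | IsMaxStable ρ H ∧ nullSub ρ ≤ H}
  have huN : u ∈ sInf 𝒦 := by
    rw [Submodule.mem_sInf]
    exact fun H hH => hcon H hH.1 hH.2
  have hst : ∀ s, (sInf 𝒦).map (r s) ≤ sInf 𝒦 := by
    rintro s _ ⟨w, hw, rfl⟩
    rw [Submodule.mem_sInf]
    intro H hH
    exact (Submodule.mem_sInf.1 hw) (H.comap (r s)) ⟨D.isMaxStable_comap s hH.1,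
      fun y hy => hH.2 (D.map_mem_nullSub s hy)⟩
  obtain ⟨Z, hZ, hZst⟩ := D.compl _ hst
  rw [mem_nullSub] at hu
  push Not at hu
  obtain ⟨n, f, hf, i, v, hfv⟩ := hu
  set π := (sInf 𝒦).projection Z hZ
  set f₁ := f.compLinearMap (Function.update (fun _ => LinearMap.id) i π) with hf₁
  have hf₁v : ∀ w, f₁ w = f (Function.update w i (π (w i))) := by
    intro w
    rw [hf₁, MultilinearMap.compLinearMap_apply]
    refine congrArg f (funext fun j => ?_)
    by_cases hj : j = i
    · subst hj; simp
    · simp [hj]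
  have hinv : IsInv ρ f₁ := by
    rw [← D.inv_iff]
    intro s w
    rw [hf₁v, hf₁v, ← (D.inv_iff n f).2 hf s (Function.update w i (π (w i)))]
    congr 1
    funext j
    by_cases hj : j = i
    · subst hj
      simp only [Function.update_self]
      exact projection_comm hZ (r s) (fun y hy => hst s ⟨y, hy, rfl⟩)
        (fun y hy => hZst s ⟨y, hy, rfl⟩) _
    · simp [hj]
  have hne : slotKer f₁ i ≠ ⊤ := by
    intro htop
    have h1 : u ∈ slotKer f₁ i := htop ▸ Submodule.mem_top
    have h2 := h1 v
    rw [hf₁v, Function.update_self, Function.update_idem,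
      Submodule.projection_apply_of_mem_left hZ huN] at h2
    exact hfv h2
  obtain ⟨H, hle, hH⟩ := exists_le_isMaxStable (hinv.isStable_slotKer i) hne
  have hNH : nullSub ρ ≤ H := fun y hy => hle fun w => mem_nullSub.1 hy n f₁ hinv i w
  have hZH : Z ≤ H := fun y hy => hle fun w => by
    rw [hf₁v, Function.update_self, (Submodule.projection_apply_eq_zero_iff hZ).2 hy]
    exact f.map_coord_zero i (by simp)
  refine hH.ne_top (eq_top_iff.2 ?_)
  rw [← hZ.sup_eq_top]
  exact sup_le (sInf_le ⟨hH, hNH⟩) hZH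

theorem hasCompl_quot (D : ReductiveData ρ r) [FiniteDimensional ℂ X] : HasCompl
    (quotAct ρ (nullSub_isStable ρ)) := by
  refine hasCompl_of_sInf_eq_bot fun y hy => ?_
  obtain ⟨u, rfl⟩ := (nullSub ρ).mkQ_surjective y
  have hu : u ∉ nullSub ρ := fun h => hy ((Submodule.Quotient.mk_eq_zero _).2 h)
  obtain ⟨H, hH, hNH, huH⟩ := D.exists_isMaxStable_notMem hu
  refine ⟨_, hH.map_mkQ (nullSub_isStable ρ) hNH, fun hmem => huH ?_⟩
  have : u ∈ (H.map (nullSub ρ).mkQ).comap (nullSub ρ).mkQ := hmem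
  rwa [Submodule.comap_map_mkQ, sup_eq_right.2 hNH] at this

end ReductiveData

end Invariant

/-- A Farkas alternative over the rationals. -/
theorem farkas_rat {V : Type} [AddCommGroup V] [Module ℚ V] (n : ℕ) : ∀ (x : Fin n → V) (y : V),
    (∃ c : Fin n → ℚ, (∀ i, 0 ≤ c i) ∧ y = ∑ i, c i • x i) ∨
    ∃ l : V →ₗ[ℚ] ℚ, (∀ i, 0 ≤ l (x i)) ∧ l y < 0 := by
  induction n with
  | zero =>
    intro x y
    by_cases hy : y = 0
    · exact Or.inl ⟨0, fun i => i.elim0, by simp [hy]⟩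
    · right
      obtain ⟨l, hl⟩ := Module.Projective.exists_dual_ne_zero ℚ hy
      refine ⟨(-(l y)) • l, fun i => i.elim0, ?_⟩
      have := mul_self_pos.2 hl
      simp only [LinearMap.smul_apply, smul_eq_mul]
      linarith
  | succ n ih =>
    intro x y
    rcases ih (fun i => x i.succ) y with ⟨c, hc, hy⟩ | ⟨l, hl, hly⟩
    · refine Or.inl ⟨Fin.cons 0 c, fun i => ?_, ?_⟩
      · refine Fin.cases ?_ (fun i => ?_) i <;> simp [hc]
      · simpa [Fin.sum_univ_succ] using hy
    by_cases hw : 0 ≤ l (x 0)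
    · exact Or.inr ⟨l, fun i => Fin.cases hw hl i, hly⟩
    push Not at hw
    let P : V →ₗ[ℚ] V := l.smulRight (x 0) - l (x 0) • LinearMap.id
    have hP : ∀ v, P v = l v • x 0 - l (x 0) • v := fun v => rfl
    rcases ih (fun i => P (x i.succ)) (P y) with ⟨c, hc, hy⟩ | ⟨m, hm, hmy⟩
    · left
      set u := ∑ i, c i • x (Fin.succ i) with hu
      have h1 : P (y - u) = 0 := by
        rw [map_sub, hy, hu, map_sum]
        simp
      have h2 : 0 ≤ l u := by
        rw [hu, map_sum]
        exact Finset.sum_nonneg fun i _ => by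
          rw [map_smul, smul_eq_mul]; exact mul_nonneg (hc i) (hl i)
      have h3 : y = (l (y - u) / l (x 0)) • x 0 + u := by
        rw [hP, sub_eq_zero] at h1
        rw [← sub_eq_iff_eq_add, div_eq_inv_mul, mul_smul, h1, smul_smul,
          inv_mul_cancel₀ hw.ne, one_smul]
      refine ⟨Fin.cons (l (y - u) / l (x 0)) c, fun i => ?_, ?_⟩
      · refine Fin.cases ?_ (fun i => ?_) i
        · rw [Fin.cons_zero, map_sub]
          exact div_nonneg_of_nonpos (by linarith) hw.le
        · simpa using hc i
      · simpa [Fin.sum_univ_succ] using h3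
    · right
      refine ⟨m ∘ₗ P, fun i => Fin.cases ?_ (fun i => hm i) i, hmy⟩
      simp [hP]

/-- A finite-dimensional complex space has a vector on which no member of a countable family of
nonzero functionals vanishes. -/
lemma exists_forall_apply_ne_zero {A : Type} [AddCommGroup A] [Module ℂ A] [FiniteDimensional ℂ A]
    (T : Set (A →ₗ[ℂ] ℂ)) (hT : T.Countable) (h0 : (0 : A →ₗ[ℂ] ℂ) ∉ T) :
    ∃ z, ∀ χ ∈ T, χ z ≠ 0 := by
  classical
  let b := Module.finBasis ℂ A
  let P : (A →ₗ[ℂ] ℂ) → Polynomial ℂ := fun χ =>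
    ∑ i : Fin _, Polynomial.monomial (i : ℕ) (χ (b i))
  have hP : ∀ χ t, (P χ).eval t = χ (∑ i : Fin _, t ^ (i : ℕ) • b i) := by
    intro χ t
    simp only [P, Polynomial.eval_finsetSum, Polynomial.eval_monomial, map_sum, map_smul,
      smul_eq_mul]
    exact Finset.sum_congr rfl fun i _ => mul_comm _ _
  have hP0 : ∀ χ, χ ≠ 0 → P χ ≠ 0 := by
    intro χ hχ h
    refine hχ (b.ext fun i => ?_)
    have := congrArg (fun p => Polynomial.coeff p (i : ℕ)) h
    simpa [P, Polynomial.finsetSum_coeff, Polynomial.coeff_monomial, Fin.val_inj] using this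
  have hc : (⋃ χ ∈ T, {t : ℂ | (P χ).eval t = 0}).Countable := by
    refine hT.biUnion fun χ hχ => Set.Finite.countable ?_
    have := Polynomial.finite_setOfPred_isRoot (hP0 χ fun h => h0 (h ▸ hχ))
    exact this
  have : ∃ t, t ∉ ⋃ χ ∈ T, {t : ℂ | (P χ).eval t = 0} := by
    by_contra! hcon
    exact not_countable_complex (by rwa [Set.eq_univ_of_forall hcon] at hc)
  obtain ⟨t, ht⟩ := this
  refine ⟨∑ i : Fin _, t ^ (i : ℕ) • b i, fun χ hχ h => ht ?_⟩
  simp only [Set.mem_iUnion]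
  exact ⟨χ, hχ, (hP χ t).trans h⟩

lemma exists_nat_smul_rat {n : ℕ} (c : Fin n → ℚ) (hc : ∀ i, 0 ≤ c i) :
    ∃ (d : ℕ) (m : Fin n → ℕ), d ≠ 0 ∧ ∀ i, (d : ℚ) * c i = m i := by
  refine ⟨∏ i, (c i).den, fun i => (∏ j ∈ Finset.univ.erase i, (c j).den) * (c i).num.toNat,
    Finset.prod_ne_zero_iff.2 fun i _ => (c i).den_ne_zero, fun i => ?_⟩
  have h1 : ((c i).num.toNat : ℚ) = (c i).num := by
    have := Int.toNat_of_nonneg (Rat.num_nonneg.2 (hc i))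
    exact_mod_cast this
  rw [← Finset.mul_prod_erase _ _ (Finset.mem_univ i)]
  push_cast
  rw [h1, ← Rat.den_mul_eq_num]
  ring

/-- Separation of a set of weights that avoids zero. -/
theorem exists_separating {A : Type} [AddCommGroup A] [Module ℂ A] [FiniteDimensional ℂ A]
    {S T : Set (A →ₗ[ℂ] ℂ)} (hS : S.Finite) (hTS : T ⊆ S) (W : AddSubmonoid (A →ₗ[ℂ] ℂ))
    (WN : Set (A →ₗ[ℂ] ℂ)) (hSW : S ⊆ W) (hTW : T ⊆ WN) (hadd : ∀ χ ∈ WN, ∀ ψ ∈ W, χ + ψ ∈ WN)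
    (h0 : (0 : A →ₗ[ℂ] ℂ) ∉ WN) :
    ∃ (z : A) (τ : ℂ →+ ℝ), (∀ χ ∈ S, τ (χ z) ≤ 0) ∧ ∀ χ ∈ T, τ (χ z) < 0 := by
  classical
  obtain ⟨n, s, hs⟩ : ∃ (n : ℕ) (s : Fin n → A →ₗ[ℂ] ℂ), Set.range s = S := by
    obtain ⟨n, s, hs⟩ := hS.fin_embedding
    exact ⟨n, s, hs⟩
  obtain ⟨z, hz⟩ := exists_forall_apply_ne_zero
    (Set.range (fun m : Fin n → ℕ => ∑ i, m i • s i) \ {0})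
    ((Set.countable_range _).mono Set.sdiff_subset) (by simp)
  have hz' : ∀ m : Fin n → ℕ, (∑ i, m i • s i : A →ₗ[ℂ] ℂ) z = 0 → ∑ i, m i • s i = 0 := by
    intro m hm
    by_contra h
    exact hz _ ⟨⟨m, rfl⟩, h⟩ hm
  have key : ∀ χ ∈ T, ∃ l : ℂ →ₗ[ℚ] ℚ, (∀ i, 0 ≤ l (s i z)) ∧ 0 < l (χ z) := by
    intro χ hχ
    rcases farkas_rat n (fun i => s i z) (-(χ z)) with ⟨c, hc, hy⟩ | ⟨l, hl, hly⟩
    · exfalso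
      obtain ⟨d, m, hd, hdm⟩ := exists_nat_smul_rat c hc
      obtain ⟨k, hk⟩ : ∃ k, s k = χ := by
        have := hTS hχ
        rw [← hs] at this
        exact this
      have h1 : (∑ i, (m + Pi.single k d : Fin n → ℕ) i • s i : A →ₗ[ℂ] ℂ) z = 0 := by
        simp only [Pi.add_apply, add_smul, Finset.sum_add_distrib, LinearMap.add_apply,
          LinearMap.sum_apply, LinearMap.smul_apply]
        have h2 : ∑ i, m i • s i z = (d : ℚ) • (-(χ z)) := by
          rw [hy, Finset.smul_sum]
          refine Finset.sum_congr rfl fun i _ => ?_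
          rw [smul_smul, hdm, Nat.cast_smul_eq_nsmul]
        have h3 : ∑ i, (Pi.single k d : Fin n → ℕ) i • s i z = (d : ℚ) • χ z := by
          rw [Finset.sum_eq_single k, Pi.single_eq_same, hk, Nat.cast_smul_eq_nsmul]
          · intro i _ hik; rw [Pi.single_eq_of_ne hik, zero_smul]
          · simp
        rw [h2, h3, smul_neg, neg_add_cancel]
      have h4 := hz' _ h1
      refine h0 ?_
      rw [← h4]
      have h5 : ∑ i, (m + Pi.single k d : Fin n → ℕ) i • s i =
          χ + (∑ i, m i • s i + (d - 1) • χ) := by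
        simp only [Pi.add_apply, add_smul, Finset.sum_add_distrib]
        have h3 : ∑ i, (Pi.single k d : Fin n → ℕ) i • s i = d • χ := by
          rw [Finset.sum_eq_single k, Pi.single_eq_same, hk]
          · intro i _ hik; rw [Pi.single_eq_of_ne hik, zero_smul]
          · simp
        rw [h3]
        conv_lhs => rw [← Nat.succ_pred_eq_of_ne_zero hd, succ_nsmul]
        rw [Nat.pred_eq_sub_one]
        abel
      rw [h5]
      refine hadd χ (hTW hχ) _ (W.add_mem (W.sum_mem fun i _ => W.nsmul_mem (hSW ?_) _)
        (W.nsmul_mem (hSW (hTS hχ)) _))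
      rw [← hs]; exact ⟨i, rfl⟩
    · exact ⟨l, hl, by rw [map_neg] at hly; linarith⟩
  choose! l hl hlχ using key
  have hTf : T.Finite := hS.subset hTS
  have hnn : ∀ χ ∈ T, ∀ ψ ∈ S, 0 ≤ l χ (ψ z) := by
    intro χ hχ ψ hψ
    rw [← hs] at hψ
    obtain ⟨i, rfl⟩ := hψ
    exact hl χ hχ i
  let L : ℂ →+ ℚ := ∑ χ ∈ hTf.toFinset, (l χ).toAddMonoidHom
  have hL : ∀ w, L w = ∑ χ ∈ hTf.toFinset, l χ w := fun w => by
    simp [L, AddMonoidHom.finsetSum_apply]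
  refine ⟨z, -((algebraMap ℚ ℝ : ℚ →+* ℝ).toAddMonoidHom.comp L), fun χ hχ => ?_, fun χ hχ => ?_⟩
  · have : 0 ≤ L (χ z) := by
      rw [hL]
      exact Finset.sum_nonneg fun ψ hψ => hnn ψ (hTf.mem_toFinset.1 hψ) χ hχ
    simpa using this
  · have : 0 < L (χ z) := by
      rw [hL]
      exact Finset.sum_pos' (fun ψ hψ => hnn ψ (hTf.mem_toFinset.1 hψ) χ (hTS hχ))
        ⟨χ, hTf.mem_toFinset.2 hχ, hlχ χ hχ⟩
    simpa using this

section FiniteChars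

variable {A X : Type} [AddCommGroup A] [Module ℂ A] [AddCommGroup X] [Module ℂ X]

lemma minpoly_root_of_mem_maxGenEigenspace [FiniteDimensional ℂ X] {K : Submodule ℂ X}
    {f : X →ₗ[ℂ] X} {q : (X ⧸ K) →ₗ[ℂ] (X ⧸ K)} (hq : ∀ v, q (K.mkQ v) = K.mkQ (f v)) {c : ℂ}
    {y : X ⧸ K} (hy : y ≠ 0) (hc : y ∈ Module.End.maxGenEigenspace q c) :
    (minpoly ℂ f).IsRoot c := by
  obtain ⟨k, hk⟩ := Module.End.mem_maxGenEigenspace q c y |>.1 hc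
  have h1 : Module.End.HasEigenvalue q c := by
    refine Module.End.hasEigenvalue_of_hasGenEigenvalue (k := k) fun h => hy ?_
    rw [← Submodule.mem_bot ℂ, ← h]
    exact Module.End.mem_genEigenspace_nat.2 hk
  obtain ⟨w, hw⟩ := h1.exists_hasEigenvector
  have h2 : ∀ (p : Polynomial ℂ) v, Polynomial.aeval q p (K.mkQ v) = K.mkQ (Polynomial.aeval f p v) := by
    intro p
    induction p using Polynomial.induction_on' with
    | add p r hp hr => intro v; simp only [map_add, LinearMap.add_apply, hp, hr]
    | monomial n a =>
      have h3 : ∀ v, (q ^ n) (K.mkQ v) = K.mkQ ((f ^ n) v) := by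
        induction n with
        | zero => intro v; simp
        | succ n ih => intro v; rw [pow_succ, pow_succ, Module.End.mul_apply, Module.End.mul_apply,
            hq, ih]
      intro v
      simp only [Polynomial.aeval_monomial, Module.End.mul_apply, Module.algebraMap_end_apply, h3,
        map_smul]
  have h4 := Module.End.aeval_apply_of_hasEigenvector (p := minpoly ℂ f) hw
  obtain ⟨v, rfl⟩ := K.mkQ_surjective w
  rw [h2, minpoly.aeval, LinearMap.zero_apply, map_zero, eq_comm, smul_eq_zero] at h4
  exact h4.resolve_right hw.2

lemma finite_detChar [FiniteDimensional ℂ A] [FiniteDimensional ℂ X] (ρ : A →ₗ[ℂ] X →ₗ[ℂ] X) :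
    {χ | ∃ (K : Submodule ℂ X) (hK : IsStable ρ K), χ = detChar ρ hK}.Finite := by
  classical
  let b := Module.finBasis ℂ A
  let R : A → Set ℂ := fun x => {c | (minpoly ℂ (ρ x)).IsRoot c}
  have hR : ∀ x, (R x).Finite := fun x => Polynomial.finite_setOfPred_isRoot
    (minpoly.ne_zero (Algebra.IsIntegral.isIntegral _))
  let V : A → Set ℂ := fun x => ⋃ n : Fin (Module.finrank ℂ X + 1),
    (fun μ : Fin n → ℂ => ∑ i, μ i) '' Set.pi Set.univ fun _ => R x
  have hV : ∀ x, (V x).Finite := fun x => Set.finite_iUnion fun n =>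
    (Set.Finite.pi fun _ => hR x).image _
  have hmem : ∀ (K : Submodule ℂ X) (hK : IsStable ρ K) x, detChar ρ hK x ∈ V x := by
    intro K hK x
    obtain ⟨ι, _, _, e, μ, he⟩ := exists_basis_maxGenEigenspace (quotAct ρ hK x)
    rw [← trace_quotAct, trace_eq_sum_of_mem_maxGenEigenspace e _ μ he]
    have hcard : Fintype.card ι ≤ Module.finrank ℂ X := by
      rw [← Module.finrank_eq_card_basis e]; exact Submodule.finrank_quotient_le K
    refine Set.mem_iUnion.2 ⟨⟨Fintype.card ι, by omega⟩, μ ∘ (Fintype.equivFin ι).symm,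
      fun i _ => ?_, (Fintype.equivFin ι).symm.sum_comp μ⟩
    exact minpoly_root_of_mem_maxGenEigenspace (fun v => quotAct_mkQ ρ hK x v) (e.ne_zero _) (he _)
  refine Set.Finite.of_finite_image (f := fun χ : A →ₗ[ℂ] ℂ => fun i => χ (b i)) ?_ ?_
  · refine (Set.Finite.pi fun i => hV (b i)).subset ?_
    rintro _ ⟨_, ⟨K, hK, rfl⟩, rfl⟩ i -
    exact hmem K hK _
  · intro χ _ ψ _ h
    exact b.ext fun i => congrFun h i

end FiniteChars

section Weights

variable {A X : Type} [AddCommGroup A] [Module ℂ A] [AddCommGroup X] [Module ℂ X]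

/-- Semi-invariance of a form, with a given character. -/
def IsSemiInv {S : Type} [Fintype S] [DecidableEq S] (ρ : A →ₗ[ℂ] X →ₗ[ℂ] X) (χ : A →ₗ[ℂ] ℂ)
    (f : MultilinearMap ℂ (fun _ : S => X) ℂ) : Prop := ∀ x v, der (ρ x) f v = χ x * f v

/-- The external product of two forms. -/
def mulForm {S T : Type} (f : MultilinearMap ℂ (fun _ : S => X) ℂ)
    (g : MultilinearMap ℂ (fun _ : T => X) ℂ) : MultilinearMap ℂ (fun _ : S ⊕ T => X) ℂ :=
  (LinearMap.mul' ℂ ℂ).compMultilinearMap (f.domCoprod g)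

lemma mulForm_apply {S T : Type} (f : MultilinearMap ℂ (fun _ : S => X) ℂ)
    (g : MultilinearMap ℂ (fun _ : T => X) ℂ) (v : S ⊕ T → X) :
    mulForm f g v = f (v ∘ Sum.inl) * g (v ∘ Sum.inr) := by
  simp [mulForm, MultilinearMap.domCoprod, MultilinearMap.domCoprodDep, Function.comp_def]

variable {S T : Type} [Fintype S] [DecidableEq S] [Fintype T] [DecidableEq T]

lemma der_mulForm (z : X →ₗ[ℂ] X) (f : MultilinearMap ℂ (fun _ : S => X) ℂ)
    (g : MultilinearMap ℂ (fun _ : T => X) ℂ) (v : S ⊕ T → X) :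
    der z (mulForm f g) v = der z f (v ∘ Sum.inl) * g (v ∘ Sum.inr) +
      f (v ∘ Sum.inl) * der z g (v ∘ Sum.inr) := by
  simp only [der, Fintype.sum_sum_type, mulForm_apply, Sum.update_inl_comp_inl,
    Sum.update_inl_comp_inr, Sum.update_inr_comp_inl, Sum.update_inr_comp_inr, Finset.sum_mul,
    Finset.mul_sum, Function.comp_apply]

lemma IsSemiInv.mulForm {ρ : A →ₗ[ℂ] X →ₗ[ℂ] X} {χ ψ : A →ₗ[ℂ] ℂ}
    {f : MultilinearMap ℂ (fun _ : S => X) ℂ} {g : MultilinearMap ℂ (fun _ : T => X) ℂ}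
    (hf : IsSemiInv ρ χ f) (hg : IsSemiInv ρ ψ g) : IsSemiInv ρ (χ + ψ) (mulForm f g) := by
  intro x v
  rw [der_mulForm, hf, hg, mulForm_apply, LinearMap.add_apply]
  ring

lemma der_domDomCongr {F : Type} [AddCommGroup F] [Module ℂ F] (σ : S ≃ T) (z : X →ₗ[ℂ] X)
    (f : MultilinearMap ℂ (fun _ : S => X) F) (v : T → X) :
    der z (f.domDomCongr σ) v = der z f (v ∘ σ) := by
  simp only [der, MultilinearMap.domDomCongr_apply]
  rw [← σ.sum_comp]
  refine Finset.sum_congr rfl fun s _ => ?_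
  congr 1
  funext i
  simp [Function.update_apply]

/-- The characters of nonzero semi-invariant forms. -/
def weights (ρ : A →ₗ[ℂ] X →ₗ[ℂ] X) : AddSubmonoid (A →ₗ[ℂ] ℂ) where
  carrier := {χ | ∃ (S : Type) (_ : Fintype S) (_ : DecidableEq S)
    (f : MultilinearMap ℂ (fun _ : S => X) ℂ) (v : S → X), f v ≠ 0 ∧ IsSemiInv ρ χ f}
  zero_mem' := ⟨Empty, inferInstance, inferInstance, MultilinearMap.constOfIsEmpty ℂ _ 1, 0,
    by simp, fun x v => by simp [der]⟩
  add_mem' := by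
    rintro χ ψ ⟨S, _, _, f, v, hfv, hf⟩ ⟨T, _, _, g, w, hgw, hg⟩
    exact ⟨S ⊕ T, inferInstance, inferInstance, mulForm f g, Sum.elim v w,
      by rw [mulForm_apply]; exact mul_ne_zero hfv hgw, hf.mulForm hg⟩

/-- The characters of semi-invariant forms that do not vanish on a given subspace in some
argument. -/
def weightsOf (ρ : A →ₗ[ℂ] X →ₗ[ℂ] X) (N : Submodule ℂ X) : Set (A →ₗ[ℂ] ℂ) :=
  {χ | ∃ (S : Type) (_ : Fintype S) (_ : DecidableEq S)
    (f : MultilinearMap ℂ (fun _ : S => X) ℂ) (v : S → X) (i : S), v i ∈ N ∧ f v ≠ 0 ∧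
      IsSemiInv ρ χ f}

lemma add_mem_weightsOf {ρ : A →ₗ[ℂ] X →ₗ[ℂ] X} {N : Submodule ℂ X} {χ ψ : A →ₗ[ℂ] ℂ}
    (hχ : χ ∈ weightsOf ρ N) (hψ : ψ ∈ weights ρ) : χ + ψ ∈ weightsOf ρ N := by
  obtain ⟨S, _, _, f, v, i, hi, hfv, hf⟩ := hχ
  obtain ⟨T, _, _, g, w, hgw, hg⟩ := hψ
  exact ⟨S ⊕ T, inferInstance, inferInstance, mulForm f g, Sum.elim v w, Sum.inl i, hi,
    by rw [mulForm_apply]; exact mul_ne_zero hfv hgw, hf.mulForm hg⟩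

lemma IsInv.apply_eq_zero {ρ : A →ₗ[ℂ] X →ₗ[ℂ] X} {f : MultilinearMap ℂ (fun _ : S => X) ℂ}
    (hf : IsInv ρ f) {v : S → X} {i : S} (hi : v i ∈ nullSub ρ) : f v = 0 := by
  let σ := Fintype.equivFin S
  have h := mem_nullSub.1 hi _ (f.domDomCongr σ) (fun x v => by rw [der_domDomCongr]; exact hf x _)
    (σ i) (v ∘ σ.symm)
  rw [MultilinearMap.domDomCongr_apply] at h
  rw [← h]
  congr 1
  funext s
  by_cases hs : s = i
  · subst hs; simp
  · rw [Function.update_of_ne (by simpa using hs)]; simp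

lemma zero_notMem_weightsOf (ρ : A →ₗ[ℂ] X →ₗ[ℂ] X) : 0 ∉ weightsOf ρ (nullSub ρ) := by
  rintro ⟨S, _, _, f, v, i, hi, hfv, hf⟩
  exact hfv (IsInv.apply_eq_zero (fun x v => by rw [hf x v]; simp) hi)

lemma der_compLinearMap {Y F : Type} [AddCommGroup Y] [Module ℂ Y] [AddCommGroup F] [Module ℂ F]
    {π : X →ₗ[ℂ] Y} {T : X →ₗ[ℂ] X} {T' : Y →ₗ[ℂ] Y} (h : ∀ v, π (T v) = T' (π v))
    (f : MultilinearMap ℂ (fun _ : S => Y) F) (v : S → X) :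
    der T (f.compLinearMap fun _ => π) v = der T' f (π ∘ v) := by
  simp only [der, MultilinearMap.compLinearMap_apply]
  refine Finset.sum_congr rfl fun s _ => ?_
  congr 1
  funext i
  by_cases hi : i = s
  · subst hi; simp [h]
  · simp [hi]

lemma det_update_self {E ι : Type} [AddCommGroup E] [Module ℂ E] [Fintype ι] [DecidableEq ι]
    (b : Module.Basis ι ℂ E) (i : ι) (u : E) : b.det (Function.update b i u) = b.repr u i := by
  conv_lhs => rw [← b.sum_repr u]
  rw [AlternatingMap.map_update_sum, Finset.sum_eq_single i]
  · rw [AlternatingMap.map_update_smul, Function.update_eq_self, b.det_self, smul_eq_mul, mul_one]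
  · intro j _ hj
    rw [AlternatingMap.map_update_smul, AlternatingMap.map_update_self b.det b hj.symm, smul_zero]
  · simp

variable [FiniteDimensional ℂ X]

lemma detChar_mem_weightsOf {ρ : A →ₗ[ℂ] X →ₗ[ℂ] X} {K : Submodule ℂ X} (hK : IsStable ρ K)
    {N : Submodule ℂ X} (hN : ¬ N ≤ K) : detChar ρ hK ∈ weightsOf ρ N := by
  obtain ⟨u, huN, huK⟩ := SetLike.not_le_iff_exists.1 hN
  let b := Module.finBasis ℂ (X ⧸ K)
  have hu : K.mkQ u ≠ 0 := by rwa [ne_eq, Submodule.mkQ_apply, Submodule.Quotient.mk_eq_zero]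
  obtain ⟨i, hi⟩ : ∃ i, b.repr (K.mkQ u) i ≠ 0 := by
    by_contra! hcon
    exact hu (b.repr.map_eq_zero_iff.1 (Finsupp.ext hcon))
  choose w hw using fun j => K.mkQ_surjective (b j)
  refine ⟨_, inferInstance, inferInstance, b.det.toMultilinearMap.compLinearMap fun _ => K.mkQ,
    Function.update w i u, i, by simpa using huN, ?_, fun x v => ?_⟩
  · rw [MultilinearMap.compLinearMap_apply]
    have : (fun j => K.mkQ (Function.update w i u j)) = Function.update b i (K.mkQ u) := by
      funext j
      by_cases hj : j = i
      · subst hj; simp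
      · rw [Function.update_of_ne hj, Function.update_of_ne hj, hw]
    rw [this]
    exact (det_update_self b i _).trans_ne hi
  · rw [der_compLinearMap (T' := quotAct ρ hK x) (fun v => (quotAct_mkQ ρ hK x v).symm), der_det,
      trace_quotAct]
    rfl

lemma detChar_mem_weights {ρ : A →ₗ[ℂ] X →ₗ[ℂ] X} {K : Submodule ℂ X} (hK : IsStable ρ K) :
    detChar ρ hK ∈ weights ρ := by
  by_cases h : (⊤ : Submodule ℂ X) ≤ K
  · have hs : Subsingleton (X ⧸ K) := Submodule.Quotient.subsingleton_iff.2 (top_le_iff.1 h)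
    have : detChar ρ hK = 0 := by
      ext x
      rw [← trace_quotAct, LinearMap.zero_apply, Subsingleton.elim (quotAct ρ hK x) 0, map_zero]
    rw [this]
    exact zero_mem _
  · obtain ⟨S, _, _, f, v, i, -, hfv, hf⟩ := detChar_mem_weightsOf hK h
    exact ⟨S, _, _, f, v, hfv, hf⟩

/-- A rational functional on the spectrum of some operator that is nonpositive on determinant
characters of quotients, strictly so for quotients on which the null subspace survives. -/
theorem exists_detChar_le [FiniteDimensional ℂ A] (ρ : A →ₗ[ℂ] X →ₗ[ℂ] X) :
    ∃ (z : A) (τ : ℂ →+ ℝ), ∀ (K : Submodule ℂ X) (hK : IsStable ρ K),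
      τ (detChar ρ hK z) ≤ 0 ∧ (¬ nullSub ρ ≤ K → τ (detChar ρ hK z) < 0) := by
  obtain ⟨z, τ, h1, h2⟩ := exists_separating (finite_detChar ρ)
    (T := {χ | ∃ (K : Submodule ℂ X) (hK : IsStable ρ K), ¬ nullSub ρ ≤ K ∧ χ = detChar ρ hK})
    (by rintro _ ⟨K, hK, -, rfl⟩; exact ⟨K, hK, rfl⟩) (weights ρ) (weightsOf ρ (nullSub ρ))
    (by rintro _ ⟨K, hK, rfl⟩; exact detChar_mem_weights hK)
    (by rintro _ ⟨K, hK, h, rfl⟩; exact detChar_mem_weightsOf hK h)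
    (fun χ hχ ψ hψ => add_mem_weightsOf hχ hψ) (zero_notMem_weightsOf ρ)
  exact ⟨z, τ, fun K hK => ⟨h1 _ ⟨K, hK, rfl⟩, fun h => h2 _ ⟨K, hK, h, rfl⟩⟩⟩

end Weights

section SumLe

variable {A E X α : Type} [AddCommGroup A] [Module ℂ A] [AddCommGroup E] [Module ℂ E]
  [AddCommGroup X] [Module ℂ X] [Fintype α] {S : Type} [Fintype S] [DecidableEq S]

/-- A nonzero invariant form bounds the margins of the frame vectors fed to its arguments. -/
theorem Frame.sum_le_zero {ρ : A →ₗ[ℂ] E →ₗ[ℂ] E} {a : α → A} {z : A} (Φ : Frame ρ a z)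
    (τ : ℂ →+ ℝ) {ρ' : A →ₗ[ℂ] X →ₗ[ℂ] X} {g : MultilinearMap ℂ (fun _ : S => X) ℂ}
    (hg : IsInv ρ' g) (l : S → E →ₗ[ℂ] X)
    (hl : ∀ x (v : S → E) s, g (Function.update (fun t => l t (v t)) s (l s (ρ x (v s)))) =
      g (Function.update (fun t => l t (v t)) s (ρ' x (l s (v s)))))
    {v : S → E} (hv : g (fun t => l t (v t)) ≠ 0) (B : S → ℝ)
    (hB : ∀ s i, l s (Φ.e i) ≠ 0 → B s ≤ Φ.κ τ i) : ∑ s, B s ≤ 0 := by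
  let f := g.compLinearMap l
  have hf : ∀ x v, der (ρ x) f v = 0 := by
    intro x v
    rw [← hg x fun t => l t (v t), der, der]
    refine Finset.sum_congr rfl fun s _ => ?_
    rw [← hl, MultilinearMap.compLinearMap_apply]
    congr 1
    funext t
    by_cases ht : t = s
    · subst ht; simp
    · simp [ht]
  obtain ⟨j₀, hj₀⟩ : ∃ j₀ : S → Φ.ι, f (Φ.e ∘ j₀) ≠ 0 := by
    by_contra! hcon
    have h0 := eq_zero_of_span Φ.span_e hcon
    exact hv (by rw [← MultilinearMap.compLinearMap_apply]; change f v = 0; rw [h0, zero_apply])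
  obtain ⟨j, hj, hsum⟩ := Φ.exists_sum_nonpos τ f hf j₀ hj₀
  refine (Finset.sum_le_sum fun s _ => hB s (j s) fun h => hj ?_).trans hsum
  exact g.map_coord_zero s h

end SumLe

section Stability

variable {A X : Type} [AddCommGroup A] [Module ℂ A] [FiniteDimensional ℂ A]
  [AddCommGroup X] [Module ℂ X] [FiniteDimensional ℂ X]
  {G : Type} [Group G] {ρ : A →ₗ[ℂ] X →ₗ[ℂ] X} {r : Representation ℂ G X}

lemma detChar_top : detChar ρ (IsStable.top ρ) = 0 := by
  have hs : Subsingleton (X ⧸ (⊤ : Submodule ℂ X)) := Submodule.Quotient.subsingleton_iff.2 rfl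
  ext x
  rw [← trace_quotAct, LinearMap.zero_apply,
    Subsingleton.elim (quotAct ρ (IsStable.top ρ) x) 0, map_zero]

lemma detChar_eq_zero_of_eq_top {K : Submodule ℂ X} (hK : IsStable ρ K) (h : K = ⊤) :
    detChar ρ hK = 0 := by
  subst h; exact detChar_top

lemma detChar_inf {K H : Submodule ℂ X} (hK : IsStable ρ K) (hH : IsStable ρ H)
    (hKH : K ⊔ H = ⊤) : detChar ρ (hK.inf hH) = detChar ρ hK + detChar ρ hH := by
  have h1 : IsStable (subAct ρ hH) (K.comap H.subtype) :=
    IsStable.comap (ρ' := ρ) (fun x v => rfl) hK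
  have h2 := detChar_of_le hH h1 (hK.inf hH) (by rw [Submodule.map_comap_subtype, inf_comm])
  have h3 : detChar (subAct ρ hH) h1 = detChar (quotAct ρ hK) (IsStable.bot _) := by
    refine detChar_comap (π := K.mkQ ∘ₗ H.subtype) (fun x v => rfl) ?_ _ _ ?_
    · intro y
      obtain ⟨u, rfl⟩ := K.mkQ_surjective y
      obtain ⟨k, hk, h, hh, rfl⟩ := Submodule.mem_sup.1 (hKH ▸ Submodule.mem_top : u ∈ K ⊔ H)
      refine ⟨⟨h, hh⟩, ?_⟩
      simpa using hk
    · rw [← LinearMap.ker, LinearMap.ker_comp, Submodule.ker_mkQ]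
  have h4 : detChar ρ hK = detChar (quotAct ρ hK) (IsStable.bot _) :=
    detChar_comap (π := K.mkQ) (fun x v => rfl) K.mkQ_surjective _ _
      (by rw [← LinearMap.ker, Submodule.ker_mkQ])
  rw [h4, ← h3, h2, sub_add_cancel]

lemma exists_section (N : Submodule ℂ X) :
    ∃ σ : (X ⧸ N) →ₗ[ℂ] X, ∀ y, N.mkQ (σ y) = y := by
  obtain ⟨σ, hσ⟩ := LinearMap.exists_rightInverse_of_surjective N.mkQ N.range_mkQ
  exact ⟨σ, fun y => LinearMap.congr_fun hσ y⟩

lemma section_sub_mem {N : Submodule ℂ X} (hN : IsStable ρ N) {σ : (X ⧸ N) →ₗ[ℂ] X}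
    (hσ : ∀ y, N.mkQ (σ y) = y) (x : A) (y : X ⧸ N) :
    σ (quotAct ρ hN x y) - ρ x (σ y) ∈ N := by
  rw [← Submodule.Quotient.mk_eq_zero, ← Submodule.mkQ_apply, map_sub, hσ, ← quotAct_mkQ ρ hN, hσ,
    sub_self]

/-- The null subspace is contained in no proper quotient on which the functional is negative:
maximal case. -/
lemma ReductiveData.detChar_eq_zero_of_isMaxStable (D : ReductiveData ρ r) {z : A} {τ : ℂ →+ ℝ}
    (hz : ∀ (K : Submodule ℂ X) (hK : IsStable ρ K), τ (detChar ρ hK z) ≤ 0)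
    {H : Submodule ℂ X} (hH : IsMaxStable ρ H) (hNH : nullSub ρ ≤ H) :
    τ (detChar ρ hH.stable z) = 0 := by
  classical
  by_contra hne
  have hneg : τ (detChar ρ hH.stable z) < 0 := lt_of_le_of_ne (hz _ _) hne
  set N := nullSub ρ
  set hN := nullSub_isStable ρ
  set ρY := quotAct ρ hN
  have hHY := IsMaxStable.map_mkQ hN hNH hH
  obtain ⟨C, hC, hcompl⟩ := D.hasCompl_quot _ hHY.stable
  let a := Module.finBasis ℂ A
  have ha : Submodule.span ℂ (Set.range a) = ⊤ := a.span_eq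
  have hcm : (H.map N.mkQ).comap N.mkQ = H := by
    rw [Submodule.comap_map_mkQ, sup_eq_right.2 hNH]
  have hCbot : detChar (subAct ρY hC) (IsStable.bot _) = detChar ρ hH.stable := by
    have h1 : detChar ρ hH.stable = detChar ρY hHY.stable :=
      detChar_comap (π := N.mkQ) (fun x v => rfl) N.mkQ_surjective _ _ hcm.symm
    have h2 : detChar (subAct ρY hC) (IsStable.bot _) = detChar ρY (IsStable.bot ρY) - detChar ρY hC :=
      detChar_of_le hC _ _ (by rw [Submodule.map_bot])
    have h3 := detChar_inf hHY.stable hC hcompl.sup_eq_top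
    have h4 : detChar ρY (hHY.stable.inf hC) = detChar ρY (IsStable.bot ρY) := by
      congr 1; exact hcompl.inf_eq_bot
    rw [h1, h2, ← h4, h3, add_sub_cancel_right]
  have hCne : C ≠ ⊥ := by
    rintro rfl
    have := hcompl.sup_eq_top
    rw [sup_bot_eq] at this
    exact hHY.ne_top this
  have hsimple : ∀ K : Submodule ℂ C, IsStable (subAct ρY hC) K → K ≠ ⊤ → K = ⊥ := by
    intro K hK hKt
    have hK' : IsStable ρY (K.map C.subtype) := IsStable.map (fun x v => rfl) hK
    rcases hHY.eq_or _ (hHY.stable.sup hK') le_sup_left with h | h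
    · have h1 : K.map C.subtype ≤ H.map N.mkQ := by rw [← h]; exact le_sup_right
      have h2 : K.map C.subtype ≤ ⊥ := by
        rw [← hcompl.inf_eq_bot]
        exact le_inf h1 (C.map_subtype_le K)
      rw [eq_bot_iff]
      intro k hk
      have h3 := h2 (Submodule.mem_map_of_mem hk)
      rw [Submodule.mem_bot] at h3 ⊢
      exact Subtype.ext h3
    · exfalso
      apply hKt
      have h1 : C ≤ K.map C.subtype := by
        have := (IsCompl.codisjoint hcompl)
        intro c hc
        obtain ⟨p, hp, k, hk, hpk⟩ := Submodule.mem_sup.1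
          (h ▸ Submodule.mem_top : c ∈ H.map N.mkQ ⊔ K.map C.subtype)
        have hp0 : p ∈ H.map N.mkQ ⊓ C := by
          refine ⟨hp, ?_⟩
          rw [eq_sub_of_add_eq hpk]
          exact C.sub_mem hc (C.map_subtype_le K hk)
        rw [hcompl.inf_eq_bot, Submodule.mem_bot] at hp0
        rw [← hpk, hp0, zero_add]
        exact hk
      rw [eq_top_iff]
      rintro ⟨c, hc⟩ -
      obtain ⟨k, hk, hkc⟩ := h1 hc
      have : k = ⟨c, hc⟩ := Subtype.ext hkc
      rwa [← this]
  obtain ⟨c, hcC, hc0⟩ := C.exists_mem_ne_zero_of_ne_bot hCne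
  obtain ⟨u, rfl⟩ := N.mkQ_surjective c
  have huN : u ∉ N := fun h => hc0 ((Submodule.Quotient.mk_eq_zero _).2 h)
  have hform : ∃ (n : ℕ) (f : MultilinearMap ℂ (fun _ : Fin n => X) ℂ), IsInv ρ f ∧ ∃ i v,
      f (Function.update v i u) ≠ 0 := by
    by_contra! hcon
    exact huN (mem_nullSub.2 hcon)
  obtain ⟨n, f, hf, i, v, hfv⟩ := hform
  have hfr : (0 : ℝ) < Module.finrank ℂ C := by
    have : Nontrivial C := Submodule.nontrivial_iff_ne_bot.2 hCne
    exact_mod_cast Module.finrank_pos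
  set t := τ (detChar ρ hH.stable z)
  set δ := t / (2 * Module.finrank ℂ C) with hδ
  have hδneg : δ < 0 := div_neg_of_neg_of_pos hneg (by positivity)
  obtain ⟨ΦC, hΦC⟩ := exists_frame_of_detChar_lt (subAct ρY hC) ha z τ δ (by
    intro K hK hKt
    obtain rfl := hsimple K hK hKt
    rw [hCbot, finrank_bot, hδ]
    change t < _
    have : t / (2 * Module.finrank ℂ C) * ((Module.finrank ℂ C : ℝ) - (0 : ℕ)) = t / 2 := by
      field_simp; simp
    rw [this]
    linarith)
  set δ' : ℝ := -δ / (2 * n) with hδ'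
  have hn : (0 : ℝ) < n := by
    have := i.pos
    exact_mod_cast this
  have hδ'pos : 0 < δ' := div_pos (by linarith) (by positivity)
  obtain ⟨ΦY, hΦY⟩ := exists_frame_of_detChar_lt ρY ha z τ δ' (by
    intro K hK hKt
    have h1 : detChar ρ (IsStable.comap (π := N.mkQ) (fun x v => rfl) hK) = detChar ρY hK :=
      detChar_comap (fun x v => rfl) N.mkQ_surjective _ _ rfl
    rw [← h1]
    refine (hz _ _).trans_lt (mul_pos hδ'pos (sub_pos.2 ?_))
    exact_mod_cast Submodule.finrank_lt hKt)
  obtain ⟨σ, hσ⟩ := exists_section N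
  let l : Fin n → (C × (X ⧸ N)) →ₗ[ℂ] X := fun s => σ ∘ₗ
    if s = i then C.subtype ∘ₗ LinearMap.fst ℂ _ _ else LinearMap.snd ℂ _ _
  have hkill : ∀ w s, w s ∈ N → f w = 0 := fun w s hw => hf.apply_eq_zero hw
  have hsub : ∀ w s y y', y - y' ∈ N → f (Function.update w s y) = f (Function.update w s y') := by
    intro w s y y' hy
    rw [← sub_eq_zero, ← MultilinearMap.map_update_sub]
    exact hkill _ s (by simpa using hy)
  have hmain := (ΦC.prod ΦY).sum_le_zero τ hf l ?_ (v := fun s => (⟨_, hcC⟩, N.mkQ (v s))) ?_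
    (fun s => if s = i then -δ else -δ') ?_
  · rw [Finset.sum_ite, Finset.filter_eq' Finset.univ i, if_pos (Finset.mem_univ i),
      Finset.sum_singleton, Finset.sum_const, nsmul_eq_mul] at hmain
    have h1 : ((Finset.univ.filter fun s => ¬ s = i).card : ℝ) ≤ n := by
      have := Finset.card_filter_le (Finset.univ : Finset (Fin n)) fun s => ¬ s = i
      rw [Finset.card_univ, Fintype.card_fin] at this
      exact_mod_cast this
    have h2 := mul_le_mul_of_nonneg_right h1 hδ'pos.le
    have h3 : (n : ℝ) * δ' = -δ / 2 := by rw [hδ']; field_simp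
    linarith
  · intro x w s
    refine hsub _ _ _ _ ?_
    by_cases hs : s = i
    · simp only [l, hs, if_true]
      exact section_sub_mem hN hσ x _
    · simp only [l, hs, if_false]
      exact section_sub_mem hN hσ x _
  · have : f (Function.update v i u) = f fun s => l s (⟨_, hcC⟩, N.mkQ (v s)) := by
      have hcongr : ∀ w w' : Fin n → X, (∀ s, N.mkQ (w s) = N.mkQ (w' s)) → f w = f w' := by
        intro w w' h
        obtain ⟨m, rfl⟩ : ∃ m, w = w' + m := ⟨w - w', by abel⟩
        rw [MultilinearMap.map_add_univ, Finset.sum_eq_single Finset.univ]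
        · congr 1; funext s; simp
        · intro T _ hT
          obtain ⟨s, hs⟩ : ∃ s, s ∉ T := by
            by_contra! h; exact hT (Finset.eq_univ_of_forall h)
          refine hkill _ s ?_
          rw [Finset.piecewise_eq_of_notMem _ _ _ hs, ← Submodule.Quotient.mk_eq_zero,
            ← Submodule.mkQ_apply]
          have := h s
          rw [Pi.add_apply, map_add] at this
          exact left_eq_add.1 this.symm |>.symm ▸ rfl
        · simp
      refine hcongr _ _ fun s => ?_
      by_cases hs : s = i
      · subst hs; simp [l, hσ]
      · simp [l, hσ, hs]
    rwa [← this]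
  · intro s k hk
    rcases k with k | k
    · rw [Frame.prod_κ_inl]
      by_cases hs : s = i
      · rw [if_pos hs]; exact (hΦC k).le
      · exact absurd (by simp [l, hs, Frame.prod]) hk
    · rw [Frame.prod_κ_inr]
      by_cases hs : s = i
      · exact absurd (by simp [l, hs, Frame.prod]) hk
      · rw [if_neg hs]; exact (hΦY k).le

theorem ReductiveData.detChar_eq_zero (D : ReductiveData ρ r) {z : A} {τ : ℂ →+ ℝ}
    (hz : ∀ (K : Submodule ℂ X) (hK : IsStable ρ K), τ (detChar ρ hK z) ≤ 0)
    {K : Submodule ℂ X} (hK : IsStable ρ K) (hNK : nullSub ρ ≤ K) :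
    τ (detChar ρ hK z) = 0 := by
  by_contra hne
  obtain ⟨K, ⟨hK, hNK, hne⟩, hmax⟩ := (wellFounded_gt (α := Submodule ℂ X)).has_min
    {K | ∃ hK : IsStable ρ K, nullSub ρ ≤ K ∧ τ (detChar ρ hK z) ≠ 0} ⟨K, hK, hNK, hne⟩
  have hKt : K ≠ ⊤ := fun h => hne (by
    rw [detChar_eq_zero_of_eq_top hK h, LinearMap.zero_apply, map_zero])
  obtain ⟨H, hKH, hH⟩ := exists_le_isMaxStable hK hKt
  have hNH := hNK.trans hKH
  have hDH := D.detChar_eq_zero_of_isMaxStable hz hH hNH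
  set N := nullSub ρ
  have hN : IsStable ρ N := nullSub_isStable ρ
  have hHY := IsMaxStable.map_mkQ hN hNH hH
  obtain ⟨C', hC', hcompl⟩ := D.hasCompl_quot _ hHY.stable
  have hcm : (H.map N.mkQ).comap N.mkQ = H := by
    rw [Submodule.comap_map_mkQ, sup_eq_right.2 hNH]
  set C := C'.comap N.mkQ with hCdef
  have hC : IsStable ρ C := IsStable.comap (fun x v => rfl) hC'
  have hNC : N ≤ C := by
    rw [hCdef]; intro u hu
    rw [Submodule.mem_comap, Submodule.mkQ_apply, (Submodule.Quotient.mk_eq_zero _).2 hu]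
    exact zero_mem _
  have hinf : C ⊓ H = N := by
    rw [← hcm, hCdef, ← Submodule.comap_inf, inf_comm, hcompl.inf_eq_bot, ← LinearMap.ker,
      Submodule.ker_mkQ]
  have hmapC : C.map N.mkQ = C' := Submodule.map_comap_eq_of_surjective N.mkQ_surjective C'
  have hsup : C ⊔ H = ⊤ := by
    have h1 : (C ⊔ H).map N.mkQ = ⊤ := by
      rw [Submodule.map_sup, hmapC, sup_comm, hcompl.sup_eq_top]
    have h2 : ((C ⊔ H).map N.mkQ).comap N.mkQ = C ⊔ H := by
      rw [Submodule.comap_map_mkQ, sup_eq_right.2 (hNH.trans le_sup_right)]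
    rw [← h2, h1, Submodule.comap_top]
  have hK1 := hK.sup hC
  have hinf' : (K ⊔ C) ⊓ H = K := by
    rw [sup_inf_assoc_of_le C hKH, hinf, sup_eq_left.2 hNK]
  have hsup' : (K ⊔ C) ⊔ H = ⊤ := by
    rw [sup_assoc, hsup, sup_top_eq]
  have hlt : K < K ⊔ C := by
    refine lt_of_le_of_ne le_sup_left fun h => hH.ne_top ?_
    rw [← hsup]
    exact (sup_eq_right.2 ((le_sup_right.trans h.ge).trans hKH)).symm
  have hDK1 : τ (detChar ρ hK1 z) = 0 := by
    by_contra hcon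
    exact hmax _ ⟨hK1, hNK.trans le_sup_left, hcon⟩ hlt
  have h1 := detChar_inf hK1 hH.stable hsup'
  have h2 : detChar ρ (hK1.inf hH.stable) = detChar ρ hK := by congr 1
  refine hne ?_
  rw [← h2, h1, LinearMap.add_apply, map_add, hDK1, hDH, add_zero]

end Stability

section Bound

variable {A X : Type} [AddCommGroup A] [Module ℂ A] [FiniteDimensional ℂ A]
  [AddCommGroup X] [Module ℂ X] [FiniteDimensional ℂ X]
  {M : Type} [AddCommGroup M] [Module ℂ M]
  {G : Type} [Group G] {ρ : A →ₗ[ℂ] X →ₗ[ℂ] X} {r : Representation ℂ G X}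

/-- The contragredient of a family of operators. -/
def dualAct (ρ : A →ₗ[ℂ] M →ₗ[ℂ] M) : A →ₗ[ℂ] Module.Dual ℂ M →ₗ[ℂ] Module.Dual ℂ M :=
  LinearMap.mk₂ ℂ (fun x ξ => -(ξ ∘ₗ ρ x))
    (fun x y ξ => by ext m; simp; ring) (fun c x ξ => by ext m; simp)
    (fun x ξ η => by ext m; simp; ring) (fun c x ξ => by ext m; simp)

@[simp] lemma dualAct_apply (ρ : A →ₗ[ℂ] M →ₗ[ℂ] M) (x : A) (ξ : Module.Dual ℂ M) (m : M) :
    dualAct ρ x ξ m = -(ξ (ρ x m)) := rfl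

/-- The form pairing a vector-valued multilinear map with a functional. -/
def dualForm {p : ℕ} (φ : MultilinearMap ℂ (fun _ : Fin p => X) M) :
    MultilinearMap ℂ (fun _ : Fin (p + 1) => X × Module.Dual ℂ M) ℂ :=
  LinearMap.uncurryLeft (M := fun _ : Fin (p + 1) => X × Module.Dual ℂ M)
    { toFun := fun e => e.2.compMultilinearMap (φ.compLinearMap fun _ => LinearMap.fst ℂ X _)
      map_add' := fun _ _ => rfl
      map_smul' := fun _ _ => rfl }

lemma dualForm_apply {p : ℕ} (φ : MultilinearMap ℂ (fun _ : Fin p => X) M)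
    (w : Fin (p + 1) → X × Module.Dual ℂ M) :
    dualForm φ w = (w 0).2 (φ fun i => (w i.succ).1) := rfl

lemma isInv_dualForm {p : ℕ} {ρM : A →ₗ[ℂ] M →ₗ[ℂ] M} {φ : MultilinearMap ℂ (fun _ : Fin p => X) M}
    (hφ : ∀ x v, ρM x (φ v) = der (ρ x) φ v) :
    IsInv (prodAct ρ (dualAct ρM)) (dualForm φ) := by
  intro x w
  rw [der, Fin.sum_univ_succ]
  simp only [dualForm_apply, Function.update_self, prodAct_apply, dualAct_apply]
  have h0 : ∀ (i : Fin p) e, Function.update w i.succ e 0 = w 0 := fun i e =>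
    Function.update_of_ne (Fin.succ_ne_zero i).symm _ _
  have h1 : ∀ (i : Fin p) e, Function.update w 0 e i.succ = w i.succ := fun i e =>
    Function.update_of_ne (Fin.succ_ne_zero i) _ _
  simp only [h0, h1]
  rw [← map_sum, hφ, neg_add_eq_zero, der]
  congr 1
  refine Finset.sum_congr rfl fun i _ => ?_
  congr 1
  funext j
  by_cases hj : j = i
  · subst hj; simp
  · rw [Function.update_of_ne hj, Function.update_of_ne (by simpa using hj)]

lemma exists_detChar_bound [FiniteDimensional ℂ M] (ρ : A →ₗ[ℂ] M →ₗ[ℂ] M) (z : A) (τ : ℂ →+ ℝ) :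
    ∃ c : ℝ, 0 < c ∧ ∀ (K : Submodule ℂ M) (hK : IsStable ρ K), τ (detChar ρ hK z) < c := by
  obtain ⟨c, hc⟩ := ((finite_detChar ρ).image fun χ => τ (χ z)).bddAbove
  refine ⟨max c 0 + 1, by positivity, fun K hK => ?_⟩
  have := hc ⟨_, ⟨K, hK, rfl⟩, rfl⟩
  exact lt_of_le_of_lt this (lt_of_le_of_lt (le_max_left _ _) (lt_add_one _))

lemma exists_pos_lt_of_neg (ρ : A →ₗ[ℂ] X →ₗ[ℂ] X) (z : A) (τ : ℂ →+ ℝ)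
    (h : ∀ (K : Submodule ℂ X) (hK : IsStable ρ K), K ≠ ⊤ → τ (detChar ρ hK z) < 0) :
    ∃ ε : ℝ, 0 < ε ∧ ∀ (K : Submodule ℂ X) (hK : IsStable ρ K), K ≠ ⊤ →
      τ (detChar ρ hK z) < -ε := by
  have hf : ((fun χ : A →ₗ[ℂ] ℂ => τ (χ z)) ''
      {χ | ∃ (K : Submodule ℂ X) (hK : IsStable ρ K), K ≠ ⊤ ∧ χ = detChar ρ hK}).Finite :=
    ((finite_detChar ρ).subset (by rintro _ ⟨K, hK, -, rfl⟩; exact ⟨K, hK, rfl⟩)).image _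
  rcases Set.eq_empty_or_nonempty ((fun χ : A →ₗ[ℂ] ℂ => τ (χ z)) ''
      {χ | ∃ (K : Submodule ℂ X) (hK : IsStable ρ K), K ≠ ⊤ ∧ χ = detChar ρ hK}) with he | hne
  · refine ⟨1, one_pos, fun K hK hKt => ?_⟩
    exact (Set.eq_empty_iff_forall_notMem.1 he _ ⟨_, ⟨K, hK, hKt, rfl⟩, rfl⟩).elim
  · obtain ⟨_, ⟨_, ⟨K₀, hK₀, hK₀t, rfl⟩, rfl⟩, hmax⟩ := Set.exists_max_image _ id hf hne
    refine ⟨-(τ (detChar ρ hK₀ z)) / 2, by have := h K₀ hK₀ hK₀t; linarith, fun K hK hKt => ?_⟩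
    have h1 := hmax _ ⟨_, ⟨K, hK, hKt, rfl⟩, rfl⟩
    have h2 := h K₀ hK₀ hK₀t
    simp only [id] at h1
    linarith

open Classical in
/-- Equivariant multilinear maps into a fixed finite-dimensional space vanish when many arguments
lie in the null subspace. -/
theorem ReductiveData.exists_bound [FiniteDimensional ℂ M] (D : ReductiveData ρ r)
    (ρM : A →ₗ[ℂ] M →ₗ[ℂ] M) :
    ∃ J : ℕ, ∀ (p : ℕ) (φ : MultilinearMap ℂ (fun _ : Fin p => X) M),
      (∀ x v, ρM x (φ v) = der (ρ x) φ v) → ∀ v : Fin p → X,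
      J < (Finset.univ.filter fun i => v i ∈ nullSub ρ).card → φ v = 0 := by
  obtain ⟨z, τ, hz⟩ := exists_detChar_le ρ
  set N := nullSub ρ with hNdef
  have hN : IsStable ρ N := nullSub_isStable ρ
  have hD := fun {K} hK => D.detChar_eq_zero (fun K hK => (hz K hK).1) (K := K) hK
  let a := Module.finBasis ℂ A
  have ha : Submodule.span ℂ (Set.range a) = ⊤ := a.span_eq
  obtain ⟨ε, hε, hεN⟩ := exists_pos_lt_of_neg (subAct ρ hN) z τ (by
    intro K hK hKt
    have hK' : IsStable ρ (K.map N.subtype) := IsStable.map (fun x v => rfl) hK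
    rw [detChar_of_le hN hK hK' rfl, LinearMap.sub_apply, map_sub, hD hN le_rfl, sub_zero]
    refine (hz _ hK').2 fun hle => hKt ?_
    rw [eq_top_iff]
    rintro ⟨u, hu⟩ -
    obtain ⟨k, hk, hku⟩ := hle hu
    have : k = ⟨u, hu⟩ := Subtype.ext hku
    rwa [← this])
  set ε' : ℝ := ε / (Module.finrank ℂ N + 1)
  have hε' : 0 < ε' := by positivity
  obtain ⟨ΦN, hΦN⟩ := exists_frame_of_detChar_lt (subAct ρ hN) ha z τ (-ε') (by
    intro K hK hKt
    refine (hεN K hK hKt).trans_le ?_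
    have h1 : ε' * (Module.finrank ℂ N + 1) = ε := by
      simp only [ε']; field_simp
    have h2 : (0 : ℝ) ≤ Module.finrank ℂ K := by positivity
    nlinarith)
  obtain ⟨c, hc0, hc⟩ := exists_detChar_bound (dualAct ρM) z τ
  obtain ⟨ΦM, hΦM⟩ := exists_frame_of_detChar_lt (dualAct ρM) ha z τ c (by
    intro K hK hKt
    refine (hc K hK).trans_le (le_mul_of_one_le_right hc0.le ?_)
    have h1 : Module.finrank ℂ K + 1 ≤ Module.finrank ℂ (Module.Dual ℂ M) :=
      Submodule.finrank_lt hKt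
    have h2 : ((Module.finrank ℂ K + 1 : ℕ) : ℝ) ≤ Module.finrank ℂ (Module.Dual ℂ M) := by
      exact_mod_cast h1
    push_cast at h2
    linarith)
  obtain ⟨J, hJ⟩ := exists_nat_gt ((c + 1) / ε')
  refine ⟨J, fun p φ hφ => ?_⟩
  by_contra! hcon
  obtain ⟨v₁, hv₁, hφ₁⟩ := hcon
  obtain ⟨m, ⟨v₀, hv₀, rfl⟩, hmax⟩ := Set.exists_max_image
    {m | ∃ v, φ v ≠ 0 ∧ (Finset.univ.filter fun i => v i ∈ N).card = m} id
    ((Set.finite_le_nat p).subset (by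
      rintro _ ⟨v, -, rfl⟩
      have := Finset.card_filter_le (Finset.univ : Finset (Fin p)) fun i => v i ∈ N
      simpa using this)) ⟨_, v₁, hφ₁, rfl⟩
  set T := Finset.univ.filter fun i => v₀ i ∈ N with hT
  have hJT : J < T.card := hv₁.trans_le (hmax _ ⟨v₁, hφ₁, rfl⟩)
  have hkill : ∀ w : Fin p → X, (∀ i ∈ T, w i ∈ N) → (∃ i, i ∉ T ∧ w i ∈ N) → φ w = 0 := by
    rintro w hw ⟨i, hi, hwi⟩
    by_contra hne
    have h1 := hmax _ ⟨w, hne, rfl⟩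
    have h2 : T.card < (Finset.univ.filter fun i => w i ∈ N).card :=
      Finset.card_lt_card (Finset.ssubset_iff_of_subset (fun j hj => by simpa using hw j hj) |>.2
        ⟨i, by simpa using hwi, hi⟩)
    exact absurd h1 (not_le.2 h2)
  set δ : ℝ := 1 / (p + 1) with hδ
  have hδpos : 0 < δ := by positivity
  obtain ⟨ΦY, hΦY⟩ := exists_frame_of_detChar_lt (quotAct ρ hN) ha z τ δ (by
    intro K hK hKt
    have h1 : detChar ρ (IsStable.comap (π := N.mkQ) (fun x v => rfl) hK) =
      detChar (quotAct ρ hN) hK := detChar_comap (fun x v => rfl) N.mkQ_surjective _ _ rfl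
    rw [← h1]
    refine ((hz _ _).1).trans_lt (mul_pos hδpos (sub_pos.2 ?_))
    exact_mod_cast Submodule.finrank_lt hKt)
  obtain ⟨σ, hσ⟩ := exists_section N
  obtain ⟨ξ, hξ⟩ := Module.Projective.exists_dual_ne_zero ℂ hv₀
  let lX : Fin p → (N × (X ⧸ N)) →ₗ[ℂ] X := fun i =>
    if i ∈ T then N.subtype ∘ₗ LinearMap.fst ℂ _ _ else σ ∘ₗ LinearMap.snd ℂ _ _
  let l : Fin (p + 1) → ((N × (X ⧸ N)) × Module.Dual ℂ M) →ₗ[ℂ] X × Module.Dual ℂ M :=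
    Fin.cons (LinearMap.inr ℂ _ _ ∘ₗ LinearMap.snd ℂ _ _)
      fun i => LinearMap.inl ℂ _ _ ∘ₗ lX i ∘ₗ LinearMap.fst ℂ _ _
  have hl0 : ∀ e, l 0 e = (0, e.2) := fun e => rfl
  have hls : ∀ (i : Fin p) e, l i.succ e = (lX i e.1, 0) := fun i e => rfl
  have hlT : ∀ i ∈ T, ∀ e, lX i e = e.1 := fun i hi e => by simp [lX, hi]
  have hlT' : ∀ i, i ∉ T → ∀ e, lX i e = σ e.2 := fun i hi e => by simp [lX, hi]
  let w₀ : Fin (p + 1) → (N × (X ⧸ N)) × Module.Dual ℂ M :=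
    Fin.cons ((0, 0), ξ) fun i =>
      ((if h : v₀ i ∈ N then ⟨v₀ i, h⟩ else 0, N.mkQ (v₀ i)), 0)
  have hw₀ : dualForm φ (fun t => l t (w₀ t)) = ξ (φ v₀) := by
    rw [dualForm_apply, hl0]
    change ξ (φ fun i => (l i.succ (w₀ i.succ)).1) = _
    congr 1
    set w : Fin p → X := fun i => (l i.succ (w₀ i.succ)).1 with hw
    have hwT : ∀ i ∈ T, w i = v₀ i := by
      intro i hi
      have : v₀ i ∈ N := by simpa [hT] using hi
      simp only [hw, hls, hlT i hi, w₀, Fin.cons_succ, dif_pos this]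
    have hwT' : ∀ i, i ∉ T → w i - v₀ i ∈ N := by
      intro i hi
      simp only [hw, hls, hlT' i hi, w₀, Fin.cons_succ]
      rw [← Submodule.Quotient.mk_eq_zero, ← Submodule.mkQ_apply, map_sub, hσ, sub_self]
    have hsplit : w = v₀ + (w - v₀) := by abel
    rw [hsplit, MultilinearMap.map_add_univ, Finset.sum_eq_single Finset.univ]
    · congr 1; funext s; simp
    · intro U _ hU
      obtain ⟨s, hs⟩ : ∃ s, s ∉ U := by
        by_contra! h; exact hU (Finset.eq_univ_of_forall h)
      by_cases hsT : s ∈ T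
      · refine φ.map_coord_zero s ?_
        rw [Finset.piecewise_eq_of_notMem _ _ _ hs, Pi.sub_apply, hwT s hsT, sub_self]
      · refine hkill _ (fun i hi => ?_) ⟨s, hsT, ?_⟩
        · by_cases hiU : i ∈ U
          · rw [Finset.piecewise_eq_of_mem _ _ _ hiU]; simpa [hT] using hi
          · rw [Finset.piecewise_eq_of_notMem _ _ _ hiU, Pi.sub_apply, hwT i hi, sub_self]
            exact zero_mem _
        · rw [Finset.piecewise_eq_of_notMem _ _ _ hs]
          exact hwT' s hsT
    · simp
  have hmain := ((ΦN.prod ΦY).prod ΦM).sum_le_zero τ (isInv_dualForm hφ) l ?_ (v := w₀)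
    (by rwa [hw₀]) (Fin.cons (-c) fun i => if i ∈ T then ε' else -δ) ?_
  · rw [Fin.sum_univ_succ] at hmain
    simp only [Fin.cons_zero, Fin.cons_succ] at hmain
    rw [Finset.sum_ite, Finset.sum_const, Finset.sum_const, nsmul_eq_mul, nsmul_eq_mul,
      Finset.filter_mem_eq_inter, Finset.univ_inter] at hmain
    have h1 : ((Finset.univ.filter fun s => s ∉ T).card : ℝ) ≤ p := by
      have := Finset.card_filter_le (Finset.univ : Finset (Fin p)) fun s => s ∉ T
      rw [Finset.card_univ, Fintype.card_fin] at this
      exact_mod_cast this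
    have h2 := mul_le_mul_of_nonneg_right h1 hδpos.le
    have h3 : (p : ℝ) * δ ≤ 1 := by
      rw [hδ, mul_one_div, div_le_one (by positivity)]; linarith
    have h4 : (J : ℝ) < T.card := by exact_mod_cast hJT
    have h5 := (div_lt_iff₀ hε').1 (hJ.trans h4)
    linarith
  · intro x w s
    refine Fin.cases ?_ (fun i => ?_) s
    · congr 2
      simp only [hl0, prodAct_apply, map_zero]
    · by_cases hi : i ∈ T
      · congr 2
        simp only [hls, prodAct_apply, map_zero, hlT i hi, coe_subAct_apply]
      · rw [← sub_eq_zero, ← MultilinearMap.map_update_sub, dualForm_apply, hkill, map_zero]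
        · intro j hj
          have hji : j.succ ≠ i.succ := fun h => hi (Fin.succ_injective _ h ▸ hj)
          rw [Function.update_of_ne hji, hls, hlT j hj]
          exact Subtype.property _
        · refine ⟨i, hi, ?_⟩
          rw [Function.update_self]
          simp only [hls, prodAct_apply, map_zero, hlT' i hi]
          exact section_sub_mem hN hσ x _
  · intro s k
    refine Fin.cases ?_ (fun i => ?_) s
    · intro hk
      rcases k with k | k
      · exact absurd (by rw [hl0]; rfl) hk
      · rw [Frame.prod_κ_inr]; exact (hΦM k).le
    · intro hk
      rw [Fin.cons_succ]
      rcases k with (k | k) | k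
      · refine le_of_le_of_eq ?_
          ((Frame.prod_κ_inl _ _ τ _).trans (Frame.prod_κ_inl _ _ τ k)).symm
        by_cases hi : i ∈ T
        · rw [if_pos hi]; have := hΦN k; linarith
        · exact absurd (by rw [hls, hlT' i hi]; simp [Frame.prod]) hk
      · refine le_of_le_of_eq ?_
          ((Frame.prod_κ_inl _ _ τ _).trans (Frame.prod_κ_inr _ _ τ k)).symm
        by_cases hi : i ∈ T
        · exact absurd (by rw [hls, hlT i hi]; simp [Frame.prod]) hk
        · rw [if_neg hi]; exact (hΦY k).le
      · exact absurd (by rw [hls]; simp [Frame.prod]) hk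

end Bound

section Polarization

variable {S : Type} [Fintype S] [DecidableEq S] {E F : Type} [AddCommGroup E] [Module ℂ E]
  [AddCommGroup F] [Module ℂ F]

lemma hasDerivAt_line_aux (f : MultilinearMap ℂ (fun _ : S => E) ℂ) (w : S → E) (T : Finset S) :
    ∀ v : S → E, HasDerivAt (fun ε : ℂ => f fun i => if i ∈ T then v i + ε • w i else v i)
      (∑ s ∈ T, f (Function.update v s (w s))) 0 := by
  induction T using Finset.induction_on with
  | empty => intro v; simpa using hasDerivAt_const (0 : ℂ) (f v)
  | insert a T ha ih =>
    intro v
    have h1 : ∀ ε : ℂ, (f fun i => if i ∈ insert a T then v i + ε • w i else v i) =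
        (f fun i => if i ∈ T then v i + ε • w i else v i) +
          ε * f fun i => if i ∈ T then Function.update v a (w a) i + ε • w i
            else Function.update v a (w a) i := by
      intro ε
      have e1 : (fun i => if i ∈ insert a T then v i + ε • w i else v i) =
          Function.update (fun i => if i ∈ T then v i + ε • w i else v i) a (v a + ε • w a) := by
        funext i
        by_cases hi : i = a
        · subst hi; simp
        · simp [hi]
      have e2 : (fun i => if i ∈ T then v i + ε • w i else v i) =
          Function.update (fun i => if i ∈ T then v i + ε • w i else v i) a (v a) := by
        funext i
        by_cases hi : i = a
        · subst hi; simp [ha]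
        · simp [hi]
      have e3 : (fun i => if i ∈ T then Function.update v a (w a) i + ε • w i
          else Function.update v a (w a) i) =
          Function.update (fun i => if i ∈ T then v i + ε • w i else v i) a (w a) := by
        funext i
        by_cases hi : i = a
        · subst hi; simp [ha]
        · simp [hi]
      rw [e1, f.map_update_add, f.map_update_smul, ← e2, e3, smul_eq_mul]
    have h2 := (ih v).add ((hasDerivAt_id (0 : ℂ)).mul (ih (Function.update v a (w a))))
    refine (h2.congr_of_eventuallyEq (Filter.Eventually.of_forall h1)).congr_deriv ?_
    rw [Finset.sum_insert ha]
    simp [add_comm]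

/-- The derivative of a multilinear form along a line. -/
lemma hasDerivAt_line (f : MultilinearMap ℂ (fun _ : S => E) ℂ) (v w : S → E) :
    HasDerivAt (fun ε : ℂ => f fun i => v i + ε • w i) (∑ s, f (Function.update v s (w s))) 0 := by
  simpa using hasDerivAt_line_aux f w Finset.univ v

lemma hasDerivAt_der (f : MultilinearMap ℂ (fun _ : S => E) ℂ) (z : E →ₗ[ℂ] E) (v : E) :
    HasDerivAt (fun ε : ℂ => f fun _ => v + ε • z v) (der z f fun _ => v) 0 :=
  hasDerivAt_line f _ _

lemma eq_of_forall_dual {a b : F} (h : ∀ ξ : Module.Dual ℂ F, ξ a = ξ b) : a = b := by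
  rw [← sub_eq_zero, ← Module.forall_dual_apply_eq_zero_iff ℂ]
  intro ξ
  rw [map_sub, h, sub_self]

/-- A symmetric multilinear map that vanishes on the diagonal is zero. -/
theorem eq_zero_of_diag {p : ℕ} (f : MultilinearMap ℂ (fun _ : Fin p => E) F)
    (hs : ∀ (v : Fin p → E) (σ : Equiv.Perm (Fin p)), f (v ∘ σ) = f v)
    (h0 : ∀ v, (f fun _ => v) = 0) : f = 0 := by
  induction p with
  | zero =>
    ext v
    rw [zero_apply, ← h0 0]
    congr 1
    exact Subsingleton.elim _ _
  | succ p ih =>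
    have key : ∀ w : E, f.curryLeft w = 0 := by
      intro w
      refine ih _ (fun v σ => ?_) fun v => ?_
      · rw [MultilinearMap.curryLeft_apply, MultilinearMap.curryLeft_apply,
          ← hs (Fin.cons w v) (Equiv.Perm.decomposeFin.symm (0, σ))]
        congr 1
        funext i
        refine Fin.cases ?_ (fun i => ?_) i <;> simp
      · refine eq_of_forall_dual fun ξ => ?_
        have h1 := hasDerivAt_line (ξ.compMultilinearMap f) (fun _ => v) fun _ => w
        have h2 : ∑ s, (ξ.compMultilinearMap f) (Function.update (fun _ => v) s w) = 0 := by
          refine h1.unique ((hasDerivAt_const (0 : ℂ) (0 : ℂ)).congr_of_eventuallyEq ?_)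
          exact Filter.Eventually.of_forall fun ε => by simp [h0]
        have h3 : ∀ s : Fin (p + 1), (ξ.compMultilinearMap f) (Function.update (fun _ => v) s w) =
            ξ (f.curryLeft w fun _ => v) := by
          intro s
          rw [LinearMap.compMultilinearMap_apply, MultilinearMap.curryLeft_apply,
            ← hs _ (Equiv.swap 0 s)]
          congr 2
          funext i
          refine Fin.cases ?_ (fun i => ?_) i
          · simp
          · rw [Fin.cons_succ, Function.comp_apply, Function.update_apply, if_neg]
            intro h
            rw [Equiv.swap_apply_eq_iff, Equiv.swap_apply_right] at h
            exact Fin.succ_ne_zero i h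
        rw [Finset.sum_congr rfl fun s _ => h3 s, Finset.sum_const, Finset.card_univ,
          Fintype.card_fin, nsmul_eq_mul, mul_eq_zero] at h2
        rw [map_zero]
        exact h2.resolve_left (by exact_mod_cast Nat.succ_ne_zero p)
    ext v
    rw [← Fin.cons_self_tail v, ← MultilinearMap.curryLeft_apply, key]
    rfl

/-- Symmetrization of a multilinear map. -/
def symmetrize {p : ℕ} (f : MultilinearMap ℂ (fun _ : Fin p => E) F) :
    MultilinearMap ℂ (fun _ : Fin p => E) F :=
  (p.factorial : ℂ)⁻¹ • ∑ σ : Equiv.Perm (Fin p), f.domDomCongr σ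

lemma symmetrize_apply {p : ℕ} (f : MultilinearMap ℂ (fun _ : Fin p => E) F) (v : Fin p → E) :
    symmetrize f v = (p.factorial : ℂ)⁻¹ • ∑ σ : Equiv.Perm (Fin p), f (v ∘ σ) := by
  simp [symmetrize, Function.comp_def]

lemma symmetrize_comp {p : ℕ} (f : MultilinearMap ℂ (fun _ : Fin p => E) F) (v : Fin p → E)
    (σ : Equiv.Perm (Fin p)) : symmetrize f (v ∘ σ) = symmetrize f v := by
  rw [symmetrize_apply, symmetrize_apply]
  congr 1
  exact Equiv.sum_comp (Equiv.mulLeft σ) fun τ : Equiv.Perm (Fin p) => f (v ∘ τ)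

lemma symmetrize_diag {p : ℕ} (f : MultilinearMap ℂ (fun _ : Fin p => E) F) (v : E) :
    (symmetrize f fun _ => v) = f fun _ => v := by
  rw [symmetrize_apply]
  have : ∀ σ : Equiv.Perm (Fin p), ((fun _ => v) ∘ σ : Fin p → E) = fun _ => v := fun σ => rfl
  simp only [this, Finset.sum_const, Finset.card_univ, Fintype.card_perm, Fintype.card_fin]
  rw [← Nat.cast_smul_eq_nsmul ℂ, smul_smul, inv_mul_cancel₀, one_smul]
  exact_mod_cast p.factorial_ne_zero

lemma der_symmetrize {p : ℕ} (z : E →ₗ[ℂ] E) (f : MultilinearMap ℂ (fun _ : Fin p => E) F)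
    (v : Fin p → E) : der z (symmetrize f) v =
      (p.factorial : ℂ)⁻¹ • ∑ σ : Equiv.Perm (Fin p), der z f (v ∘ σ) := by
  simp only [← der_domDomCongr]
  simp only [← derMap_apply, symmetrize, map_smul, map_sum]
  simp

/-- Comparison of coefficients of a polynomial curve. -/
lemma eq_sum_of_forall_pow_smul {κ : Type} (J : Finset κ) (d : κ → ℕ) (a : κ → F) (u : F) (p : ℕ)
    (h : ∀ t : ℂ, t ^ p • u = ∑ j ∈ J, t ^ d j • a j) :
    u = ∑ j ∈ J with d j = p, a j := by
  refine eq_of_forall_dual fun ξ => ?_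
  have h1 : (Polynomial.monomial p (ξ u) : Polynomial ℂ) =
      ∑ j ∈ J, Polynomial.monomial (d j) (ξ (a j)) := by
    refine Polynomial.funext fun t => ?_
    have := congrArg ξ (h t)
    rw [map_smul, map_sum] at this
    simpa [Polynomial.eval_finsetSum, mul_comm] using this
  have h2 := congrArg (fun q => Polynomial.coeff q p) h1
  simpa [Polynomial.finsetSum_coeff, Polynomial.coeff_monomial, Finset.sum_filter,
    apply_ite ξ] using h2

lemma map_smul_diag {p : ℕ} (f : MultilinearMap ℂ (fun _ : Fin p => E) F) (t : ℂ) (v : E) :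
    (f fun _ => t • v) = t ^ p • f fun _ => v := by
  rw [f.map_smul_univ (fun _ => t) fun _ => v, Fin.prod_const]

end Polarization

section Noether

variable {X M : Type} [AddCommGroup X] [Module ℂ X] [FiniteDimensional ℂ X]
  [AddCommGroup M] [Module ℂ M] [FiniteDimensional ℂ M]

lemma expand_diag {p : ℕ} {F ι : Type} [AddCommGroup F] [Module ℂ F] [Fintype ι]
    (e : Module.Basis ι ℂ X)
    (f : MultilinearMap ℂ (fun _ : Fin p => X) F) (w : Fin p → X) :
    f w = ∑ j : Fin p → ι, (∏ i, e.repr (w i) (j i)) • f fun i => e (j i) := by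
  classical
  have : w = fun i => ∑ k, e.repr (w i) k • e k := funext fun i => (e.sum_repr (w i)).symm
  conv_lhs => rw [this]
  rw [f.map_sum]
  exact Finset.sum_congr rfl fun j _ => f.map_smul_univ _ _

/-- Polynomial functions on a vector space that factor through the quotient by a subspace. -/
def quotPoly (N : Submodule ℂ X) : Subalgebra ℂ (X → ℂ) :=
  Algebra.adjoin ℂ (Set.range fun j => fun v => (Module.finBasis ℂ (X ⧸ N)).repr (N.mkQ v) j)

instance (N : Submodule ℂ X) : IsNoetherianRing (quotPoly N) :=
  isNoetherianRing_of_fg (Subalgebra.fg_def.2 ⟨_, Set.finite_range _, rfl⟩)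

lemma comp_mkQ_mem_quotPoly (N : Submodule ℂ X) (l : Module.Dual ℂ (X ⧸ N)) :
    (fun v => l (N.mkQ v)) ∈ quotPoly N := by
  have : (fun v => l (N.mkQ v)) = ∑ j, l (Module.finBasis ℂ (X ⧸ N) j) •
      fun v => (Module.finBasis ℂ (X ⧸ N)).repr (N.mkQ v) j := by
    funext v
    conv_lhs => rw [← (Module.finBasis ℂ (X ⧸ N)).sum_repr (N.mkQ v)]
    rw [map_sum, Finset.sum_apply]
    refine Finset.sum_congr rfl fun j _ => ?_
    rw [map_smul, Pi.smul_apply, smul_eq_mul, smul_eq_mul, mul_comm]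
  rw [this]
  exact Subalgebra.sum_mem _ fun j _ => Subalgebra.smul_mem _
    (Algebra.subset_adjoin (Set.mem_range_self j)) _

/-- The module of functions at most linear over `quotPoly N`. -/
def affinePoly (N : Submodule ℂ X) : Submodule (quotPoly N) (X → ℂ) :=
  Submodule.span _ (insert 1 (Set.range fun j => fun v => (Module.finBasis ℂ X).repr v j))

lemma affinePoly_fg (N : Submodule ℂ X) : (affinePoly N).FG :=
  Submodule.fg_span ((Set.finite_range _).insert _)

lemma smul_mem_of_mem_quotPoly {N : Submodule ℂ X} {F : Type} [AddCommGroup F] [Module ℂ F]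
    {W : Submodule (quotPoly N) (X → F)} {s : X → ℂ} (hs : s ∈ quotPoly N) {f : X → F}
    (hf : f ∈ W) : s • f ∈ W :=
  W.smul_mem ⟨s, hs⟩ hf

lemma const_smul_mem {N : Submodule ℂ X} {F : Type} [AddCommGroup F] [Module ℂ F]
    {W : Submodule (quotPoly N) (X → F)} (c : ℂ) {f : X → F} (hf : f ∈ W) : c • f ∈ W :=
  smul_mem_of_mem_quotPoly (Subalgebra.algebraMap_mem (quotPoly N) c) hf

lemma dual_mem_affinePoly (N : Submodule ℂ X) (l : Module.Dual ℂ X) :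
    (fun v => l v) ∈ affinePoly N := by
  have : (fun v => l v) = ∑ j, l (Module.finBasis ℂ X j) •
      fun v => (Module.finBasis ℂ X).repr v j := by
    funext v
    conv_lhs => rw [← (Module.finBasis ℂ X).sum_repr v]
    rw [map_sum, Finset.sum_apply]
    refine Finset.sum_congr rfl fun j _ => ?_
    rw [map_smul, Pi.smul_apply, smul_eq_mul, smul_eq_mul, mul_comm]
  rw [this]
  exact Submodule.sum_mem _ fun j _ =>
    const_smul_mem _ (Submodule.subset_span (Set.mem_insert_of_mem _ ⟨j, rfl⟩))

lemma prod_mem_affinePoly_pow {N : Submodule ℂ X} {ι : Type} (T : Finset ι) (g : ι → X → ℂ)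
    (hg : ∀ i ∈ T, g i ∈ affinePoly N) : ∏ i ∈ T, g i ∈ affinePoly N ^ T.card := by
  classical
  induction T using Finset.induction_on with
  | empty => simp
  | insert a T ha ih =>
    rw [Finset.prod_insert ha, Finset.card_insert_of_notMem ha, pow_succ']
    exact Submodule.mul_mem_mul (hg a (Finset.mem_insert_self _ _))
      (ih fun i hi => hg i (Finset.mem_insert_of_mem hi))

lemma affinePoly_pow_mono (N : Submodule ℂ X) {j k : ℕ} (h : j ≤ k) :
    affinePoly N ^ j ≤ affinePoly N ^ k := by
  refine pow_le_pow_right' ?_ h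
  rw [Submodule.one_le]
  exact Submodule.subset_span (Set.mem_insert _ _)

open Classical in
lemma diag_mem_affinePoly_pow (N : Submodule ℂ X) {p J : ℕ}
    (f : MultilinearMap ℂ (fun _ : Fin p => X) ℂ)
    (hf : ∀ v : Fin p → X, J < (Finset.univ.filter fun i => v i ∈ N).card → f v = 0) :
    (fun v => f fun _ => v) ∈ affinePoly N ^ J := by
  obtain ⟨σ, hσ⟩ := exists_section N
  let R : X →ₗ[ℂ] X := σ ∘ₗ N.mkQ
  let L : X →ₗ[ℂ] X := LinearMap.id - R
  have hL : ∀ v, L v ∈ N := fun v => by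
    rw [← Submodule.Quotient.mk_eq_zero, ← Submodule.mkQ_apply]
    rw [LinearMap.sub_apply, map_sub, LinearMap.comp_apply, hσ, LinearMap.id_apply, sub_self]
  let T : Finset (Fin p) → Fin p → X →ₗ[ℂ] X := fun U i => if i ∈ U then R else L
  have h1 : (fun v => f fun _ => v) = ∑ U : Finset (Fin p), fun v => f fun i => T U i v := by
    funext v
    rw [Finset.sum_apply]
    have : (fun _ : Fin p => v) = (fun _ => R v) + fun _ => L v := by
      funext i; simp [L]
    rw [this, f.map_add_univ]
    refine Finset.sum_congr rfl fun U _ => congrArg f (funext fun i => ?_)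
    by_cases hi : i ∈ U <;> simp [T, hi]
  rw [h1]
  refine Submodule.sum_mem _ fun U _ => ?_
  by_cases hU : J < Uᶜ.card
  · have : (fun v => f fun i => T U i v) = 0 := by
      funext v
      refine hf _ (hU.trans_le (Finset.card_le_card fun i hi => ?_))
      rw [Finset.mem_compl] at hi
      simpa [T, hi] using hL v
    rw [this]
    exact zero_mem _
  · refine affinePoly_pow_mono N (not_lt.1 hU) ?_
    let e := Module.finBasis ℂ X
    have h2 : (fun v => f fun i => T U i v) = ∑ j : Fin p → Fin (Module.finrank ℂ X),
        (f fun i => e (j i)) •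
          ((∏ i ∈ U, fun v => e.repr (T U i v) (j i)) * ∏ i ∈ Uᶜ, fun v => e.repr (T U i v) (j i)) := by
      funext v
      rw [expand_diag e, Finset.sum_apply]
      refine Finset.sum_congr rfl fun j _ => ?_
      rw [Finset.prod_mul_prod_compl, Pi.smul_apply, Finset.prod_apply, smul_eq_mul, smul_eq_mul,
        mul_comm]
    rw [h2]
    refine Submodule.sum_mem _ fun j _ => const_smul_mem _ ?_
    refine smul_mem_of_mem_quotPoly (Subalgebra.prod_mem _ fun i hi => ?_)
      (prod_mem_affinePoly_pow _ _ fun i hi => ?_)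
    · have : (fun v => e.repr (T U i v) (j i)) = fun v => (e.coord (j i) ∘ₗ σ) (N.mkQ v) := by
        funext v; simp [T, hi, R]
      rw [this]
      exact comp_mkQ_mem_quotPoly N _
    · exact dual_mem_affinePoly N (e.coord (j i) ∘ₗ T U i)

/-- Evaluation on the diagonal. -/
def diag (φ : Σ p : ℕ, MultilinearMap ℂ (fun _ : Fin p => X) M) : X → M := fun v => φ.2 fun _ => v

open Classical in
theorem exists_finset_span_diag (N : Submodule ℂ X) (J : ℕ)
    (S : Set (Σ p : ℕ, MultilinearMap ℂ (fun _ : Fin p => X) M))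
    (hS : ∀ φ ∈ S, ∀ v : Fin φ.1 → X,
      J < (Finset.univ.filter fun i => v i ∈ N).card → φ.2 v = 0) :
    ∃ T : Finset (Σ p : ℕ, MultilinearMap ℂ (fun _ : Fin p => X) M), ↑T ⊆ S ∧
      ∀ φ ∈ S, diag φ ∈ Submodule.span (quotPoly N) (diag '' (T : Set _)) := by
  let m := Module.finBasis ℂ M
  let W : Submodule (quotPoly N) (X → ℂ) := affinePoly N ^ J
  have hWfg : W.FG := (affinePoly_fg N).pow J
  have : IsNoetherian (quotPoly N) W := isNoetherian_of_fg_of_noetherian W hWfg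
  let ev : (Fin (Module.finrank ℂ M) → W) →ₗ[quotPoly N] (X → M) :=
    { toFun := fun s v => ∑ j, (s j : X → ℂ) v • m j
      map_add' := fun s t => by
        funext v; simp [add_smul, Finset.sum_add_distrib]
      map_smul' := fun c s => by
        funext v
        change _ = (c : X → ℂ) v • ∑ j, (s j : X → ℂ) v • m j
        rw [Finset.smul_sum]
        refine Finset.sum_congr rfl fun j _ => ?_
        rw [smul_smul]
        rfl }
  have : IsNoetherian (quotPoly N) (Fin (Module.finrank ℂ M) → W) :=
    @isNoetherian_pi (quotPoly N) _ _ _ (fun _ => W) _ _ fun _ => this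
  have : IsNoetherian (quotPoly N) (LinearMap.range ev) := isNoetherian_range ev
  have hle : Submodule.span (quotPoly N) (diag '' S) ≤ LinearMap.range ev := by
    rw [Submodule.span_le]
    rintro _ ⟨φ, hφ, rfl⟩
    refine ⟨fun j => ⟨fun v => m.coord j (diag φ v), ?_⟩, ?_⟩
    · exact diag_mem_affinePoly_pow N ((m.coord j).compMultilinearMap φ.2) fun v hv => by
        rw [LinearMap.compMultilinearMap_apply, hS φ hφ v hv, map_zero]
    · funext v
      exact m.sum_repr _
  have hfg : (Submodule.span (quotPoly N) (diag '' S)).FG := isNoetherian_submodule.1 this _ hle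
  obtain ⟨T', hT', heq⟩ := Submodule.fg_span_iff_fg_span_finset_subset _ |>.1 hfg
  obtain ⟨T, hTS, rfl⟩ := Finset.subset_set_image_iff.1 hT'
  refine ⟨T, hTS, fun φ hφ => ?_⟩
  rw [← Finset.coe_image, ← heq]
  exact Submodule.subset_span ⟨φ, hφ, rfl⟩

end Noether

section Homogeneous

variable {X Y : Type} [AddCommGroup X] [Module ℂ X] [AddCommGroup Y] [Module ℂ Y]

/-- Homogeneous polynomial functions of a given degree pulled back along a linear map. -/
def homFun (π : X →ₗ[ℂ] Y) (k : ℕ) : Submodule ℂ (X → ℂ) :=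
  LinearMap.range
    ({ toFun := fun c v => c fun _ => π v
       map_add' := fun _ _ => rfl
       map_smul' := fun _ _ => rfl } :
      MultilinearMap ℂ (fun _ : Fin k => Y) ℂ →ₗ[ℂ] (X → ℂ))

lemma mem_homFun {π : X →ₗ[ℂ] Y} {k : ℕ} {f : X → ℂ} : f ∈ homFun π k ↔
    ∃ c : MultilinearMap ℂ (fun _ : Fin k => Y) ℂ, (fun v => c fun _ => π v) = f := Iff.rfl

lemma mul_mem_homFun {π : X →ₗ[ℂ] Y} {k l : ℕ} {f g : X → ℂ} (hf : f ∈ homFun π k)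
    (hg : g ∈ homFun π l) : f * g ∈ homFun π (k + l) := by
  obtain ⟨c, rfl⟩ := mem_homFun.1 hf
  obtain ⟨c', rfl⟩ := mem_homFun.1 hg
  refine mem_homFun.2 ⟨(mulForm c c').domDomCongr finSumFinEquiv, ?_⟩
  funext v
  exact mulForm_apply c c' fun _ => π v

lemma adjoin_le_iSup_homFun (π : X →ₗ[ℂ] Y) {S : Set (X → ℂ)}
    (hS : ∀ f ∈ S, ∃ l : Module.Dual ℂ Y, f = fun v => l (π v)) :
    Subalgebra.toSubmodule (Algebra.adjoin ℂ S) ≤ ⨆ k, homFun π k := by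
  intro s hs
  rw [Subalgebra.mem_toSubmodule] at hs
  induction hs using Algebra.adjoin_induction with
  | mem f hf =>
    obtain ⟨l, rfl⟩ := hS f hf
    exact Submodule.mem_iSup_of_mem 1 (mem_homFun.2 ⟨l.compMultilinearMap
      (MultilinearMap.ofSubsingleton ℂ Y Y (0 : Fin 1) LinearMap.id), rfl⟩)
  | algebraMap c =>
    exact Submodule.mem_iSup_of_mem 0
      (mem_homFun.2 ⟨MultilinearMap.constOfIsEmpty ℂ _ c, rfl⟩)
  | add f g _ _ hf hg => exact add_mem hf hg
  | mul f g _ _ hf hg =>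
    refine Submodule.iSup_induction _ (motive := fun f => f * g ∈ ⨆ k, homFun π k) hf
      (fun k f hf => ?_) (by rw [zero_mul]; exact zero_mem _)
      (fun f f' hf hf' => by rw [add_mul]; exact add_mem hf hf')
    refine Submodule.iSup_induction _ (motive := fun g => f * g ∈ ⨆ k, homFun π k) hg
      (fun l g hg => ?_) (by rw [mul_zero]; exact zero_mem _)
      (fun g g' hg hg' => by rw [mul_add]; exact add_mem hg hg')
    exact Submodule.mem_iSup_of_mem _ (mul_mem_homFun hf hg)

lemma exists_components {π : X →ₗ[ℂ] Y} {s : X → ℂ} (hs : s ∈ ⨆ k, homFun π k) :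
    ∃ (n : ℕ) (c : ∀ k, MultilinearMap ℂ (fun _ : Fin k => Y) ℂ),
      ∀ v, s v = ∑ k ∈ Finset.range n, c k fun _ => π v := by
  classical
  obtain ⟨f, hf, rfl⟩ := (Submodule.mem_iSup_iff_exists_finsupp _ _).1 hs
  choose c hc using fun k => mem_homFun.1 (hf k)
  refine ⟨f.support.sup id + 1, c, fun v => ?_⟩
  rw [Finsupp.sum, Finset.sum_apply]
  have h1 : ∀ k, (c k fun _ => π v) = f k v := fun k => congrFun (hc k) v
  simp only [h1]
  refine Finset.sum_subset (fun k hk => ?_) fun k _ hk => ?_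
  · exact Finset.mem_range_succ_iff.2 (Finset.le_sup (f := id) hk)
  · rw [Finsupp.notMem_support_iff.1 hk]; rfl

/-- If a homogeneous function is a combination of homogeneous functions with polynomial
coefficients, then the coefficients may be taken homogeneous. -/
lemma exists_homogeneous_coeff {M : Type} [AddCommGroup M] [Module ℂ M] {I : Type} [DecidableEq I]
    (π : X →ₗ[ℂ] Y) (T : Finset I) (d : I → ℕ) (n : I → X → M) (s : I → X → ℂ) (p : ℕ) (u : X → M)
    (hn : ∀ i (t : ℂ) v, n i (t • v) = t ^ d i • n i v) (hu : ∀ (t : ℂ) v, u (t • v) = t ^ p • u v)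
    (Pr : ∀ k, MultilinearMap ℂ (fun _ : Fin k => Y) ℂ → Prop) (h0 : ∀ k, Pr k 0)
    (hs : ∀ i, ∃ (n : ℕ) (c : ∀ k, MultilinearMap ℂ (fun _ : Fin k => Y) ℂ),
      (∀ k, Pr k (c k)) ∧ ∀ v, s i v = ∑ k ∈ Finset.range n, c k fun _ => π v)
    (h : ∀ v, u v = ∑ i ∈ T, s i v • n i v) :
    ∃ c : ∀ i, MultilinearMap ℂ (fun _ : Fin (p - d i) => Y) ℂ, (∀ i, Pr _ (c i)) ∧
      ∀ v, u v = ∑ i ∈ T with d i ≤ p, (c i fun _ => π v) • n i v := by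
  choose Q c hPr hc using hs
  refine ⟨fun i => if p - d i < Q i then c i (p - d i) else 0, fun i => ?_, fun v => ?_⟩
  · dsimp only
    split_ifs
    exacts [hPr _ _, h0 _]
  have h1 := eq_sum_of_forall_pow_smul (T.sigma fun i => Finset.range (Q i))
    (fun j => j.2 + d j.1) (fun j => (c j.1 j.2 fun _ => π v) • n j.1 v) (u v) p (fun t => by
      rw [← hu, h, Finset.sum_sigma]
      refine Finset.sum_congr rfl fun i hi => ?_
      rw [hc i, Finset.sum_smul]
      refine Finset.sum_congr rfl fun k _ => ?_
      simp only [map_smul, map_smul_diag, hn, smul_smul, smul_eq_mul]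
      congr 1
      ring)
  rw [h1, Finset.sum_filter, Finset.sum_filter, Finset.sum_sigma]
  refine Finset.sum_congr rfl fun i hi => ?_
  by_cases hip : d i ≤ p
  · rw [if_pos hip]
    have h2 : ∀ k, (k + d i = p) ↔ k = p - d i := fun k => by omega
    simp only [h2]
    rw [Finset.sum_ite_eq']
    by_cases hk : p - d i < Q i
    · simp [hk]
    · simp [hk]
  · rw [if_neg hip]
    refine Finset.sum_eq_zero fun k _ => if_neg ?_
    simp only
    omega

end Homogeneous

section Lift

variable {A X : Type} [AddCommGroup A] [Module ℂ A] [FiniteDimensional ℂ A]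
  [AddCommGroup X] [Module ℂ X] [FiniteDimensional ℂ X]
  {M : Type} [AddCommGroup M] [Module ℂ M]
  {G : Type} [Group G] {ρ : A →ₗ[ℂ] X →ₗ[ℂ] X} {r : Representation ℂ G X}
  {ρM : A →ₗ[ℂ] M →ₗ[ℂ] M}

/-- Equivariance of a multilinear map. -/
def IsEquivariant {S : Type} [Fintype S] [DecidableEq S] (ρ : A →ₗ[ℂ] X →ₗ[ℂ] X)
    (ρM : A →ₗ[ℂ] M →ₗ[ℂ] M) (φ : MultilinearMap ℂ (fun _ : S => X) M) : Prop :=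
  ∀ x v, ρM x (φ v) = der (ρ x) φ v

lemma sum_der_smul_eq_zero {N : Submodule ℂ X} (hN : IsStable ρ N) {I : Type} [Fintype I]
    {q p : I → ℕ} {p₀ : ℕ} {c : ∀ i, MultilinearMap ℂ (fun _ : Fin (q i) => X ⧸ N) ℂ}
    {φ : ∀ i, MultilinearMap ℂ (fun _ : Fin (p i) => X) M}
    {φ₀ : MultilinearMap ℂ (fun _ : Fin p₀ => X) M}
    (hφ : ∀ i, IsEquivariant ρ ρM (φ i)) (hφ₀ : IsEquivariant ρ ρM φ₀)
    (h : ∀ v, (φ₀ fun _ => v) = ∑ i, (c i fun _ => N.mkQ v) • φ i fun _ => v) (x : A) (v : X) :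
    ∑ i, (der (quotAct ρ hN x) (c i) fun _ => N.mkQ v) • (φ i fun _ => v) = 0 := by
  refine eq_of_forall_dual fun ξ => ?_
  have e1 : ∀ {k : ℕ} (ψ : MultilinearMap ℂ (fun _ : Fin k => X) M), IsEquivariant ρ ρM ψ →
      HasDerivAt (fun ε : ℂ => ξ (ψ fun _ => v + ε • ρ x v)) (ξ (ρM x (ψ fun _ => v))) 0 := by
    intro k ψ hψ
    rw [hψ x]
    have := hasDerivAt_der (ξ.compMultilinearMap ψ) (ρ x) v
    refine this.congr_deriv ?_
    simp [der]
  have e2 : ∀ i, HasDerivAt (fun ε : ℂ => c i fun _ => N.mkQ (v + ε • ρ x v))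
      (der (quotAct ρ hN x) (c i) fun _ => N.mkQ v) 0 := by
    intro i
    have := hasDerivAt_der ((c i).compLinearMap fun _ => N.mkQ) (ρ x) v
    rw [der_compLinearMap (T' := quotAct ρ hN x) (fun v => (quotAct_mkQ ρ hN x v).symm)] at this
    exact this
  have e3 := HasDerivAt.fun_sum (u := Finset.univ) fun i _ => (e2 i).mul (e1 (φ i) (hφ i))
  have e4 := (e1 φ₀ hφ₀).unique (e3.congr_of_eventuallyEq (Filter.Eventually.of_forall fun ε => by
    simp [h]))
  rw [h, map_sum, map_sum, Finset.sum_add_distrib] at e4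
  simp only [zero_smul, add_zero, map_smul, smul_eq_mul] at e4
  rw [map_sum, map_zero]
  simp only [map_smul, smul_eq_mul]
  linear_combination -e4

open Classical in
/-- Coefficients of an equivariant combination may be taken invariant. -/
theorem ReductiveData.exists_invariant_coeff (D : ReductiveData ρ r)
    (T : Finset (Σ p : ℕ, MultilinearMap ℂ (fun _ : Fin p => X) M))
    (hT : ∀ ψ ∈ T, IsEquivariant ρ ρM ψ.2)
    {φ : Σ p : ℕ, MultilinearMap ℂ (fun _ : Fin p => X) M} (hφ : IsEquivariant ρ ρM φ.2)
    (h : diag φ ∈ Submodule.span (quotPoly (nullSub ρ)) (diag '' (T : Set _))) :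
    ∃ b : ∀ ψ : {ψ // ψ ∈ T.filter fun ψ => ψ.1 ≤ φ.1},
        MultilinearMap ℂ (fun _ : Fin (φ.1 - ψ.1.1) => X) ℂ,
      (∀ ψ, IsInv ρ (b ψ)) ∧ ∀ v, diag φ v = ∑ ψ, (b ψ fun _ => v) • diag ψ.1 v := by
  set N := nullSub ρ
  have hN : IsStable ρ N := nullSub_isStable ρ
  obtain ⟨s, hs⟩ := (Submodule.mem_span_image_finset_iff_exists_fun' _).1 h
  obtain ⟨c, -, hc⟩ := exists_homogeneous_coeff N.mkQ T (fun ψ => ψ.1) diag (fun ψ => (s ψ : X → ℂ))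
    φ.1 (diag φ) (fun ψ t v => map_smul_diag ψ.2 t v) (fun t v => map_smul_diag φ.2 t v)
    (fun _ _ => True) (fun _ => trivial)
    (fun ψ => by
      obtain ⟨n, c, hc⟩ := exists_components (adjoin_le_iSup_homFun N.mkQ (by
        rintro _ ⟨j, rfl⟩
        exact ⟨(Module.finBasis ℂ (X ⧸ N)).coord j, rfl⟩) (s ψ).2)
      exact ⟨n, c, fun _ => trivial, hc⟩) (fun v => by
      rw [← hs, Finset.sum_apply]; rfl)
  let I := {ψ // ψ ∈ T.filter fun ψ => ψ.1 ≤ φ.1}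
  let _ : Fintype I := inferInstanceAs (Fintype {ψ // ψ ∈ T.filter fun ψ => ψ.1 ≤ φ.1})
  have hI : ∀ i : I, IsEquivariant ρ ρM i.1.2 := fun i => hT _ (Finset.mem_filter.1 i.2).1
  have hc' : ∀ v, diag φ v = ∑ i : I, (c i.1 fun _ => N.mkQ v) • diag i.1 v := fun v => by
    rw [hc, ← Finset.sum_coe_sort]
  let K : Submodule ℂ (∀ i : I, MultilinearMap ℂ (fun _ : Fin (φ.1 - i.1.1) => X ⧸ N) ℂ) :=
    { carrier := {t | ∀ v, ∑ i : I, (t i fun _ => N.mkQ v) • diag i.1 v = 0}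
      add_mem' := fun {t t'} ht ht' v => by
        have h1 := ht v
        have h2 := ht' v
        simp only [Pi.add_apply, add_apply, add_smul, Finset.sum_add_distrib]
        rw [h1, h2, add_zero]
      zero_mem' := fun v => by simp
      smul_mem' := fun a t ht v => by
        have h1 := ht v
        simp only [Pi.smul_apply, smul_apply, smul_assoc, ← Finset.smul_sum]
        rw [h1, smul_zero] }
  have hK : ∀ t, t ∈ K ↔ ∀ v, ∑ i : I, (t i fun _ => N.mkQ v) • diag i.1 v = 0 := fun t => Iff.rfl
  obtain ⟨k, hk, hinv⟩ := exists_invariant_mod (ρ := quotAct ρ hN) D.hasCompl_quot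
    (Module.finBasis ℂ A).span_eq (fun i : I => φ.1 - i.1.1) K
    (fun x t ht => by
      rw [hK] at ht ⊢
      intro v
      simp only [derMap_apply]
      exact sum_der_smul_eq_zero (p₀ := 0) (φ₀ := 0) hN hI
        (fun x v => by simp [der]) (fun v => (ht v).symm) x v)
    (fun i => c i.1)
    (fun x => by
      rw [hK]
      intro v
      simp only [derMap_apply]
      exact sum_der_smul_eq_zero hN hI hφ hc' x v)
  refine ⟨fun i => (c i.1 - k i).compLinearMap fun _ => N.mkQ, fun i x v => ?_, fun v => ?_⟩
  · rw [der_compLinearMap (T' := quotAct ρ hN x) (fun v => (quotAct_mkQ ρ hN x v).symm),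
      ← derMap_apply, hinv]
    rfl
  · have h2 := (hK k).1 hk v
    simp only [MultilinearMap.compLinearMap_apply, sub_apply, sub_smul,
      Finset.sum_sub_distrib]
    rw [h2, sub_zero]
    exact hc' v

end Lift

section FiniteGeneration

variable {A X : Type} [AddCommGroup A] [Module ℂ A] [FiniteDimensional ℂ A]
  [AddCommGroup X] [Module ℂ X] [FiniteDimensional ℂ X]
  {M : Type} [AddCommGroup M] [Module ℂ M]
  {G : Type} [Group G] {ρ : A →ₗ[ℂ] X →ₗ[ℂ] X} {r : Representation ℂ G X}
  {ρM : A →ₗ[ℂ] M →ₗ[ℂ] M}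

open ClassicalStructure (polyFuns polyMapsDeg)

lemma diag_mem_polyMapsDeg {p : ℕ} {F : Type} [AddCommGroup F] [Module ℂ F]
    (f : MultilinearMap ℂ (fun _ : Fin p => X) F) : (fun v => f fun _ => v) ∈ polyMapsDeg p X F := by
  have : (fun v => f fun _ => v) = ∑ j : Fin p → Fin (Module.finrank ℂ X), fun v =>
      (∏ i, (Module.finBasis ℂ X).coord (j i) v) • f fun i => Module.finBasis ℂ X (j i) := by
    funext v
    rw [expand_diag (Module.finBasis ℂ X), Finset.sum_apply]
    rfl
  rw [this]
  exact Submodule.sum_mem _ fun j _ => Submodule.subset_span ⟨_, _, rfl⟩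

lemma diag_mem_polyFuns {p : ℕ} (f : MultilinearMap ℂ (fun _ : Fin p => X) ℂ) :
    (fun v => f fun _ => v) ∈ polyFuns X := by
  have h : polyMapsDeg p X ℂ ≤ Subalgebra.toSubmodule (polyFuns X) := by
    refine Submodule.span_le.2 ?_
    rintro _ ⟨l, w, rfl⟩
    have : (fun v => (∏ i, l i v) • w) = (∏ i, (l i : X → ℂ)) * algebraMap ℂ (X → ℂ) w := by
      funext v
      simp
    rw [this]
    exact (Subalgebra.mem_toSubmodule _).2 (mul_mem (Subalgebra.prod_mem _ fun i _ => Algebra.subset_adjoin ⟨l i, rfl⟩)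
      (Subalgebra.algebraMap_mem _ w))
  exact h (diag_mem_polyMapsDeg f)

/-- The property of being the ring of invariant polynomial functions. -/
def IsInvariantRing (r : Representation ℂ G X) (R : Subalgebra ℂ (X → ℂ)) : Prop :=
  ∀ f, f ∈ R ↔ f ∈ polyFuns X ∧ ∀ s v, f (r s v) = f v

namespace ReductiveData

lemma diag_mem (D : ReductiveData ρ r) {R : Subalgebra ℂ (X → ℂ)} (hR : IsInvariantRing r R) {p : ℕ}
    {f : MultilinearMap ℂ (fun _ : Fin p => X) ℂ} (hf : IsInv ρ f) : (fun v => f fun _ => v) ∈ R :=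
  (hR _).2 ⟨diag_mem_polyFuns f, fun s v => (D.inv_iff _ f).2 hf s fun _ => v⟩

lemma exists_isInv_components (D : ReductiveData ρ r) {R : Subalgebra ℂ (X → ℂ)}
    (hR : IsInvariantRing r R) {f : X → ℂ}
    (hf : f ∈ R) : ∃ (n : ℕ) (c : ∀ k, MultilinearMap ℂ (fun _ : Fin k => X) ℂ),
      (∀ k, IsInv ρ (c k)) ∧ ∀ v, f v = ∑ k ∈ Finset.range n, c k fun _ => v := by
  obtain ⟨hf1, hf2⟩ := (hR f).1 hf
  obtain ⟨n, c, hc⟩ := exists_components (adjoin_le_iSup_homFun LinearMap.id (by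
    rintro _ ⟨l, rfl⟩
    exact ⟨l, rfl⟩) hf1)
  have hinv : ∀ k ∈ Finset.range n, ∀ s v, (c k fun _ => r s v) = c k fun _ => v := by
    intro k hk s v
    have := eq_sum_of_forall_pow_smul (Finset.range n) (fun k => k)
      (fun k => (c k fun _ => r s v) - c k fun _ => v) 0 k (fun t => by
        have h1 := hf2 s (t • v)
        rw [hc, hc, ← sub_eq_zero, ← Finset.sum_sub_distrib] at h1
        rw [smul_zero, ← h1]
        refine Finset.sum_congr rfl fun j _ => ?_
        simp only [map_smul, LinearMap.id_apply, map_smul_diag, smul_sub])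
    rw [Finset.sum_filter, Finset.sum_ite_eq', if_pos hk] at this
    exact sub_eq_zero.1 this.symm
  refine ⟨n, fun k => if k < n then symmetrize (c k) else 0, fun k => ?_, fun v => ?_⟩
  · dsimp only
    split_ifs with hk
    · rw [← D.inv_iff]
      intro s v
      have := eq_zero_of_diag ((symmetrize (c k)).compLinearMap (fun _ => r s) - symmetrize (c k))
        (fun v σ => by
          have := symmetrize_comp (c k) (fun i => r s (v i)) σ
          simp only [sub_apply, MultilinearMap.compLinearMap_apply, symmetrize_comp]
          rw [← this]
          rfl)
        (fun v => by
          simp only [sub_apply, MultilinearMap.compLinearMap_apply, symmetrize_diag]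
          rw [hinv k (Finset.mem_range.2 hk), sub_self])
      exact sub_eq_zero.1 (congrArg (fun f => f v) this)
    · intro x v
      simp [der]
  · rw [hc]
    refine Finset.sum_congr rfl fun k hk => ?_
    dsimp only
    rw [if_pos (Finset.mem_range.1 hk), symmetrize_diag]
    rfl

/-- The ring of invariants of a reductive group is finitely generated. -/
theorem invariantRing_fg (D : ReductiveData ρ r) {R : Subalgebra ℂ (X → ℂ)}
    (hR : IsInvariantRing r R) : R.FG := by
  classical
  have heq : ∀ {p : ℕ} {f : MultilinearMap ℂ (fun _ : Fin p => X) ℂ}, IsInv ρ f →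
      IsEquivariant ρ (0 : A →ₗ[ℂ] ℂ →ₗ[ℂ] ℂ) f := fun hf x v => (hf x v).symm
  obtain ⟨T, hT, hspan⟩ := exists_finset_span_diag (nullSub ρ) 0
    {φ : Σ p : ℕ, MultilinearMap ℂ (fun _ : Fin p => X) ℂ | 1 ≤ φ.1 ∧ IsInv ρ φ.2}
    (fun φ hφ v hv => by
      obtain ⟨i, hi⟩ := Finset.card_pos.1 hv
      exact hφ.2.apply_eq_zero (Finset.mem_filter.1 hi).2)
  have key : ∀ (p : ℕ) (f : MultilinearMap ℂ (fun _ : Fin p => X) ℂ), IsInv ρ f →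
      (fun v => f fun _ => v) ∈ Algebra.adjoin ℂ (diag '' (T : Set _)) := by
    intro p
    induction p using Nat.strong_induction_on with
    | _ p ih =>
      intro f hf
      rcases Nat.eq_zero_or_pos p with rfl | hp
      · have : (fun v : X => f fun _ => v) = algebraMap ℂ (X → ℂ) (f 0) := by
          funext v
          exact congrArg f (Subsingleton.elim _ _)
        rw [this]
        exact Subalgebra.algebraMap_mem _ _
      · obtain ⟨b, hb, hsum⟩ := D.exists_invariant_coeff T (fun ψ hψ => heq (hT hψ).2)
          (φ := ⟨p, f⟩) (heq hf) (hspan ⟨p, f⟩ ⟨hp, hf⟩)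
        have : (fun v => f fun _ => v) = ∑ ψ, (fun v => b ψ fun _ => v) * diag ψ.1 := by
          funext v
          rw [Finset.sum_apply]
          exact hsum v
        rw [this]
        refine Subalgebra.sum_mem _ fun ψ _ => mul_mem (ih _ ?_ _ (hb ψ))
          (Algebra.subset_adjoin ⟨_, (Finset.mem_filter.1 ψ.2).1, rfl⟩)
        have := (hT (Finset.mem_filter.1 ψ.2).1).1
        dsimp only
        omega
  refine Subalgebra.fg_def.2 ⟨diag '' (T : Set _), T.finite_toSet.image _, le_antisymm ?_ ?_⟩
  · refine Algebra.adjoin_le ?_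
    rintro _ ⟨ψ, hψ, rfl⟩
    exact D.diag_mem hR (hT hψ).2
  · intro f hf
    obtain ⟨n, c, hc, hfc⟩ := D.exists_isInv_components hR hf
    have : f = ∑ k ∈ Finset.range n, fun v => c k fun _ => v := by
      funext v
      rw [hfc, Finset.sum_apply]
    rw [this]
    exact Subalgebra.sum_mem _ fun k _ => key k _ (hc k)

/-- Any family of equivariant maps is generated over the invariants by finitely many members. -/
theorem exists_finset_generators (D : ReductiveData ρ r) [FiniteDimensional ℂ M]
    {R : Subalgebra ℂ (X → ℂ)}
    (hR : IsInvariantRing r R) (S : Set (Σ p : ℕ, MultilinearMap ℂ (fun _ : Fin p => X) M))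
    (hS : ∀ φ ∈ S, IsEquivariant ρ ρM φ.2) :
    ∃ T : Finset (Σ p : ℕ, MultilinearMap ℂ (fun _ : Fin p => X) M), ↑T ⊆ S ∧
      ∀ φ ∈ S, ∃ b : ∀ ψ : Σ p : ℕ, MultilinearMap ℂ (fun _ : Fin p => X) M,
          MultilinearMap ℂ (fun _ : Fin (φ.1 - ψ.1) => X) ℂ,
        (∀ ψ, IsInv ρ (b ψ)) ∧
        ∀ v, diag φ v = ∑ ψ ∈ T with ψ.1 ≤ φ.1, (b ψ fun _ => v) • diag ψ v := by
  classical
  have hRn : IsNoetherianRing R := isNoetherianRing_of_fg (D.invariantRing_fg hR)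
  obtain ⟨J, hJ⟩ := D.exists_bound ρM
  obtain ⟨T₀, hT₀, hspan⟩ := exists_finset_span_diag (nullSub ρ) J
    {φ : Σ p : ℕ, MultilinearMap ℂ (fun _ : Fin p => X) M | IsEquivariant ρ ρM φ.2}
    (fun φ hφ v hv => hJ _ φ.2 hφ v hv)
  have hle : Submodule.span R (diag '' S) ≤ Submodule.span R (diag '' (T₀ : Set _)) := by
    rw [Submodule.span_le]
    rintro _ ⟨φ, hφ, rfl⟩
    obtain ⟨b, hb, hsum⟩ := D.exists_invariant_coeff T₀ (fun ψ hψ => hT₀ hψ) (hS φ hφ)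
      (hspan φ (hS φ hφ))
    have : diag φ = ∑ ψ, (⟨_, D.diag_mem hR (hb ψ)⟩ : R) • diag ψ.1 := by
      funext v
      rw [Finset.sum_apply]
      exact hsum v
    rw [this]
    exact Submodule.sum_mem _ fun ψ _ => Submodule.smul_mem _ _
      (Submodule.subset_span ⟨_, (Finset.mem_filter.1 ψ.2).1, rfl⟩)
  have hno : IsNoetherian R (Submodule.span R (diag (X := X) (M := M) '' T₀)) :=
    isNoetherian_of_fg_of_noetherian _ (by
      rw [← Finset.coe_image]
      exact ⟨_, rfl⟩)
  have hfg : (Submodule.span R (diag '' S)).FG := isNoetherian_submodule.1 hno _ hle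
  obtain ⟨T', hT', heq⟩ := Submodule.fg_span_iff_fg_span_finset_subset _ |>.1 hfg
  obtain ⟨T, hTS, rfl⟩ := Finset.subset_set_image_iff.1 hT'
  refine ⟨T, hTS, fun φ hφ => ?_⟩
  have hmem : diag φ ∈ Submodule.span R (diag '' (T : Set _)) := by
    rw [← Finset.coe_image, ← heq]
    exact Submodule.subset_span ⟨φ, hφ, rfl⟩
  obtain ⟨s, hs⟩ := (Submodule.mem_span_image_finset_iff_exists_fun' _).1 hmem
  exact exists_homogeneous_coeff LinearMap.id T (fun ψ => ψ.1) diag (fun ψ => (s ψ : X → ℂ))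
    φ.1 (diag φ) (fun ψ t v => map_smul_diag ψ.2 t v) (fun t v => map_smul_diag φ.2 t v)
    (fun _ f => IsInv ρ f) (fun _ x v => by simp [der])
    (fun ψ => D.exists_isInv_components hR (s ψ).2) (fun v => by
      rw [← hs, Finset.sum_apply]; rfl)

end ReductiveData

end FiniteGeneration

section FormSMul

variable {A X : Type} [AddCommGroup A] [Module ℂ A] [AddCommGroup X] [Module ℂ X]
  {M : Type} [AddCommGroup M] [Module ℂ M] {ρ : A →ₗ[ℂ] X →ₗ[ℂ] X} {ρM : A →ₗ[ℂ] M →ₗ[ℂ] M}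

/-- The external product of a form and a multilinear map. -/
def mulMap {S T : Type} (b : MultilinearMap ℂ (fun _ : S => X) ℂ)
    (φ : MultilinearMap ℂ (fun _ : T => X) M) : MultilinearMap ℂ (fun _ : S ⊕ T => X) M :=
  (TensorProduct.lid ℂ M).toLinearMap.compMultilinearMap (b.domCoprod φ)

lemma mulMap_apply {S T : Type} (b : MultilinearMap ℂ (fun _ : S => X) ℂ)
    (φ : MultilinearMap ℂ (fun _ : T => X) M) (v : S ⊕ T → X) :
    mulMap b φ v = b (v ∘ Sum.inl) • φ (v ∘ Sum.inr) := by
  simp [mulMap, MultilinearMap.domCoprod, MultilinearMap.domCoprodDep, Function.comp_def]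

lemma IsInv.mulMap {S T : Type} [Fintype S] [DecidableEq S] [Fintype T] [DecidableEq T]
    {b : MultilinearMap ℂ (fun _ : S => X) ℂ} {φ : MultilinearMap ℂ (fun _ : T => X) M}
    (hb : IsInv ρ b) (hφ : IsEquivariant ρ ρM φ) : IsEquivariant ρ ρM (mulMap b φ) := by
  intro x v
  have h := hb x (v ∘ Sum.inl)
  rw [mulMap_apply, map_smul, hφ]
  simp only [der, Fintype.sum_sum_type, mulMap_apply, Sum.update_inl_comp_inl,
    Sum.update_inl_comp_inr, Sum.update_inr_comp_inl, Sum.update_inr_comp_inr,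
    Finset.smul_sum] at h ⊢
  rw [← Finset.sum_smul]
  erw [h]
  rw [zero_smul, zero_add]
  rfl

/-- The symmetric product of a form and a multilinear map. -/
def symMul {q s : ℕ} (b : MultilinearMap ℂ (fun _ : Fin q => X) ℂ)
    (φ : MultilinearMap ℂ (fun _ : Fin s => X) M) : MultilinearMap ℂ (fun _ : Fin (q + s) => X) M :=
  symmetrize ((mulMap b φ).domDomCongr finSumFinEquiv)

lemma symMul_diag {q s : ℕ} (b : MultilinearMap ℂ (fun _ : Fin q => X) ℂ)
    (φ : MultilinearMap ℂ (fun _ : Fin s => X) M) (v : X) :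
    (symMul b φ fun _ => v) = (b fun _ => v) • φ fun _ => v := by
  rw [symMul, symmetrize_diag, MultilinearMap.domDomCongr_apply, mulMap_apply]
  rfl

lemma IsInv.symMul {q s : ℕ} {b : MultilinearMap ℂ (fun _ : Fin q => X) ℂ}
    {φ : MultilinearMap ℂ (fun _ : Fin s => X) M} (hb : IsInv ρ b) (hφ : IsEquivariant ρ ρM φ) :
    IsEquivariant ρ ρM (symMul b φ) := by
  intro x v
  rw [KempfNess.symMul, der_symmetrize, symmetrize_apply, map_smul, map_sum]
  simp only [der_domDomCongr, MultilinearMap.domDomCongr_apply]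
  congr 1
  exact Finset.sum_congr rfl fun σ _ => hb.mulMap hφ x _

end FormSMul

end KempfNess

namespace ClassicalStructure

open KempfNess

variable {g : LieSuperalgebra} (C : ClassicalStructure g)

lemma reductiveData : ReductiveData g.b01 C.ρ1 where
  stable s K hK x u hu := by
    rw [Submodule.mem_comap, C.compat01]
    exact hK _ _ hu
  compl := C.reductive1
  inv_iff := C.diff_adjoint

lemma isInvariantRing : IsInvariantRing C.ρ1 C.invPolyFuns := fun _ => Iff.rfl

lemma diag_mem_invPolyDeg {q : ℕ} {b : MultilinearMap ℂ (fun _ : Fin q => g.V1) ℂ}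
    (hb : IsInv g.b01 b) : (fun v => b fun _ => v) ∈ C.invPolyDeg q :=
  letI := C.findim1
  ⟨diag_mem_polyMapsDeg b, fun s v => (C.reductiveData.inv_iff _ b).2 hb s fun _ => v⟩

end ClassicalStructure

namespace RelCohomology

open KempfNess

variable {g : LieSuperalgebra} {M : SuperModule g}

/-- The product of an invariant form and a cochain. -/
def mulCochain {q s : ℕ} {b : MultilinearMap ℂ (fun _ : Fin q => g.V1) ℂ} (hb : IsInv g.b01 b)
    {X : Type} [AddCommGroup X] [Module ℂ X] {ρ : g.V0 →ₗ[ℂ] X →ₗ[ℂ] X} (φ : cochain g s X ρ) :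
    cochain g (q + s) X ρ :=
  ⟨symMul b φ.1, fun v σ => symmetrize_comp _ v σ, hb.symMul φ.2.2⟩

lemma cochain_ext {s : ℕ} {X : Type} [AddCommGroup X] [Module ℂ X]
    {ρ : g.V0 →ₗ[ℂ] X →ₗ[ℂ] X} {φ ψ : cochain g s X ρ}
    (h : ∀ v, (φ.1 fun _ => v) = ψ.1 fun _ => v) : φ = ψ := by
  refine sub_eq_zero.1 (Subtype.ext (eq_zero_of_diag _ (φ - ψ).2.1 fun v => ?_))
  rw [Submodule.coe_sub, sub_apply, h, sub_self]

variable {d : ∀ p, Cochains M p →ₗ[ℂ] Cochains M (p + 1)}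

lemma IsKoszulDiff.mem_ker_iff (hd : IsKoszulDiff M d) {p : ℕ} {φ : Cochains M p} :
    φ ∈ LinearMap.ker (d p) ↔
      ∀ v, M.a10 v (φ.1.1 fun _ => v) = 0 ∧ M.a11 v (φ.2.1 fun _ => v) = 0 := by
  have hp : (p : ℂ) + 1 ≠ 0 := Nat.cast_add_one_ne_zero p
  have h1 : ∀ v, ((d p φ).1.1 fun _ => v) =
      ((-1 : ℂ) ^ (p + 1) * (p + 1)) • M.a11 v (φ.2.1 fun _ => v) := fun v => by
    rw [(hd p φ fun _ => v).1, mul_smul]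
    have : ∀ i : Fin (p + 1), Fin.removeNth i (fun _ => v) = fun _ => v := fun i => rfl
    simp only [this, Finset.sum_const, Finset.card_univ, Fintype.card_fin]
    rw [← Nat.cast_smul_eq_nsmul ℂ, Nat.cast_add_one]
  have h2 : ∀ v, ((d p φ).2.1 fun _ => v) =
      ((-1 : ℂ) ^ p * (p + 1)) • M.a10 v (φ.1.1 fun _ => v) := fun v => by
    rw [(hd p φ fun _ => v).2, mul_smul]
    have : ∀ i : Fin (p + 1), Fin.removeNth i (fun _ => v) = fun _ => v := fun i => rfl
    simp only [this, Finset.sum_const, Finset.card_univ, Fintype.card_fin]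
    rw [← Nat.cast_smul_eq_nsmul ℂ, Nat.cast_add_one]
  have hne : ∀ k, (-1 : ℂ) ^ k * (p + 1) ≠ 0 := fun k => mul_ne_zero (by simp) hp
  rw [LinearMap.mem_ker]
  constructor
  · intro h v
    have k1 := h1 v
    have k2 := h2 v
    rw [h] at k1 k2
    exact ⟨(smul_eq_zero.1 k2.symm).resolve_left (hne _),
      (smul_eq_zero.1 k1.symm).resolve_left (hne _)⟩
  · intro h
    refine Prod.ext (cochain_ext fun v => ?_) (cochain_ext fun v => ?_)
    · rw [h1, (h v).2, smul_zero]
      rfl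
    · rw [h2, (h v).1, smul_zero]
      rfl

/-- The product of an invariant form and a cocycle. -/
def mulCocycle (hd : IsKoszulDiff M d) {q s : ℕ}
    {b : MultilinearMap ℂ (fun _ : Fin q => g.V1) ℂ} (hb : IsInv g.b01 b)
    (φ : LinearMap.ker (d s)) : LinearMap.ker (d (q + s)) :=
  ⟨(mulCochain hb φ.1.1, mulCochain hb φ.1.2), hd.mem_ker_iff.2 fun v => by
    have h := hd.mem_ker_iff.1 φ.2 v
    simp only [mulCochain, symMul_diag, map_smul, h.1, h.2, smul_zero, and_self]⟩

/-- The multilinear map underlying a cocycle, with values in the full supermodule. -/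
def toMap (p : ℕ) (φ : LinearMap.ker (d p)) :
    Σ p : ℕ, MultilinearMap ℂ (fun _ : Fin p => g.V1) (M.M0 × M.M1) :=
  ⟨p, φ.1.1.1.prod φ.1.2.1⟩

lemma ext_of_diag {p : ℕ} {φ ψ : LinearMap.ker (d p)}
    (h : ∀ v, diag (toMap p φ) v = diag (toMap p ψ) v) : φ = ψ :=
  Subtype.ext (Prod.ext (cochain_ext fun v => congrArg Prod.fst (h v))
    (cochain_ext fun v => congrArg Prod.snd (h v)))

lemma toMap_injective (p : ℕ) : Function.Injective (toMap (d := d) p) := fun φ ψ h =>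
  ext_of_diag fun v => by rw [h]

lemma isEquivariant_toMap {p : ℕ} (φ : LinearMap.ker (d p)) :
    IsEquivariant g.b01 (prodAct M.a00 M.a01) (toMap p φ).2 := by
  intro x v
  refine Prod.ext ((φ.1.1.2.2 x v).trans ?_) ((φ.1.2.2.2 x v).trans ?_)
  · simp only [der, Prod.fst_sum]
    rfl
  · simp only [der, Prod.snd_sum]
    rfl

/-- The class of a cocycle. -/
def cls (p : ℕ) : LinearMap.ker (d p) →ₗ[ℂ] cohomology d p := Submodule.mkQ _

lemma diag_sum {p : ℕ} {ι : Type} (T : Finset ι) (χ : ι → LinearMap.ker (d p)) (v : g.V1) :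
    diag (toMap p (∑ i ∈ T, χ i)) v = ∑ i ∈ T, diag (toMap p (χ i)) v := by
  classical
  induction T using Finset.induction_on with
  | empty => rfl
  | insert i T hi ih =>
    rw [Finset.sum_insert hi, Finset.sum_insert hi, ← ih]
    rfl

end RelCohomology

/-! ## Statement 5

Let `g` be a classical Lie superalgebra and `M` a finite-dimensional `g`-supermodule
semisimple over `g₀`.  Then `H^•(g,g₀;ℂ)` is a finitely generated ℂ-algebra (realized
via `H^•(g,g₀;ℂ) ≅ S(g₁*)^{G₀}` as the algebra of invariant polynomial functions on
`g₁`), and `H^•(g,g₀;M)` is a finitely generated `H^•(g,g₀;ℂ)`-module (for the cup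
product action, characterized on cochains by evaluation on the diagonal). -/

open RelCohomology KempfNess in
theorem cohomology_finitely_generated
    (g : LieSuperalgebra) (C : ClassicalStructure g)
    (M : SuperModule g) (hM : ClassicalStructure.InF g M)
    -- the Koszul differential of the relative cochain complex `C^•(g,g₀;M)`
    (d : ∀ p, RelCohomology.Cochains M p →ₗ[ℂ] RelCohomology.Cochains M (p+1))
    (hd : RelCohomology.IsKoszulDiff M d)
    -- the action of `H^•(g,g₀;ℂ) ≅ S(g₁*)^{G₀}` on `H^•(g,g₀;M)`, given on
    -- cochains by multiplication (characterized by evaluation on the diagonal)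
    (actD : ∀ q p, ↥(ClassicalStructure.invPolyDeg C q) →ₗ[ℂ]
      RelCohomology.cohomology d p →ₗ[ℂ] RelCohomology.cohomology d (q+p))
    (hactD : ∀ (q p : ℕ) (f : ↥(ClassicalStructure.invPolyDeg C q))
      (φ : ↥(LinearMap.ker (d p))) (χ : ↥(LinearMap.ker (d (q+p)))),
      (∀ v : g.V1,
        χ.1.1.1 (fun _ => v) = (f.1 v) • (φ.1.1.1 (fun _ => v)) ∧
        χ.1.2.1 (fun _ => v) = (f.1 v) • (φ.1.2.1 (fun _ => v))) →
      actD q p f (Submodule.Quotient.mk φ) = Submodule.Quotient.mk χ) :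
    -- `H^•(g,g₀;ℂ) ≅ S(g₁*)^{G₀}` is a finitely generated ℂ-algebra
    (ClassicalStructure.invPolyFuns C).FG ∧
    -- `H^•(g,g₀;M)` is a finitely generated `H^•(g,g₀;ℂ)`-module
    (∃ (n : ℕ) (gens : ∀ r, Finset (RelCohomology.cohomology d r)),
      (∀ r, n < r → gens r = ∅) ∧
      ∀ (p : ℕ) (z : RelCohomology.cohomology d p),
        z ∈ Submodule.span ℂ
          { w : RelCohomology.cohomology d p |
            ∃ (q r : ℕ) (h : q + r = p) (f : ↥(ClassicalStructure.invPolyDeg C q))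
              (y : RelCohomology.cohomology d r),
              y ∈ gens r ∧ w = h ▸ (actD q r f y) }) := by
  classical
  have := C.findim0
  have := C.findim1
  have := hM.1.1
  have := hM.1.2
  refine ⟨C.reductiveData.invariantRing_fg C.isInvariantRing, ?_⟩
  obtain ⟨T, hTS, hT⟩ := C.reductiveData.exists_finset_generators (ρM := prodAct M.a00 M.a01)
    C.isInvariantRing {φ | ∃ p, ∃ z : LinearMap.ker (d p), toMap p z = φ} (by
      rintro _ ⟨p, z, rfl⟩
      exact isEquivariant_toMap z)
  let gens r : Finset (cohomology d r) :=
    (T.finite_toSet.preimage (toMap_injective (d := d) r).injOn).toFinset.image (cls r)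
  have mem_gens : ∀ {r} {z : LinearMap.ker (d r)}, toMap r z ∈ T → cls r z ∈ gens r :=
    fun hz => Finset.mem_image_of_mem _ ((Set.Finite.mem_toFinset _).2 hz)
  refine ⟨T.sup Sigma.fst, gens, fun r hr => ?_, fun p z => ?_⟩
  · refine Finset.image_eq_empty.2 (Finset.eq_empty_of_forall_notMem fun z hz => ?_)
    have hz' : z ∈ toMap r ⁻¹' (T : Set _) := (Set.Finite.mem_toFinset _).1 hz
    exact absurd (Finset.le_sup (f := Sigma.fst) (Finset.mem_coe.1 hz')) (not_le.2 hr)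
  obtain ⟨φ, rfl⟩ := Submodule.mkQ_surjective _ z
  obtain ⟨b, hb, hsum⟩ := hT _ ⟨p, φ, rfl⟩
  set W := { w : cohomology d p | ∃ (q r : ℕ) (h : q + r = p) (f : C.invPolyDeg q)
    (y : cohomology d r), y ∈ gens r ∧ w = h ▸ (actD q r f y) } with hW
  have key : ∀ ψ ∈ T.filter fun ψ => ψ.1 ≤ p, ∃ χ : LinearMap.ker (d p),
      (∀ v, diag (toMap p χ) v = (b ψ fun _ => v) • diag ψ v) ∧ cls p χ ∈ W := by
    intro ψ hψ
    obtain ⟨hψT, hψp⟩ := Finset.mem_filter.1 hψ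
    obtain ⟨r, y, rfl⟩ := hTS hψT
    have aux : ∀ (q : ℕ) (h : q + r = p) (c : MultilinearMap ℂ (fun _ : Fin q => g.V1) ℂ),
        IsInv g.b01 c → ∃ χ : LinearMap.ker (d p),
          (∀ v, diag (toMap p χ) v = (c fun _ => v) • diag (toMap r y) v) ∧ cls p χ ∈ W := by
      rintro q rfl c hc
      refine ⟨mulCocycle hd hc y, fun v => Prod.ext (symMul_diag _ _ v) (symMul_diag _ _ v),
        q, r, rfl, ⟨_, C.diag_mem_invPolyDeg hc⟩, cls r y, mem_gens hψT, ?_⟩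
      exact (hactD q r _ y _ fun v => ⟨symMul_diag _ _ v, symMul_diag _ _ v⟩).symm
    exact aux _ (Nat.sub_add_cancel hψp) _ (hb _)
  choose! χ hχ hχW using key
  have hφ : φ = ∑ ψ ∈ T with ψ.1 ≤ p, χ ψ := ext_of_diag fun v => by
    rw [diag_sum, hsum]
    exact Finset.sum_congr rfl fun ψ hψ => (hχ ψ hψ v).symm
  change cls p φ ∈ _
  rw [hφ, map_sum]
  exact Submodule.sum_mem _ fun ψ hψ => Submodule.subset_span (hχW ψ hψ)
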